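/- Let G be a finite group with |G| = |L₃(29)| = 2⁵·3·5·7²·13·29³·67 and degree pattern D(G) = D(L₃(29)) = (4,3,3,4,1,2,1), i.e., deg_G(2)=4, deg_G(3)=3, deg_G(5)=3, deg_G(7)=4, deg_G(13)=1, deg_G(29)=2, deg_G(67)=1. Then G is isomorphic to L₃(29). -/

import Mathlib

open scoped MatrixGroups

/-- Two distinct primes `p` and `q` dividing `|G|` are adjacent in the prime graph `Γ(G)`
of a finite group `G` iff `G` has an element of order `p * q`. -/
def primeGraphAdj (G : Type*) [Group G] (p q : ℕ) : Prop :=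
  p ≠ q ∧ p.Prime ∧ q.Prime ∧ p ∣ Nat.card G ∧ q ∣ Nat.card G ∧ ∃ g : G, orderOf g = p * q

open scoped Classical in
/-- The degree of a vertex `p` in the prime graph of `G`: the number of primes dividing `|G|`
that are adjacent to `p`. -/
noncomputable def primeGraphDeg (G : Type*) [Group G] (p : ℕ) : ℕ :=
  ((Nat.card G).primeFactors.filter (fun r => primeGraphAdj G p r)).card

set_option linter.unusedSectionVars false
set_option linter.unusedDecidableInType false
set_option linter.unusedFintypeInType false
set_option linter.unusedSimpArgs false

section
open Finset

section CharTheory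

variable {k : Type*} [Field k] {G : Type*} [Group G] [Fintype G]
  {ι : Type*} {d : ι → ℕ}
  (φ : MonoidAlgebra k G ≃ₐ[k] (∀ i, Matrix (Fin (d i)) (Fin (d i)) k))

/-- The `i`-th irreducible matrix representation. -/
noncomputable def wRep (i : ι) : G →* Matrix (Fin (d i)) (Fin (d i)) k where
  toFun g := φ (MonoidAlgebra.single g 1) i
  map_one' := by
    rw [← MonoidAlgebra.one_def, map_one]; rfl
  map_mul' a b := by
    have : (MonoidAlgebra.single (a * b) (1 : k)) =
      MonoidAlgebra.single a 1 * MonoidAlgebra.single b 1 := by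
      rw [MonoidAlgebra.single_mul_single, one_mul]
    rw [this, map_mul]; rfl

/-- The `i`-th irreducible character. -/
noncomputable def wChar (i : ι) (g : G) : k := Matrix.trace (wRep φ i g)

theorem wChar_one (i : ι) : wChar φ i 1 = d i := by
  simp [wChar]

theorem wRep_sum (f : G → k) (i : ι) :
    φ (∑ g, f g • MonoidAlgebra.single g 1) i = ∑ g, f g • wRep φ i g := by
  rw [map_sum, Finset.sum_apply]
  refine Finset.sum_congr rfl fun g _ => ?_
  rw [map_smul]; rfl

theorem wChar_conj (i : ι) (g x : G) : wChar φ i (x * g * x⁻¹) = wChar φ i g := by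
  unfold wChar
  rw [map_mul, Matrix.trace_mul_comm, ← map_mul]
  simp [← mul_assoc]

/-- A matrix commuting with the whole representation is scalar. -/
theorem wRep_comm_scalar (i : ι) (X : Matrix (Fin (d i)) (Fin (d i)) k)
    (h : ∀ g, Commute (wRep φ i g) X) : ∃ c : k, X = c • (1 : Matrix _ _ k) := by
  classical
  have hall : ∀ Y : Matrix (Fin (d i)) (Fin (d i)) k, Commute Y X := by
    intro Y
    obtain ⟨u, hu⟩ := φ.surjective (Pi.single i Y)
    have hY : φ u i = Y := by rw [hu]; simp
    rw [← hY]
    have hus : u = ∑ g, u.coeff g • MonoidAlgebra.single g (1:k) := by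
      have := (MonoidAlgebra.basis G k).sum_repr u
      rw [← this]
      simp
    rw [hus, wRep_sum]
    refine Commute.sum_left _ _ _ fun g _ => ?_
    exact (h g).smul_left _
  have h2 : X ∈ Set.range (Matrix.scalar (Fin (d i))) :=
    Matrix.mem_range_scalar_iff_commute_single'.2 (fun a b => hall _)
  obtain ⟨c, hc⟩ := h2
  refine ⟨c, ?_⟩
  rw [← hc]
  ext a b
  simp [Matrix.scalar_apply, Matrix.diagonal_apply, Matrix.one_apply]

variable [Fintype ι]

/-- Trace of a sandwich map. -/
theorem trace_sandwich (P Q : ∀ i, Matrix (Fin (d i)) (Fin (d i)) k) :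
    LinearMap.trace k (∀ i, Matrix (Fin (d i)) (Fin (d i)) k)
      (LinearMap.mulLeft k P ∘ₗ LinearMap.mulRight k Q) =
    ∑ i, Matrix.trace (P i) * Matrix.trace (Q i) := by
  classical
  let b := Pi.basis (fun i => Matrix.stdBasis k (Fin (d i)) (Fin (d i)))
  rw [LinearMap.trace_eq_matrix_trace k b, Matrix.trace, Fintype.sum_sigma]
  refine Finset.sum_congr rfl fun i _ => ?_
  rw [Matrix.trace, Matrix.trace, Finset.sum_mul_sum, Fintype.sum_prod_type]
  refine Finset.sum_congr rfl fun s _ => Finset.sum_congr rfl fun t _ => ?_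
  rw [Matrix.diag_apply, LinearMap.toMatrix_apply]
  simp only [b, LinearMap.comp_apply, LinearMap.mulLeft_apply, LinearMap.mulRight_apply,
    Pi.basis_repr, Pi.basis_apply, Pi.mul_apply, Pi.single_eq_same, Matrix.stdBasis_eq_single]
  have : ∀ X : Matrix (Fin (d i)) (Fin (d i)) k,
      (Matrix.stdBasis k (Fin (d i)) (Fin (d i))).repr X (s, t) = X s t := by
    intro X
    simp [Matrix.stdBasis, Module.Basis.repr_reindex, Pi.basis_repr]
  rw [this]
  simp [Matrix.mul_apply, Matrix.single_apply, Matrix.diag_apply, ite_and]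

/-- column orthogonality -/
theorem wChar_orth [DecidableEq G] (a b : G) :
    ∑ i, wChar φ i a * wChar φ i b⁻¹ = ((univ.filter fun x : G => a * x * b⁻¹ = x).card : k) := by
  have h1 := trace_sandwich (k := k) (d := d) (φ (MonoidAlgebra.single a 1))
    (φ (MonoidAlgebra.single b⁻¹ 1))
  have h2 : (∑ i, wChar φ i a * wChar φ i b⁻¹) = LinearMap.trace k _
      (LinearMap.mulLeft k (φ (MonoidAlgebra.single a 1)) ∘ₗ
        LinearMap.mulRight k (φ (MonoidAlgebra.single b⁻¹ 1))) := by
    rw [h1]; rfl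
  rw [h2, ← LinearMap.trace_conj' _ φ.toLinearEquiv.symm]
  have h3 : φ.toLinearEquiv.symm.conj (LinearMap.mulLeft k (φ (MonoidAlgebra.single a 1)) ∘ₗ
        LinearMap.mulRight k (φ (MonoidAlgebra.single b⁻¹ 1))) =
      LinearMap.mulLeft k (MonoidAlgebra.single a 1) ∘ₗ
        LinearMap.mulRight k (MonoidAlgebra.single b⁻¹ 1) := by
    apply LinearMap.ext
    intro x
    simp [LinearEquiv.conj_apply]
  rw [h3, LinearMap.trace_eq_matrix_trace k (MonoidAlgebra.basis G k), Matrix.trace,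
    Finset.card_filter, Nat.cast_sum]
  refine Finset.sum_congr rfl fun x _ => ?_
  rw [Matrix.diag_apply, LinearMap.toMatrix_apply]
  simp [MonoidAlgebra.single_mul_single, MonoidAlgebra.basis, Finsupp.single_apply, ← mul_assoc]

/-- regular character -/
theorem wChar_regular [DecidableEq G] (f : G → k) :
    ∑ i, (d i : k) * Matrix.trace (∑ g, f g • wRep φ i g) = (Fintype.card G : k) * f 1 := by
  have h : ∀ i, (d i : k) * Matrix.trace (∑ g, f g • wRep φ i g) =
      ∑ g, f g * (wChar φ i g * wChar φ i (1:G)⁻¹) := by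
    intro i
    rw [Matrix.trace_sum, Finset.mul_sum]
    refine Finset.sum_congr rfl fun g _ => ?_
    rw [Matrix.trace_smul, inv_one, wChar_one, smul_eq_mul, wChar]; ring
  rw [Finset.sum_congr rfl (fun i _ => h i), Finset.sum_comm]
  have : ∀ g, ∑ i, f g * (wChar φ i g * wChar φ i (1:G)⁻¹) =
      if g = 1 then (Fintype.card G : k) * f 1 else 0 := by
    intro g
    rw [← Finset.mul_sum, wChar_orth]
    split_ifs with hg
    · subst hg; simp [mul_comm]
    · simp [hg]
  rw [Finset.sum_congr rfl (fun g _ => this g)]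
  simp

end CharTheory
end

section
open Finset

section CharTheory2

variable {k : Type*} [Field k] [CharZero k] {G : Type*} [Group G] [Fintype G]
  {ι : Type*} [Fintype ι] {d : ι → ℕ}
  (φ : MonoidAlgebra k G ≃ₐ[k] (∀ i, Matrix (Fin (d i)) (Fin (d i)) k))

theorem wRep_mul_sum (f : G → k) (i : ι) (y : G) :
    (∑ g, f g • wRep φ i g) * wRep φ i y = ∑ g, f (g * y⁻¹) • wRep φ i g := by
  rw [Finset.sum_mul]
  rw [← Equiv.sum_comp (Equiv.mulRight y) (fun g => f (g * y⁻¹) • wRep φ i g)]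
  refine Finset.sum_congr rfl fun g _ => ?_
  simp [map_mul]

theorem exists_coeff (u : MonoidAlgebra k G) :
    u = ∑ g, u.coeff g • MonoidAlgebra.single g (1:k) := by
  have := (MonoidAlgebra.basis G k).sum_repr u
  rw [← this]
  simp

/-- coefficients from the block images -/
theorem coeff_formula (f : G → k) (x : G) :
    (Fintype.card G : k) * f x =
      ∑ i, (d i : k) * Matrix.trace ((∑ g, f g • wRep φ i g) * wRep φ i x⁻¹) := by
  classical
  have := wChar_regular φ (fun g => f (g * x))
  simp only [one_mul] at this
  rw [← this]
  refine Finset.sum_congr rfl fun i _ => ?_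
  rw [wRep_mul_sum, inv_inv]

/-- central primitive idempotents -/
theorem wIdem [DecidableEq ι] (i j : ι) :
    ∑ g, ((d i : k) * wChar φ i g⁻¹ / Fintype.card G) • wRep φ j g = if i = j then 1 else 0 := by
  obtain ⟨u, hu⟩ := φ.surjective (Pi.single i 1)
  have hj : ∀ j, ∑ g, u.coeff g • wRep φ j g = if i = j then 1 else 0 := by
    intro j
    rw [← wRep_sum, ← exists_coeff, hu]
    split_ifs with h
    · subst h; simp
    · rw [Pi.single_eq_of_ne (Ne.symm h)]
  have hN : (Fintype.card G : k) ≠ 0 := by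
    exact_mod_cast Fintype.card_ne_zero
  rw [← hj j]
  refine Finset.sum_congr rfl fun g _ => ?_
  congr 1
  have := coeff_formula φ u.coeff g
  rw [Finset.sum_eq_single i] at this
  · rw [hj, if_pos rfl, one_mul] at this
    rw [div_eq_iff hN, mul_comm (u.coeff g), this]; rfl
  · intro b _ hb
    rw [hj, if_neg (Ne.symm hb)]; simp
  · simp

/-- two elements with the same block images have the same coefficients -/
theorem coeff_ext (f f' : G → k) (h : ∀ i, ∑ g, f g • wRep φ i g = ∑ g, f' g • wRep φ i g) :
    f = f' := by
  funext x
  have hN : (Fintype.card G : k) ≠ 0 := by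
    exact_mod_cast Fintype.card_ne_zero
  apply mul_left_cancel₀ hN
  rw [coeff_formula φ, coeff_formula φ]
  simp only [h]

theorem sum_sq_deg (φ : MonoidAlgebra k G ≃ₐ[k] (∀ i, Matrix (Fin (d i)) (Fin (d i)) k)) :
    ∑ i, d i ^ 2 = Fintype.card G := by
  classical
  have := wChar_orth φ (1:G) 1
  simp only [inv_one, wChar_one, one_mul, mul_one, Finset.filter_true] at this
  have h2 : ((∑ i, d i ^ 2 : ℕ) : k) = ((Fintype.card G : ℕ) : k) := by
    push_cast
    rw [← Finset.card_univ, ← this]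
    exact Finset.sum_congr rfl fun i _ => by ring
  exact_mod_cast h2

/-- integral scalars -/
theorem integral_scalar (i : ι) (hd : d i ≠ 0) (f : G → k) (hf : ∀ g, IsIntegral ℤ (f g)) (c : k)
    (h : ∑ g, f g • wRep φ i g = c • (1 : Matrix (Fin (d i)) (Fin (d i)) k)) : IsIntegral ℤ c := by
  let O := integralClosure ℤ k
  let F : G → O := fun g => ⟨f g, hf g⟩
  let ψ : MonoidAlgebra O G →ₐ[O] Matrix (Fin (d i)) (Fin (d i)) k :=
    MonoidAlgebra.lift O (Matrix (Fin (d i)) (Fin (d i)) k) G (wRep φ i)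
  have hi : IsIntegral O (∑ g, MonoidAlgebra.single g (F g)) := Algebra.IsIntegral.isIntegral _
  have h1 := hi.map ψ
  have h2 : ψ (∑ g, MonoidAlgebra.single g (F g)) =
      algebraMap k (Matrix (Fin (d i)) (Fin (d i)) k) c := by
    rw [map_sum, Algebra.algebraMap_eq_smul_one, ← h]
    refine Finset.sum_congr rfl fun g _ => ?_
    simp only [ψ, MonoidAlgebra.lift_single]
    rfl
  rw [h2] at h1
  have : Nonempty (Fin (d i)) := ⟨⟨0, Nat.pos_of_ne_zero hd⟩⟩
  have h3 : IsIntegral O c :=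
    (isIntegral_algebraMap_iff (FaithfulSMul.algebraMap_injective k _)).1 h1
  exact isIntegral_trans (R := ℤ) (A := O) c h3

/-- trace of idempotent is a natural number -/
theorem trace_idem {n : ℕ} (M : Matrix (Fin n) (Fin n) k) (h : M * M = M) :
    ∃ m : ℕ, M.trace = m := by
  have h1 : IsIdempotentElem (Matrix.toLin' M) := by
    show _ * _ = _
    rw [Module.End.mul_eq_comp, ← Matrix.toLin'_mul, h]
  have h2 := (LinearMap.IsIdempotentElem.isProj_range _ h1)
  have h3 := LinearMap.IsProj.trace h2
  rw [Matrix.trace_toLin'_eq] at h3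
  exact ⟨_, h3⟩

end CharTheory2
end

section
open Finset

theorem roots_of_finite_order {k : Type*} [Field k] [IsAlgClosed k] {n m : ℕ}
    (M : Matrix (Fin n) (Fin n) k) (h : M ^ m = 1) :
    ∃ s : Multiset k, Multiset.card s = n ∧ (∀ r ∈ s, r ^ m = 1) ∧ M.trace = s.sum := by
  refine ⟨M.charpoly.roots, ?_, ?_, ?_⟩
  · rw [← (IsAlgClosed.splits M.charpoly).natDegree_eq_card_roots, Matrix.charpoly_natDegree_eq_dim,
      Fintype.card_fin]
  · intro r hr
    have hroot := (Polynomial.mem_roots'.1 hr).2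
    have hev : Module.End.HasEigenvalue (Matrix.toLin' M) r := by
      rw [Module.End.hasEigenvalue_iff_isRoot_charpoly, Matrix.charpoly_toLin']
      exact hroot
    obtain ⟨v, hv⟩ := hev.exists_hasEigenvector
    have h1 := hv.pow_apply m
    rw [← Matrix.toLin'_pow, h, Matrix.toLin'_one, LinearMap.id_apply] at h1
    have h2 : (r ^ m - 1) • v = 0 := by rw [sub_smul, ← h1, one_smul, sub_self]
    rcases smul_eq_zero.1 h2 with h3 | h3
    · exact sub_eq_zero.1 h3
    · exact absurd h3 hv.2
  · exact Matrix.trace_eq_sum_roots_charpoly M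

open scoped ComplexOrder in
theorem star_trace {G : Type*} [Group G] [Fintype G] {n : ℕ}
    (ρ : G →* Matrix (Fin n) (Fin n) ℂ) (g : G) :
    (starRingEnd ℂ) (ρ g).trace = (ρ g⁻¹).trace := by
  let P : Matrix (Fin n) (Fin n) ℂ := ∑ x, (ρ x).conjTranspose * ρ x
  have hP : P.PosDef := by
    have h0 : ∀ x, ((ρ x).conjTranspose * ρ x).PosDef := by
      intro x
      apply Matrix.PosDef.conjTranspose_mul_self
      apply Matrix.mulVec_injective_of_isUnit
      exact (Group.isUnit x).map ρ
    exact Matrix.posDef_sum (Finset.univ_nonempty) (fun x _ => h0 x)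
  have hu : IsUnit P := hP.isUnit
  have h1 : (ρ g).conjTranspose * P = P * ρ g⁻¹ := by
    have : (ρ g).conjTranspose * P * ρ g = P := by
      show (ρ g).conjTranspose * (∑ x, (ρ x).conjTranspose * ρ x) * ρ g = P
      rw [Finset.mul_sum, Finset.sum_mul]
      show _ = ∑ x, (ρ x).conjTranspose * ρ x
      rw [← Equiv.sum_comp (Equiv.mulRight g) (fun x => (ρ x).conjTranspose * ρ x)]
      refine Finset.sum_congr rfl fun x _ => ?_
      simp [map_mul, Matrix.conjTranspose_mul, mul_assoc]
    calc (ρ g).conjTranspose * P = (ρ g).conjTranspose * P * (ρ g * ρ g⁻¹) := by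
          rw [← map_mul]; simp
      _ = P * ρ g⁻¹ := by rw [← mul_assoc, this]
  obtain ⟨u, hu⟩ := hu
  have h2 : (ρ g).conjTranspose = P * ρ g⁻¹ * (↑u⁻¹ : Matrix _ _ ℂ) := by
    rw [← h1, mul_assoc, ← hu]; simp
  have h3 : (ρ g).conjTranspose.trace = (ρ g⁻¹).trace := by
    rw [h2, Matrix.trace_mul_comm, ← mul_assoc, ← hu]; simp
  rw [Matrix.trace_conjTranspose] at h3
  exact h3

section CharTheory3

variable {k : Type*} [Field k] [CharZero k] {G : Type*} [Group G] [Fintype G]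
  {ι : Type*} [Fintype ι] {d : ι → ℕ}
  (φ : MonoidAlgebra k G ≃ₐ[k] (∀ i, Matrix (Fin (d i)) (Fin (d i)) k))

theorem wRep_pow_card (i : ι) (g : G) : wRep φ i g ^ (Fintype.card G) = 1 := by
  rw [← map_pow, pow_card_eq_one, map_one]

theorem wChar_integral [IsAlgClosed k] (i : ι) (g : G) : IsIntegral ℤ (wChar φ i g) := by
  obtain ⟨s, -, h2, h3⟩ := roots_of_finite_order _ (wRep_pow_card φ i g)
  unfold wChar
  rw [h3]
  refine IsIntegral.multiset_sum (fun r hr => ?_)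
  exact IsIntegral.of_pow (Fintype.card_pos) (by rw [h2 r hr]; exact isIntegral_one)

open scoped Classical in
theorem class_sum_scalar (i : ι) (hd : d i ≠ 0) (x : G) :
    ∑ g, (if IsConj x g then (1:k) else 0) • wRep φ i g =
     (((univ.filter fun g => IsConj x g).card : k) * wChar φ i x / d i) •
        (1 : Matrix (Fin (d i)) (Fin (d i)) k) := by
  obtain ⟨c, hc⟩ := wRep_comm_scalar φ i
    (∑ g, (if IsConj x g then (1:k) else 0) • wRep φ i g) (by
      intro y
      show _ * _ = _ * _
      rw [Finset.mul_sum, Finset.sum_mul]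
      rw [← Equiv.sum_comp (MulAut.conj y).toEquiv
        (fun g => (if IsConj x g then (1:k) else 0) • wRep φ i g * wRep φ i y)]
      refine Finset.sum_congr rfl fun g _ => ?_
      have h : IsConj x (y * g * y⁻¹) ↔ IsConj x g := by
        constructor
        · intro h; exact h.trans (isConj_iff.2 ⟨y⁻¹, by group⟩)
        · intro h; exact h.trans (isConj_iff.2 ⟨y, rfl⟩)
      simp only [MulEquiv.toEquiv_eq_coe, MulEquiv.coe_toEquiv, MulAut.conj_apply, h,
        mul_smul_comm, smul_mul_assoc, ← map_mul]
      simp)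
  rw [hc]
  congr 1
  have h1 := congrArg Matrix.trace hc
  rw [Matrix.trace_sum] at h1
  simp only [Matrix.trace_smul, Matrix.trace_one, Fintype.card_fin, smul_eq_mul] at h1
  have h2 : ∀ g, (if IsConj x g then (1:k) else 0) * (wRep φ i g).trace =
      if IsConj x g then wChar φ i x else 0 := by
    intro g
    split_ifs with h
    · obtain ⟨y, rfl⟩ := isConj_iff.1 h
      rw [one_mul, ← wChar_conj φ i x y]; rfl
    · simp
  simp only [h2] at h1
  rw [← Finset.sum_filter, Finset.sum_const, nsmul_eq_mul] at h1
  rw [h1, mul_div_cancel_right₀]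
  exact_mod_cast hd

open scoped Classical in
theorem class_integral (i : ι) (hd : d i ≠ 0) (x : G) :
    IsIntegral ℤ (((univ.filter fun g => IsConj x g).card : k) * wChar φ i x / d i) := by
  refine integral_scalar φ i hd _ (fun g => ?_) _ (class_sum_scalar φ i hd x)
  split_ifs
  · exact isIntegral_one
  · exact isIntegral_zero

theorem rat_of_integral (q : ℚ) (h : IsIntegral ℤ (algebraMap ℚ k q)) : ∃ z : ℤ, (z : ℚ) = q := by
  have h1 : IsIntegral ℤ q :=
    (isIntegral_algebraMap_iff (FaithfulSMul.algebraMap_injective ℚ k)).1 h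
  obtain ⟨z, hz⟩ := IsIntegrallyClosed.isIntegral_iff.1 h1
  exact ⟨z, by simpa using hz⟩

theorem dvd_of_integral (a b : ℤ) (hb : b ≠ 0) (h : IsIntegral ℤ ((a : k) / b)) : b ∣ a := by
  obtain ⟨z, hz⟩ := rat_of_integral (k := k) ((a:ℚ)/b) (by simpa using h)
  refine ⟨z, ?_⟩
  have : (b : ℚ) ≠ 0 := by exact_mod_cast hb
  field_simp at hz
  rw [mul_comm]
  exact_mod_cast hz.symm

theorem deg_dvd [IsAlgClosed k]
    (φ : MonoidAlgebra k G ≃ₐ[k] (∀ i, Matrix (Fin (d i)) (Fin (d i)) k)) (i : ι) (hd : d i ≠ 0) : d i ∣ Fintype.card G := by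
  classical
  have hN : (Fintype.card G : k) ≠ 0 := by exact_mod_cast Fintype.card_ne_zero
  have hd' : (d i : k) ≠ 0 := by exact_mod_cast hd
  have h1 := wIdem φ i i
  rw [if_pos rfl] at h1
  have h2 : ∑ g, wChar φ i g⁻¹ • wRep φ i g =
      ((Fintype.card G : k) / d i) • (1 : Matrix (Fin (d i)) (Fin (d i)) k) := by
    rw [← h1, Finset.smul_sum]
    refine Finset.sum_congr rfl fun g _ => ?_
    rw [smul_smul]; congr 1; field_simp
  have h3 := integral_scalar φ i hd _ (fun g => wChar_integral φ i g⁻¹) _ h2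
  have := dvd_of_integral (k := k) (Fintype.card G) (d i) (by exact_mod_cast hd) (by simpa using h3)
  exact_mod_cast this

theorem sub_mult (A : Subgroup G) [Fintype A] (lam : A →* kˣ) (i : ι) :
    ∃ m : ℕ, (∑ a : A, ((lam a⁻¹ : kˣ) : k) * wChar φ i a) = (Fintype.card A : k) * m := by
  have hA : (Fintype.card A : k) ≠ 0 := by exact_mod_cast Fintype.card_ne_zero
  let M : Matrix (Fin (d i)) (Fin (d i)) k := ∑ a : A, ((lam a⁻¹ : kˣ) : k) • wRep φ i a
  have hx : ∀ b : A, (((lam b⁻¹ : kˣ) : k) • wRep φ i b) * M = M := by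
    intro b
    show _ * (∑ a : A, ((lam a⁻¹ : kˣ) : k) • wRep φ i a) = ∑ a : A, ((lam a⁻¹ : kˣ) : k) • wRep φ i a
    conv_rhs => rw [← Equiv.sum_comp (Equiv.mulLeft b)]
    rw [Finset.mul_sum]
    refine Finset.sum_congr rfl fun a _ => ?_
    simp only [Equiv.coe_mulLeft, mul_inv_rev, map_mul, Units.val_mul, Subgroup.coe_mul,
      smul_mul_assoc, mul_smul_comm, smul_smul]
  have hM : M * M = (Fintype.card A : k) • M := by
    conv_lhs => lhs; change (∑ a : A, ((lam a⁻¹ : kˣ) : k) • wRep φ i a)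
    rw [Finset.sum_mul, Finset.sum_congr rfl (fun b _ => hx b), Finset.sum_const, Finset.card_univ,
      ← Nat.cast_smul_eq_nsmul k]
  obtain ⟨m, hm⟩ := trace_idem ((Fintype.card A : k)⁻¹ • M) (by
    rw [smul_mul_smul_comm, hM, smul_smul]
    congr 1; field_simp)
  refine ⟨m, ?_⟩
  rw [← hm, Matrix.trace_smul, smul_eq_mul, mul_inv_cancel_left₀ hA, Matrix.trace_sum]
  exact Finset.sum_congr rfl fun a _ => by rw [Matrix.trace_smul, smul_eq_mul]; rfl

theorem exists_trivial (hd : ∀ i, d i ≠ 0) :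
    ∃ i, d i = 1 ∧ (∀ g, wRep φ i g = 1) ∧ ∀ j, (∀ g, wRep φ j g = 1) → j = i := by
  classical
  have hN : (Fintype.card G : k) ≠ 0 := by exact_mod_cast Fintype.card_ne_zero
  have hne : ∃ i, ∑ g, (1:k) • wRep φ i g ≠ 0 := by
    by_contra! hcon
    have := coeff_ext φ (fun _ => 1) (fun _ => 0) (fun i => by rw [hcon]; simp)
    exact one_ne_zero (congrFun this 1)
  obtain ⟨i, hi⟩ := hne
  have hl : ∀ y, wRep φ i y * (∑ g, (1:k) • wRep φ i g) = ∑ g, (1:k) • wRep φ i g := by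
    intro y
    rw [Finset.mul_sum, ← Equiv.sum_comp (Equiv.mulLeft y) (fun g => (1:k) • wRep φ i g)]
    simp
  have hr : ∀ y, (∑ g, (1:k) • wRep φ i g) * wRep φ i y = ∑ g, (1:k) • wRep φ i g := by
    intro y
    rw [wRep_mul_sum]
  obtain ⟨c, hc⟩ := wRep_comm_scalar φ i (∑ g, (1:k) • wRep φ i g) (fun y => by
    show _ * _ = _ * _
    rw [hl, hr])
  have hc0 : c ≠ 0 := by
    rintro rfl; apply hi; rw [hc, zero_smul]
  have htriv : ∀ g, wRep φ i g = 1 := by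
    intro g
    have := hl g
    rw [hc, mul_smul_comm, mul_one] at this
    exact smul_right_injective _ hc0 this
  have hchar : ∀ g, wChar φ i g = d i := by
    intro g; unfold wChar; rw [htriv]; simp
  have hd1 : d i = 1 := by
    have h1 := congrArg Matrix.trace (wIdem φ i i)
    have hdi : (d i : k) ≠ 0 := by exact_mod_cast hd i
    rw [if_pos rfl, Matrix.trace_sum] at h1
    simp only [hchar, htriv, Matrix.trace_smul, Matrix.trace_one, Fintype.card_fin, smul_eq_mul,
      Finset.sum_const, Finset.card_univ, nsmul_eq_mul] at h1
    field_simp at h1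
    have h2 : d i ^ 2 = 1 := by exact_mod_cast h1
    simpa using h2
  refine ⟨i, hd1, htriv, fun j hj => ?_⟩
  by_contra hij
  have h1 := wIdem φ i j
  rw [if_neg (Ne.symm hij)] at h1
  simp only [hchar, hj, hd1, Nat.cast_one, Finset.sum_const, Finset.card_univ, mul_one] at h1
  have h2 := congrArg Matrix.trace h1
  rw [Matrix.trace_smul, Matrix.trace_smul] at h2
  simp [hd j] at h2

end CharTheory3
end

section
open Finset

theorem four_sets {α : Type*} [DecidableEq α] (F : Finset (Finset α)) (h4 : ∀ S ∈ F, S.card = 4)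
    (h3 : ∀ S ∈ F, ∀ T ∈ F, S ≠ T → (S ∩ T).card = 3) (hF : 6 ≤ F.card) :
    ∃ K : Finset α, K.card = 3 ∧ ∀ S ∈ F, K ⊆ S := by
  obtain ⟨S1, h1, S2, h2, h12⟩ := Finset.one_lt_card.1 (by omega : 1 < F.card)
  refine ⟨S1 ∩ S2, h3 _ h1 _ h2 h12, ?_⟩
  by_contra! hcon
  obtain ⟨S3, hS3, hK⟩ := hcon
  have h5 : (S1 ∪ S2).card = 5 := by
    have := Finset.card_union_add_card_inter S1 S2
    rw [h4 _ h1, h4 _ h2, h3 _ h1 _ h2 h12] at this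
    omega
  have key : ∀ S ∈ F, ¬ (S1 ∩ S2 ⊆ S) → S ⊆ S1 ∪ S2 ∧ (S ∩ (S1 ∩ S2)).card ≤ 2 := by
    intro S hS hn
    have a1 : S ≠ S1 := by rintro rfl; exact hn Finset.inter_subset_left
    have a2 : S ≠ S2 := by rintro rfl; exact hn Finset.inter_subset_right
    have b1 := h3 _ hS _ h1 a1
    have b2 := h3 _ hS _ h2 a2
    have b3 : (S ∩ (S1 ∩ S2)).card ≤ 2 := by
      have : (S ∩ (S1 ∩ S2)).card < (S1 ∩ S2).card := by
        apply Finset.card_lt_card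
        refine ⟨Finset.inter_subset_right, fun h => hn fun x hx => ?_⟩
        exact (Finset.mem_inter.1 (h hx)).1
      rw [h3 _ h1 _ h2 h12] at this; omega
    refine ⟨?_, b3⟩
    have c := Finset.card_union_add_card_inter (S ∩ S1) (S ∩ S2)
    have e1 : S ∩ S1 ∪ S ∩ S2 = S ∩ (S1 ∪ S2) := by rw [Finset.inter_union_distrib_left]
    have e2 : S ∩ S1 ∩ (S ∩ S2) = S ∩ (S1 ∩ S2) := by
      ext x; simp only [Finset.mem_inter]; tauto
    rw [e1, e2, b1, b2] at c
    have : S ∩ (S1 ∪ S2) = S := by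
      apply Finset.eq_of_subset_of_card_le Finset.inter_subset_left
      rw [h4 _ hS]; omega
    rw [← this]; exact Finset.inter_subset_right
  have hall : F ⊆ (S1 ∪ S2).powersetCard 4 := by
    intro S hS
    rw [Finset.mem_powersetCard]
    refine ⟨?_, h4 _ hS⟩
    by_cases hn : S1 ∩ S2 ⊆ S
    · have hne : S ≠ S3 := by rintro rfl; exact hK hn
      have b1 := h3 _ hS _ hS3 hne
      obtain ⟨k1, k2⟩ := key _ hS3 hK
      intro x hx
      by_cases hxK : x ∈ S1 ∩ S2
      · exact Finset.mem_union_left _ (Finset.mem_inter.1 hxK).1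
      · apply k1
        by_contra hx3
        have : S ∩ S3 ⊆ S3 ∩ (S1 ∩ S2) := by
          intro y hy
          rw [Finset.mem_inter] at hy ⊢
          refine ⟨hy.2, ?_⟩
          have hS' : S = insert x (S1 ∩ S2) := by
            symm
            apply Finset.eq_of_subset_of_card_le
            · exact Finset.insert_subset hx hn
            · rw [h4 _ hS, Finset.card_insert_of_notMem hxK, h3 _ h1 _ h2 h12]
          have := hy.1
          rw [hS', Finset.mem_insert] at this
          rcases this with rfl | h
          · exact absurd hy.2 hx3
          · exact h
        have := Finset.card_le_card this
        omega
    · exact (key _ hS hn).1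
  have := Finset.card_le_card hall
  rw [Finset.card_powersetCard, h5] at this
  have : Nat.choose 5 4 = 5 := rfl
  omega

/-- signed version -/
theorem signed_core {ι Λ : Type*} [Fintype ι] [DecidableEq ι] [Fintype Λ]
    (u : Λ → ι → ℤ) (i1 : ι) (h1 : ∀ l, u l i1 = 1) (hn : ∀ l, ∑ i, u l i * u l i = 4)
    (h34 : ∀ l m, u l ≠ u m → ∑ i, u l i * u m i = 3)
    (hbig : 6 ≤ (univ.image u).card) :
    ∃ a b : ι, a ≠ i1 ∧ b ≠ i1 ∧ a ≠ b ∧ ∃ da db : ℤ, (da = 1 ∨ da = -1) ∧ (db = 1 ∨ db = -1) ∧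
      (∀ l, u l a = da) ∧ (∀ l, u l b = db) ∧
      ∃ c : Λ → ι, ∀ l, c l ≠ i1 ∧ c l ≠ a ∧ c l ≠ b ∧ (u l (c l) = 1 ∨ u l (c l) = -1) ∧
        ∀ i, i ≠ i1 → i ≠ a → i ≠ b → i ≠ c l → u l i = 0 := by
  classical
  have hval : ∀ l i, u l i = 0 ∨ u l i = 1 ∨ u l i = -1 := by
    intro l i
    by_cases hi : i = i1
    · rw [hi, h1]; simp
    have : u l i * u l i + 1 ≤ 4 := by
      have h := Finset.sum_le_sum_of_subset_of_nonneg (f := fun i => u l i * u l i)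
        (Finset.subset_univ {i, i1}) (fun j _ _ => mul_self_nonneg _)
      rw [Finset.sum_pair hi, hn l, h1] at h
      simpa using h
    have h2 : u l i ≤ 1 := by nlinarith
    have h3 : -1 ≤ u l i := by nlinarith
    omega
  let S : Λ → Finset (ι × ℤ) := fun l => (univ.filter fun i => u l i ≠ 0).image fun i => (i, u l i)
  have hS : ∀ l x, x ∈ S l ↔ (u l x.1 = x.2 ∧ x.2 ≠ 0) := by
    intro l x
    simp only [S, Finset.mem_image, Finset.mem_filter, Finset.mem_univ, true_and]
    constructor
    · rintro ⟨i, hi, rfl⟩; exact ⟨rfl, hi⟩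
    · rintro ⟨h, h'⟩; exact ⟨x.1, by rw [h]; exact h', by rw [h]⟩
  have hScard : ∀ l, (S l).card = 4 := by
    intro l
    rw [Finset.card_image_of_injective _ (fun i j h => (Prod.mk.inj h).1)]
    have : ∀ i, u l i * u l i = if u l i ≠ 0 then 1 else 0 := by
      intro i; rcases hval l i with h | h | h <;> simp [h]
    have h := hn l
    rw [Finset.sum_congr rfl (fun i _ => this i), ← Finset.sum_filter, Finset.sum_const] at h
    simp at h
    exact_mod_cast h
  have hSinj : ∀ l m, S l = S m → u l = u m := by
    intro l m h
    funext i
    by_cases hi : u l i = 0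
    · by_contra hne
      have : (i, u m i) ∈ S m := (hS _ _).2 ⟨rfl, fun h => hne (by simp only at h; rw [hi, h])⟩
      rw [← h, hS] at this
      exact hne this.1
    · have : (i, u l i) ∈ S l := (hS _ _).2 ⟨rfl, hi⟩
      rw [h, hS] at this
      exact this.1.symm
  have hinter : ∀ l m, S l ≠ S m → (S l ∩ S m).card = 3 := by
    intro l m hne
    have h3 := h34 l m (fun h => hne (by
      simp only [S, h]))
    have hle : (S l ∩ S m).card < 4 := by
      rw [← hScard l]
      apply Finset.card_lt_card
      refine ⟨Finset.inter_subset_left, fun h => hne ?_⟩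
      apply Finset.eq_of_subset_of_card_le
      · intro x hx; exact (Finset.mem_inter.1 (h hx)).2
      · rw [hScard, hScard]
    have hge : (3 : ℤ) ≤ (S l ∩ S m).card := by
      have e : (S l ∩ S m).card = (univ.filter fun i => u l i = u m i ∧ u l i ≠ 0).card := by
        rw [← Finset.card_image_of_injective (f := fun i => (i, u l i)) (univ.filter fun i => u l i = u m i ∧ u l i ≠ 0) (fun i j h => (Prod.mk.inj h).1)]
        congr 1
        ext x
        rw [Finset.mem_inter, hS, hS, Finset.mem_image]
        constructor
        · rintro ⟨⟨h, h'⟩, h2, -⟩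
          exact ⟨x.1, by simp [h, h2, h'], by rw [h]⟩
        · rintro ⟨i, hi, rfl⟩
          simp only [Finset.mem_filter, Finset.mem_univ, true_and] at hi
          exact ⟨⟨rfl, hi.2⟩, hi.1.symm, hi.2⟩
      rw [e, ← h3, Finset.card_filter, Nat.cast_sum]
      refine Finset.sum_le_sum fun i _ => ?_
      rcases hval l i with h | h | h <;> rcases hval m i with h' | h' | h' <;> simp [h, h']
    omega
  have hcardim : (univ.image S).card = (univ.image u).card := by
    have : univ.image S = (univ.image u).image (fun f : ι → ℤ => (univ.filter fun i => f i ≠ 0).image fun i => (i, f i)) := by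
      rw [Finset.image_image]; rfl
    rw [this, Finset.card_image_of_injOn]
    intro x hx y hy hxy
    simp only [Finset.coe_image, Finset.coe_univ, Set.image_univ, Set.mem_range] at hx hy
    obtain ⟨l, rfl⟩ := hx
    obtain ⟨m, rfl⟩ := hy
    exact hSinj _ _ hxy
  obtain ⟨K, hK3, hK⟩ := four_sets (univ.image S)
    (by intro s hs; obtain ⟨l, -, rfl⟩ := Finset.mem_image.1 hs; exact hScard l)
    (by
      intro s hs t ht hst
      obtain ⟨l, -, rfl⟩ := Finset.mem_image.1 hs
      obtain ⟨m, -, rfl⟩ := Finset.mem_image.1 ht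
      exact hinter _ _ hst) (by rw [hcardim]; exact hbig)
  have hKs : ∀ l, K ⊆ S l := fun l => hK _ (Finset.mem_image_of_mem _ (Finset.mem_univ l))
  have hi1 : (i1, (1:ℤ)) ∈ K := by
    by_contra hnot
    have : ∀ l, S l = insert (i1, (1:ℤ)) K := by
      intro l
      symm
      apply Finset.eq_of_subset_of_card_le
      · refine Finset.insert_subset ?_ (hKs l)
        rw [hS]; exact ⟨h1 l, one_ne_zero⟩
      · rw [hScard, Finset.card_insert_of_notMem hnot, hK3]
    have hsub : univ.image S ⊆ {insert (i1, (1:ℤ)) K} := by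
      intro s hs; obtain ⟨l, -, rfl⟩ := Finset.mem_image.1 hs
      rw [this l]; simp
    have := Finset.card_le_card hsub
    rw [hcardim] at this
    simp at this
    omega
  have hK2 : (K.erase (i1, 1)).card = 2 := by rw [Finset.card_erase_of_mem hi1, hK3]
  obtain ⟨x, y, hxy, hKxy⟩ := Finset.card_eq_two.1 hK2
  have hne : Nonempty Λ := by
    by_contra h
    rw [not_nonempty_iff] at h
    simp at hbig
  obtain ⟨l0⟩ := hne
  have hxK : x ∈ K.erase (i1, 1) := by rw [hKxy]; simp
  have hyK : y ∈ K.erase (i1, 1) := by rw [hKxy]; simp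
  rw [Finset.mem_erase] at hxK hyK
  have hxu : ∀ l, u l x.1 = x.2 ∧ x.2 ≠ 0 := fun l => (hS _ _).1 (hKs l hxK.2)
  have hyu : ∀ l, u l y.1 = y.2 ∧ y.2 ≠ 0 := fun l => (hS _ _).1 (hKs l hyK.2)
  refine ⟨x.1, y.1, ?_, ?_, ?_, x.2, y.2, ?_, ?_, fun l => (hxu l).1, fun l => (hyu l).1, ?_⟩
  · intro h
    apply hxK.1
    have := (hxu l0).1
    rw [h, h1] at this
    exact Prod.ext h this.symm
  · intro h
    apply hyK.1
    have := (hyu l0).1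
    rw [h, h1] at this
    exact Prod.ext h this.symm
  · intro h
    apply hxy
    refine Prod.ext h ?_
    rw [← (hxu l0).1, ← (hyu l0).1, h]
  · rcases hval l0 x.1 with h | h | h
    · exact absurd h (by rw [(hxu l0).1]; exact (hxu l0).2)
    · left; rw [← h, (hxu l0).1]
    · right; rw [← h, (hxu l0).1]
  · rcases hval l0 y.1 with h | h | h
    · exact absurd h (by rw [(hyu l0).1]; exact (hyu l0).2)
    · left; rw [← h, (hyu l0).1]
    · right; rw [← h, (hyu l0).1]
  · have : ∀ l, ∃ c : ι, c ≠ i1 ∧ c ≠ x.1 ∧ c ≠ y.1 ∧ (u l c = 1 ∨ u l c = -1) ∧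
        ∀ i, i ≠ i1 → i ≠ x.1 → i ≠ y.1 → i ≠ c → u l i = 0 := by
      intro l
      have h5 : (S l \ K).card = 1 := by
        rw [Finset.card_sdiff_of_subset (hKs l), hScard, hK3]
      obtain ⟨z, hz⟩ := Finset.card_eq_one.1 h5
      have hzm : z ∈ S l \ K := by rw [hz]; simp
      rw [Finset.mem_sdiff, hS] at hzm
      have hKe : ∀ t, t ∈ K → t = (i1, 1) ∨ t = x ∨ t = y := by
        intro t ht
        by_cases hh : t = (i1, 1)
        · exact Or.inl hh
        · right
          have : t ∈ K.erase (i1, 1) := Finset.mem_erase.2 ⟨hh, ht⟩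
          rw [hKxy] at this
          simpa using this
      refine ⟨z.1, ?_, ?_, ?_, ?_, ?_⟩
      · intro h
        apply hzm.2
        have : z = (i1, 1) := Prod.ext h (by rw [← hzm.1.1, h, h1])
        rw [this]; exact hi1
      · intro h
        apply hzm.2
        have : z = x := Prod.ext h (by rw [← hzm.1.1, h, (hxu l).1])
        rw [this]; exact hxK.2
      · intro h
        apply hzm.2
        have : z = y := Prod.ext h (by rw [← hzm.1.1, h, (hyu l).1])
        rw [this]; exact hyK.2
      · rcases hval l z.1 with h | h | h
        · exact absurd h (by rw [hzm.1.1]; exact hzm.1.2)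
        · exact Or.inl h
        · exact Or.inr h
      · intro i hi hix hiy hiz
        by_contra hu
        have hm : (i, u l i) ∈ S l := (hS _ _).2 ⟨rfl, hu⟩
        by_cases hk : (i, u l i) ∈ K
        · rcases hKe _ hk with h | h | h
          · exact hi (congrArg Prod.fst h)
          · exact hix (congrArg Prod.fst h)
          · exact hiy (congrArg Prod.fst h)
        · have : (i, u l i) ∈ S l \ K := Finset.mem_sdiff.2 ⟨hm, hk⟩
          rw [hz, Finset.mem_singleton] at this
          exact hiz (congrArg Prod.fst this)
    choose c hc using this
    exact ⟨c, hc⟩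
end

section
open Finset

section CharTheory5

variable {k : Type*} [Field k] [CharZero k] {G : Type*} [Group G] [Fintype G]
  {ι : Type*} [Fintype ι] {d : ι → ℕ}
  (φ : MonoidAlgebra k G ≃ₐ[k] (∀ i, Matrix (Fin (d i)) (Fin (d i)) k))

theorem conv_image (f f' : G → k) (i : ι) :
    ∑ x, (∑ y, f y * f' (y⁻¹ * x)) • wRep φ i x =
      (∑ g, f g • wRep φ i g) * (∑ g, f' g • wRep φ i g) := by
  rw [Finset.sum_mul]
  simp only [Finset.sum_smul]
  rw [Finset.sum_comm]
  refine Finset.sum_congr rfl fun y _ => ?_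
  rw [Finset.mul_sum, ← Equiv.sum_comp (Equiv.mulLeft y)]
  refine Finset.sum_congr rfl fun x _ => ?_
  simp [smul_smul, mul_comm]

theorem galois_fix (hd : ∀ i, d i ≠ 0) (a : ι)
    (hJ : ∀ J : Finset ι, ∑ j ∈ J, d j ^ 2 = d a ^ 2 → J = {a}) (σ : k →+* k) (g : G) :
    σ (wChar φ a g) = wChar φ a g := by
  classical
  have hN : (Fintype.card G : k) ≠ 0 := by exact_mod_cast Fintype.card_ne_zero
  let f : G → k := fun g => (d a : k) * wChar φ a g⁻¹ / Fintype.card G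
  have hf : ∀ j, ∑ g, f g • wRep φ j g = if a = j then 1 else 0 := fun j => wIdem φ a j
  have hconv : ∀ x, f x = ∑ y, f y * f (y⁻¹ * x) := by
    have := coeff_ext φ f (fun x => ∑ y, f y * f (y⁻¹ * x)) (fun j => by
      rw [conv_image, hf]
      split_ifs <;> simp)
    exact congrFun this
  have hcl : ∀ x y, f (y * x * y⁻¹) = f x := by
    intro x y
    simp only [f]
    congr 2
    rw [← wChar_conj φ a x⁻¹ y]
    congr 1; group
  let f' : G → k := fun g => σ (f g)
  have hconv' : ∀ x, f' x = ∑ y, f' y * f' (y⁻¹ * x) := by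
    intro x
    simp only [f']
    rw [hconv x, map_sum]
    exact Finset.sum_congr rfl fun y _ => by rw [map_mul]
  have hsc : ∀ j, ∃ c : k, ∑ g, f' g • wRep φ j g = c • (1 : Matrix (Fin (d j)) (Fin (d j)) k) := by
    intro j
    apply wRep_comm_scalar φ j
    intro y
    show _ * _ = _ * _
    rw [Finset.mul_sum, Finset.sum_mul]
    rw [← Equiv.sum_comp (MulAut.conj y).toEquiv (fun g => f' g • wRep φ j g * wRep φ j y)]
    refine Finset.sum_congr rfl fun g _ => ?_
    have h : f' (y * g * y⁻¹) = f' g := by simp only [f', hcl]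
    simp only [MulEquiv.toEquiv_eq_coe, MulEquiv.coe_toEquiv, MulAut.conj_apply, h,
        mul_smul_comm, smul_mul_assoc, ← map_mul]
    simp
  choose c hc using hsc
  have hc01 : ∀ j, c j = 0 ∨ c j = 1 := by
    intro j
    have h1 : (∑ g, f' g • wRep φ j g) * (∑ g, f' g • wRep φ j g) = ∑ g, f' g • wRep φ j g := by
      rw [← conv_image]
      exact Finset.sum_congr rfl fun x _ => by rw [← hconv']
    rw [hc, smul_mul_smul_comm, one_mul] at h1
    have h2 := congrArg Matrix.trace h1
    simp only [Matrix.trace_smul, Matrix.trace_one, Fintype.card_fin, smul_eq_mul] at h2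
    have hdj : (d j : k) ≠ 0 := by exact_mod_cast hd j
    have h3 := mul_right_cancel₀ hdj h2
    rcases eq_or_ne (c j) 0 with h | h
    · exact Or.inl h
    · exact Or.inr (mul_left_cancel₀ h (by rw [h3, mul_one]))
  let J : Finset ι := univ.filter fun j => c j = 1
  have hJ1 : J = {a} := by
    apply hJ
    have h1 := coeff_formula φ f' 1
    have h2 : (Fintype.card G : k) * f' 1 = (d a : k) ^ 2 := by
      simp only [f', f]
      rw [inv_one, wChar_one]
      simp only [map_div₀, map_mul, map_natCast]
      field_simp
    rw [h2] at h1
    have h3 : ∀ j, (d j : k) * Matrix.trace ((∑ g, f' g • wRep φ j g) * wRep φ j (1:G)⁻¹) =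
        if c j = 1 then (d j : k) ^ 2 else 0 := by
      intro j
      rw [hc, inv_one, map_one, mul_one]
      split_ifs with h
      · rw [h]; simp; ring
      · rcases hc01 j with h' | h'
        · rw [h']; simp
        · exact absurd h' h
    rw [Finset.sum_congr rfl (fun j _ => h3 j), ← Finset.sum_filter] at h1
    exact_mod_cast h1.symm
  have hff : f' = f := by
    apply coeff_ext φ
    intro j
    rw [hc, hf]
    have : j ∈ J ↔ j = a := by rw [hJ1]; simp
    simp only [J, Finset.mem_filter, Finset.mem_univ, true_and] at this
    split_ifs with h
    · rw [this.2 h.symm, one_smul]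
    · rcases hc01 j with h' | h'
      · rw [h', zero_smul]
      · exact absurd (this.1 h').symm h
  have h := congrFun hff g⁻¹
  simp only [f', f, inv_inv, map_div₀, map_mul, map_natCast] at h
  have hda : (d a : k) ≠ 0 := by exact_mod_cast hd a
  field_simp at h
  exact h

end CharTheory5

theorem rat_of_fixed (x : AlgebraicClosure ℚ)
    (h : ∀ σ : AlgebraicClosure ℚ →+* AlgebraicClosure ℚ, σ x = x) :
    ∃ q : ℚ, algebraMap ℚ _ q = x := by
  have h1 : x ∈ (⊥ : IntermediateField ℚ (AlgebraicClosure ℚ)) := by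
    have : IsAlgClosure ℚ (AlgebraicClosure ℚ) := by
      convert @AlgebraicClosure.instIsAlgClosure ℚ _
      · rfl
      · exact Subsingleton.elim _ _
    have : IsGalois ℚ (AlgebraicClosure ℚ) := IsAlgClosure.isGalois ℚ _
    rw [InfiniteGalois.mem_bot_iff_fixed]
    intro f
    exact h (f : AlgebraicClosure ℚ →+* AlgebraicClosure ℚ)
  exact IntermediateField.mem_bot.1 h1

theorem int_of_fixed (x : AlgebraicClosure ℚ) (hx : IsIntegral ℤ x)
    (h : ∀ σ : AlgebraicClosure ℚ →+* AlgebraicClosure ℚ, σ x = x) :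
    ∃ z : ℤ, (z : AlgebraicClosure ℚ) = x := by
  obtain ⟨q, rfl⟩ := rat_of_fixed x h
  obtain ⟨z, rfl⟩ := rat_of_integral (k := AlgebraicClosure ℚ) q hx
  exact ⟨z, by simp⟩

theorem frob_trace {k : Type*} [Field k] [CharZero k] [IsAlgClosed k] {n p t : ℕ} [Fact p.Prime]
    (M : Matrix (Fin n) (Fin n) k) (h : M ^ (p ^ t) = 1) (z : ℤ) (hz : M.trace = z) :
    (p : ℤ) ∣ z - n := by
  obtain ⟨s, hs1, hs2, hs3⟩ := roots_of_finite_order M h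
  let O := integralClosure ℤ k
  have hlift : ∀ r ∈ s, r ∈ O := by
    intro r hr
    exact IsIntegral.of_pow (pow_pos (Fact.out (p := p.Prime)).pos t)
      (by rw [hs2 r hr]; exact isIntegral_one)
  let s' : Multiset O := s.pmap (fun r hr => ⟨r, hr⟩) hlift
  have hs's : s'.map (algebraMap O k) = s := by
    simp only [s', Multiset.map_pmap]
    show s.pmap (fun r _ => r) hlift = s
    rw [Multiset.pmap_eq_map, Multiset.map_id']
  have hs'1 : ∀ r ∈ s', r ^ (p ^ t) = 1 := by
    intro r hr
    apply Subtype.ext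
    apply hs2
    rw [← hs's]
    exact Multiset.mem_map_of_mem _ hr
  have hsum : s'.sum = (z : O) := by
    apply FaithfulSMul.algebraMap_injective O k
    rw [map_multiset_sum, hs's, ← hs3, hz]; simp
  let I : Ideal O := Ideal.span {(p : O)}
  have hpO : (p : O ⧸ I) = 0 := by
    have : (p : O) ∈ I := Ideal.subset_span rfl
    have h2 := Ideal.Quotient.eq_zero_iff_mem.2 this
    simpa using h2
  have hdvd : ∀ w : ℤ, (w : O ⧸ I) = 0 → (p : ℤ) ∣ w := by
    intro w hw
    have : (w : O) ∈ I := by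
      rw [← Ideal.Quotient.eq_zero_iff_mem]; simpa using hw
    rw [Ideal.mem_span_singleton] at this
    obtain ⟨v, hv⟩ := this
    apply dvd_of_integral (k := k) w p (by exact_mod_cast (Fact.out (p := p.Prime)).ne_zero)
    have hp0 : (p : k) ≠ 0 := by exact_mod_cast (Fact.out (p := p.Prime)).ne_zero
    have h3 : ((w:k) / ((p:ℤ):k)) = (v : k) := by
      have := congrArg (algebraMap O k) hv
      simp only [map_mul, map_natCast, map_intCast] at this
      rw [this]
      push_cast
      rw [mul_div_cancel_left₀ _ hp0]; rfl
    rw [h3]; exact v.2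
  have hchar : CharP (O ⧸ I) p := by
    refine ⟨fun x => ?_⟩
    constructor
    · intro hx
      have := hdvd x (by simpa using hx)
      exact_mod_cast this
    · rintro ⟨y, rfl⟩
      push_cast; rw [hpO, zero_mul]
  have key : ∀ m : Multiset O, (∀ r ∈ m, r ^ (p ^ t) = 1) →
      (Ideal.Quotient.mk I m.sum) ^ (p ^ t) = (Multiset.card m : O ⧸ I) := by
    intro m
    induction m using Multiset.induction_on with
    | empty =>
      intro _
      rw [Multiset.sum_zero, map_zero, Multiset.card_zero, Nat.cast_zero]
      exact zero_pow (pow_pos (Fact.out (p := p.Prime)).pos t).ne'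
    | cons r m ih =>
      intro hm
      rw [Multiset.sum_cons, map_add, add_pow_char_pow, ih (fun r hr => hm r (by simp [hr])),
        ← map_pow, hm r (by simp)]
      simp [add_comm]
  have h1 := key s' hs'1
  have hc : Multiset.card s' = n := by rw [← hs1, ← hs's, Multiset.card_map]
  rw [hsum, hc] at h1
  have h2 : (p : ℤ) ∣ z ^ (p ^ t) - n := by
    apply hdvd
    push_cast
    rw [sub_eq_zero]
    simpa using h1
  have h3 : (p : ℤ) ∣ z ^ (p ^ t) - z := by
    rw [← ZMod.intCast_zmod_eq_zero_iff_dvd]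
    push_cast
    rw [ZMod.pow_card_pow, sub_self]
  have := dvd_sub h2 h3
  have e : z ^ p ^ t - ↑n - (z ^ p ^ t - z) = z - n := by ring
  rwa [e] at this
end

section
open Finset

theorem dual_card (k : Type*) [Field k] [CharZero k] [IsAlgClosed k] {A : Type*} [Group A] [Finite A]
    (hcomm : ∀ a b : A, a * b = b * a) :
    Finite (A →* kˣ) ∧ Nat.card (A →* kˣ) = Nat.card A := by
  let _ : CommGroup A := { ‹Group A› with mul_comm := hcomm }
  have h0 : NeZero (Monoid.exponent A) := ⟨Monoid.exponent_ne_zero_of_finite⟩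
  have h1 : Nat.card (A →* kˣ) = Nat.card A :=
    CommGroup.card_monoidHom_of_hasEnoughRootsOfUnity A k
  refine ⟨?_, h1⟩
  apply Nat.finite_of_card_ne_zero
  rw [h1]; exact Nat.card_pos.ne'

theorem dual_sum {k : Type*} [Field k] [CharZero k] [IsAlgClosed k] {A : Type*} [Group A] [Finite A]
    (hcomm : ∀ a b : A, a * b = b * a) [Fintype (A →* kˣ)] (a : A) (ha : a ≠ 1) :
    ∑ l : A →* kˣ, ((l a : kˣ) : k) = 0 := by
  let _ : CommGroup A := { ‹Group A› with mul_comm := hcomm }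
  have h0 : NeZero (Monoid.exponent A) := ⟨Monoid.exponent_ne_zero_of_finite⟩
  obtain ⟨m, hm⟩ := CommGroup.exists_apply_ne_one_of_hasEnoughRootsOfUnity A k ha
  have h1 : ((m a : kˣ) : k) * ∑ l : A →* kˣ, ((l a : kˣ) : k) = ∑ l : A →* kˣ, ((l a : kˣ) : k) := by
    rw [Finset.mul_sum]
    conv_rhs => rw [← Equiv.sum_comp (Equiv.mulLeft m)]
    exact Finset.sum_congr rfl fun l _ => by simp
  by_contra hne
  have h2 : ((m a : kˣ) : k) = 1 := mul_right_cancel₀ hne (by rw [h1, one_mul])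
  exact hm (Units.ext h2)

theorem hom_sum_zero {k : Type*} [Field k] {A : Type*} [Group A] [Fintype A]
    (l m : A →* kˣ) (h : l ≠ m) : ∑ a, ((l a⁻¹ : kˣ) : k) * ((m a : kˣ) : k) = 0 := by
  let f : A →* k := (Units.coeHom k).comp (l⁻¹ * m)
  have h1 := sum_hom_units_eq_zero f (by
    intro hf
    apply h
    ext a
    have := DFunLike.congr_fun hf a
    simp only [f, MonoidHom.comp_apply, MonoidHom.mul_apply, MonoidHom.inv_apply,
      Units.coeHom_apply, MonoidHom.one_apply] at this
    have h3 : (l a)⁻¹ * m a = 1 := Units.ext this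
    rw [inv_mul_eq_one] at h3
    rw [h3])
  rw [← h1]
  exact Finset.sum_congr rfl fun a _ => by simp [f]

/-- The set-up of the self-centralizing subgroup of order `871`. -/
structure CohSetup {G : Type*} [Group G] (H N : Subgroup G) : Prop where
  cardG : Nat.card G = 2 ^ 5 * 3 * 5 * 7 ^ 2 * 13 * 29 ^ 3 * 67
  cardH : Nat.card H = 871
  cardN : Nat.card N = 2613
  le : H ≤ N
  comm : ∀ a ∈ H, ∀ b ∈ H, a * b = b * a
  cent : ∀ h ∈ H, h ≠ 1 → ∀ x, x * h = h * x → x ∈ H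
  norm : ∀ x ∈ N, ∀ h ∈ H, x⁻¹ * h * x ∈ H
  ti : ∀ x, ∀ h ∈ H, h ≠ 1 → x⁻¹ * h * x ∈ H → x ∈ N
  perf : ∀ K : Subgroup G, K.Normal → H ≤ K → K = ⊤

section Coh

variable {k : Type*} [Field k] [CharZero k] [IsAlgClosed k] {G : Type*} [Group G] [Fintype G]
  {ι : Type*} [Fintype ι] {d : ι → ℕ}
  (φ : MonoidAlgebra k G ≃ₐ[k] (∀ i, Matrix (Fin (d i)) (Fin (d i)) k))
  {H N : Subgroup G}

/-- conjugation relation of characters of `H` -/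
def ConjRel (N : Subgroup G) (l m : H →* kˣ) (x : G) : Prop :=
  x ∈ N ∧ ∀ a b : H, (a : G) * x = x * b → l a = m b

theorem inner_v [DecidableEq G] (S : CohSetup H N) [Fintype H] (l m : H →* kˣ)
    [DecidablePred (ConjRel N l m)] :
    ∑ i, (∑ a : H, ((l a⁻¹ : kˣ) : k) * wChar φ i a) * (∑ a : H, ((m a⁻¹ : kˣ) : k) * wChar φ i a) =
      ((Nat.card G : k) - Nat.card N) + 871 * ((univ.filter (ConjRel N l m)).card : k) := by
  classical
  have hH : Fintype.card H = 871 := by rw [← Nat.card_eq_fintype_card]; exact S.cardH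
  let T : G → k := fun x => ∑ a : H, ∑ b : H,
    if (a : G) * x * (b : G)⁻¹ = x then ((l a⁻¹ : kˣ) : k) * ((m b : kˣ) : k) else 0
  have h1 : ∑ i, (∑ a : H, ((l a⁻¹ : kˣ) : k) * wChar φ i a) *
      (∑ a : H, ((m a⁻¹ : kˣ) : k) * wChar φ i a) = ∑ x, T x := by
    have e1 : ∀ i, (∑ a : H, ((m a⁻¹ : kˣ) : k) * wChar φ i a) =
        ∑ b : H, ((m b : kˣ) : k) * wChar φ i (b : G)⁻¹ := by
      intro i
      rw [← Equiv.sum_comp (Equiv.inv H)]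
      simp
    simp only [e1, Finset.sum_mul_sum, T]
    rw [Finset.sum_comm, Finset.sum_comm (s := (univ : Finset G))]
    refine Finset.sum_congr rfl fun a _ => ?_
    rw [Finset.sum_comm, Finset.sum_comm (s := (univ : Finset G))]
    refine Finset.sum_congr rfl fun b _ => ?_
    rw [← Finset.sum_filter, Finset.sum_const, nsmul_eq_mul, ← wChar_orth φ, Finset.sum_mul]
    exact Finset.sum_congr rfl fun i _ => by ring
  have hTn : ∀ x, x ∉ N → T x = 1 := by
    intro x hx
    simp only [T]
    rw [Finset.sum_eq_single (1 : H), Finset.sum_eq_single (1 : H)]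
    · simp
    · intro b _ hb
      rw [if_neg]
      intro h
      apply hb
      simp at h
      exact h
    · simp
    · intro a _ ha
      refine Finset.sum_eq_zero fun b _ => ?_
      rw [if_neg]
      intro h
      apply hx
      refine S.ti x a a.2 (fun h => ha (Subtype.ext h)) ?_
      have : x⁻¹ * a * x = b := by
        rw [mul_inv_eq_iff_eq_mul] at h
        rw [mul_assoc, h]; group
      rw [this]; exact b.2
    · simp
  have hTy : ∀ x, x ∈ N → T x = if ConjRel N l m x then 871 else 0 := by
    intro x hx
    let cj : H → H := fun a => ⟨x⁻¹ * a * x, S.norm x hx a a.2⟩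
    have hcj : ∀ a b : H, (a : G) * x * (b : G)⁻¹ = x ↔ b = cj a := by
      intro a b
      rw [mul_inv_eq_iff_eq_mul, Subtype.ext_iff]
      simp only [cj]
      constructor
      · intro h; rw [mul_assoc, h]; group
      · intro h; rw [h]; group
    let m' : H →* kˣ := ⟨⟨fun a => m (cj a), by
        rw [show cj 1 = 1 from Subtype.ext (by simp [cj]), map_one]⟩, fun a b => by
        show m (cj (a * b)) = m (cj a) * m (cj b)
        rw [← map_mul]; congr 1; apply Subtype.ext; simp [cj]; group⟩
    have hT : T x = ∑ a : H, ((l a⁻¹ : kˣ) : k) * ((m' a : kˣ) : k) := by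
      simp only [T, hcj]
      refine Finset.sum_congr rfl fun a _ => ?_
      rw [Finset.sum_ite_eq' univ (cj a)]; simp [m']
    rw [hT]
    split_ifs with h
    · have : l = m' := by
        ext a
        have := h.2 a (cj a) (by simp [cj, mul_assoc])
        rw [this]; rfl
      rw [← this]
      simp [hH]
    · apply hom_sum_zero
      rintro rfl
      apply h
      refine ⟨hx, fun a b hab => ?_⟩
      show m (cj a) = m b
      rw [← (hcj a b).1 (by rw [hab]; group)]
  rw [h1]
  have hT : ∀ x, T x = (1 - if x ∈ N then 1 else 0) + if ConjRel N l m x then 871 else 0 := by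
    intro x
    by_cases hx : x ∈ N
    · rw [hTy x hx, if_pos hx]; ring
    · rw [hTn x hx, if_neg hx, if_neg (fun h => hx h.1)]; ring
  rw [Finset.sum_congr rfl (fun x _ => hT x), Finset.sum_add_distrib, Finset.sum_sub_distrib,
    ← Finset.sum_filter, ← Finset.sum_filter]
  have hNc : (univ.filter fun x => x ∈ N).card = Nat.card N := by
    rw [Nat.card_eq_fintype_card, Fintype.card_subtype]
  simp [hNc, Nat.card_eq_fintype_card, mul_comm]

end Coh
end

section
open Finset

section Coh7

variable {k : Type*} [Field k] [CharZero k] [IsAlgClosed k] {G : Type*} [Group G] [Fintype G]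
  {ι : Type*} [Fintype ι] {d : ι → ℕ}
  {H N : Subgroup G}

theorem conjRel_coset (S : CohSetup H N) (l m : H →* kˣ) (hm : m ≠ 1) (x0 x : G)
    (h0 : ConjRel N l m x0) : ConjRel N l m x ↔ x0⁻¹ * x ∈ H := by
  constructor
  · intro h
    set y := x0⁻¹ * x with hy
    by_contra hyH
    have hyN : y ∈ N := N.mul_mem (N.inv_mem h0.1) h.1
    let f : H → H := fun b => ⟨(b:G)⁻¹ * (y⁻¹ * b * y),
      H.mul_mem (H.inv_mem b.2) (S.norm y hyN b b.2)⟩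
    have hinj : Function.Injective f := by
      intro b c hbc
      have e : (b:G)⁻¹ * (y⁻¹ * b * y) = (c:G)⁻¹ * (y⁻¹ * c * y) := congrArg Subtype.val hbc
      have hb := S.norm y hyN b b.2
      have hc := S.norm y hyN c c.2
      have e2 : (y⁻¹ * b * y) * (y⁻¹ * c * y)⁻¹ = (b:G) * (c:G)⁻¹ := by
        have e3 : (y⁻¹ * b * y) = b * ((c:G)⁻¹ * (y⁻¹ * c * y)) := by rw [← e]; group
        rw [e3]; group
      have e4 : y * ((b:G) * (c:G)⁻¹) = ((b:G) * (c:G)⁻¹) * y := by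
        rw [← e2]; simp only [mul_inv_rev, inv_inv]
        have : (b:G) * (c:G)⁻¹ = (y⁻¹ * b * y) * (y⁻¹ * c * y)⁻¹ := e2.symm
        calc y * (y⁻¹ * ↑b * y * (y⁻¹ * ((c:G)⁻¹ * y))) = (b:G) * (c:G)⁻¹ * y := by group
          _ = (y⁻¹ * ↑b * y * (y⁻¹ * ((c:G)⁻¹ * y))) * y := by rw [this]; group
      by_contra hne
      apply hyH
      refine S.cent _ (H.mul_mem b.2 (H.inv_mem c.2)) (fun h1 => hne ?_) y e4
      exact Subtype.ext (mul_inv_eq_one.1 h1)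
    have hsurj := Finite.surjective_of_injective hinj
    apply hm
    ext b
    obtain ⟨c, rfl⟩ := hsurj b
    have hc := S.norm y hyN c c.2
    have e1 : m c = m ⟨_, hc⟩ := by
      have ha : x0 * c * x0⁻¹ ∈ H := by
        by_cases hc1 : (c : G) = 1
        · rw [hc1]; simp [H.one_mem]
        · have := S.norm x0⁻¹ (N.inv_mem h0.1) c c.2
          simpa using this
      rw [← h0.2 ⟨_, ha⟩ c (by simp), ← h.2 ⟨_, ha⟩ ⟨_, hc⟩ (by simp [hy]; group)]
    have : f c = c⁻¹ * ⟨_, hc⟩ := rfl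
    rw [this, map_mul, map_inv, e1]; simp
  · intro h
    have hx : x = x0 * (x0⁻¹ * x) := by group
    refine ⟨by rw [hx]; exact N.mul_mem h0.1 (S.le h), fun a b hab => ?_⟩
    apply h0.2
    rw [hx] at hab
    have hc := S.comm _ h b b.2
    have : (a:G) * x0 * (x0⁻¹ * x) = x0 * b * (x0⁻¹ * x) := by
      rw [mul_assoc, hab, mul_assoc x0, hc, ← mul_assoc]
    exact mul_right_cancel this

theorem conjRel_card (S : CohSetup H N) (l m : H →* kˣ) (hm : m ≠ 1)
    [DecidablePred (ConjRel N l m)] :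
    (univ.filter (ConjRel N l m)).card = 0 ∨ (univ.filter (ConjRel N l m)).card = 871 := by
  classical
  by_cases h : ∃ x0, ConjRel N l m x0
  · right
    obtain ⟨x0, h0⟩ := h
    rw [← S.cardH, Nat.card_eq_fintype_card, ← Finset.card_univ]
    symm
    refine Finset.card_bij (fun (a : H) _ => x0 * a) ?_ ?_ ?_
    · intro a _
      simp only [Finset.mem_filter, Finset.mem_univ, true_and]
      rw [conjRel_coset S l m hm x0 _ h0]; simp
    · intro a _ b _ hab
      exact Subtype.ext (mul_left_cancel hab)
    · intro x hx
      simp only [Finset.mem_filter, Finset.mem_univ, true_and] at hx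
      exact ⟨⟨_, (conjRel_coset S l m hm x0 x h0).1 hx⟩, Finset.mem_univ _, by simp⟩
  · left
    push Not at h
    rw [Finset.card_eq_zero, Finset.filter_eq_empty_iff]
    intro x _; exact h x

theorem conjRel_one (S : CohSetup H N) (l m : H →* kˣ) (h : l = 1 ∧ m ≠ 1 ∨ l ≠ 1 ∧ m = 1) (x : G) :
    ¬ ConjRel N l m x := by
  intro hx
  rcases h with ⟨rfl, hm⟩ | ⟨hl, rfl⟩
  · apply hm
    ext b
    have ha : x * b * x⁻¹ ∈ H := by
      have := S.norm x⁻¹ (N.inv_mem hx.1) b b.2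
      simpa using this
    rw [← hx.2 ⟨_, ha⟩ b (by simp)]
    rfl
  · apply hl
    ext a
    have ha := S.norm x hx.1 a a.2
    rw [hx.2 a ⟨_, ha⟩ (by simp; group)]
    rfl

theorem conjRel_self (l : H →* kˣ) : ConjRel N l l 1 :=
  ⟨N.one_mem, fun a b hab => by
    have : a = b := Subtype.ext (by simpa using hab)
    rw [this]⟩

theorem conjRel_unique (S : CohSetup H N) (l m m' : H →* kˣ) (x : G) (h : ConjRel N l m x)
    (h' : ConjRel N l m' x) : m = m' := by
  ext b
  have ha : x * b * x⁻¹ ∈ H := by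
    have := S.norm x⁻¹ (N.inv_mem h.1) b b.2
    simpa using this
  rw [← h.2 ⟨_, ha⟩ b (by simp), ← h'.2 ⟨_, ha⟩ b (by simp)]

end Coh7
end

section
open Finset

universe uk ug
section Coh8

variable {k : Type uk} [Field k] [CharZero k] [IsAlgClosed k] {G : Type ug} [Group G] [Fintype G]
  {ι : Type*} [Fintype ι] {d : ι → ℕ}
  (φ : MonoidAlgebra k G ≃ₐ[k] (∀ i, Matrix (Fin (d i)) (Fin (d i)) k))
  {H N : Subgroup G}

theorem coh_core [Fintype H] (hd : ∀ i, d i ≠ 0) (S : CohSetup H N) :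
    ∃ (Λ : Type (max uk ug)) (_ : Fintype Λ) (ev : Λ → H → k) (v1 : ι → ℕ) (u : Λ → ι → ℤ) (i1 : ι),
      Fintype.card Λ = 870 ∧ (∀ h : H, h ≠ 1 → ∑ l, ev l h = -1) ∧
      d i1 = 1 ∧ (∀ g, wRep φ i1 g = 1) ∧ (∀ j, (∀ g, wRep φ j g = 1) → j = i1) ∧
      (∀ l, u l i1 = 1) ∧ (∀ l, ∑ i, u l i * u l i = 4) ∧
      (∀ l m, u l ≠ u m → ∑ i, u l i * u m i = 3) ∧
      (∀ l, (univ.filter fun m => u m = u l).card ≤ 3) ∧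
      (∀ i, (d i : ℤ) = 871 * v1 i - ∑ l, u l i) ∧
      (∀ i, ∀ h : H, h ≠ 1 → wChar φ i h = - ∑ l, (u l i : k) * ev l h) ∧
      (∀ i, ∑ h : H, wChar φ i h = 871 * v1 i) ∧
      (∀ x, (x = 1 ∨ ∀ y, y⁻¹ * x * y ∉ H) → ∀ l, ∑ i, (u l i : k) * wChar φ i x = 0) := by
  classical
  have hcomm : ∀ a b : H, a * b = b * a := fun a b => Subtype.ext (S.comm a a.2 b b.2)
  obtain ⟨hfin, hLcard⟩ := dual_card k hcomm
  have hFt : Fintype (H →* kˣ) := Fintype.ofFinite _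
  have hH : Fintype.card H = 871 := by rw [← Nat.card_eq_fintype_card]; exact S.cardH
  have hL : Fintype.card (H →* kˣ) = 871 := by
    rw [← Nat.card_eq_fintype_card, hLcard, S.cardH]
  have hmult := fun (l : H →* kˣ) (i : ι) => sub_mult φ H l i
  choose v hv using hmult
  rw [hH] at hv
  obtain ⟨i1, hi1, htriv, huniq⟩ := exists_trivial φ hd
  let Λ := {l : H →* kˣ // l ≠ 1}
  let u : Λ → ι → ℤ := fun l i => v 1 i - v l.1 i
  have hsub : ∀ f : (H →* kˣ) → k, ∑ l, f l = f 1 + ∑ l : Λ, f l.1 := by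
    intro f
    rw [← Finset.add_sum_erase univ f (Finset.mem_univ 1)]
    congr 1
    rw [← Finset.sum_subtype (univ.erase (1 : H →* kˣ)) (p := fun l => l ≠ 1)]
    intro x; simp
  have hLam : Fintype.card Λ = 870 := by
    have := Fintype.card_subtype_compl (fun l : H →* kˣ => l = 1)
    rw [hL, Fintype.card_subtype_eq] at this
    exact this
  -- inversion
  have hinv : ∀ (i : ι) (h : H), ∑ l, (v l i : k) * ((l h : kˣ) : k) = wChar φ i h := by
    intro i h
    have e : ∀ l : H →* kˣ, (871 : k) * ((v l i : k) * ((l h : kˣ) : k)) =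
        ∑ a : H, ((l (a⁻¹ * h) : kˣ) : k) * wChar φ i a := by
      intro l
      have := hv l i
      push_cast at this
      rw [← mul_assoc, ← this, Finset.sum_mul]
      refine Finset.sum_congr rfl fun a _ => ?_
      rw [map_mul]; push_cast; ring
    have e2 : (871 : k) * ∑ l, (v l i : k) * ((l h : kˣ) : k) = 871 * wChar φ i h := by
      rw [Finset.mul_sum, Finset.sum_congr rfl (fun l _ => e l), Finset.sum_comm]
      rw [Finset.sum_eq_single h]
      · simp [hL]
      · intro a _ ha
        rw [← Finset.sum_mul, dual_sum hcomm, zero_mul]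
        intro h1
        exact ha (inv_mul_eq_one.1 h1)
      · simp
    exact mul_left_cancel₀ (by norm_num) e2
  have hinner : ∀ l m : H →* kˣ, (871 : k) * 871 * ∑ i, (v l i : k) * (v m i : k) =
      ((Nat.card G : k) - Nat.card N) + 871 * ((univ.filter (ConjRel N l m)).card : k) := by
    intro l m
    rw [← inner_v φ S l m, Finset.mul_sum]
    refine Finset.sum_congr rfl fun i _ => ?_
    rw [hv, hv]; push_cast; ring
  have hc11 : (univ.filter (ConjRel N (1 : H →* kˣ) 1)).card = 2613 := by
    rw [← S.cardN, Nat.card_eq_fintype_card, Fintype.card_subtype]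
    congr 1
    ext x
    simp [ConjRel]
  have hc0 : ∀ l m : H →* kˣ, (l = 1 ∧ m ≠ 1 ∨ l ≠ 1 ∧ m = 1) →
      (univ.filter (ConjRel N l m)).card = 0 := by
    intro l m h
    rw [Finset.card_eq_zero, Finset.filter_eq_empty_iff]
    intro x _; exact conjRel_one S l m h x
  have huu : ∀ l m : Λ, 871 * ∑ i, u l i * u m i =
      2613 + ((univ.filter (ConjRel N l.1 m.1)).card : ℤ) := by
    intro l m
    have h1 : (871 : k) * (871 * ∑ i, (u l i : k) * (u m i : k)) =
        871 * (2613 + ((univ.filter (ConjRel N l.1 m.1)).card : k)) := by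
      have a1 := hinner 1 1
      have a2 := hinner 1 m.1
      have a3 := hinner l.1 1
      have a4 := hinner l.1 m.1
      rw [hc0 1 m.1 (Or.inl ⟨rfl, m.2⟩)] at a2
      rw [hc0 l.1 1 (Or.inr ⟨l.2, rfl⟩)] at a3
      rw [hc11] at a1
      have e : ∑ i, (u l i : k) * (u m i : k) = ∑ i, (v 1 i : k) * (v 1 i : k)
          - ∑ i, (v 1 i : k) * (v m.1 i : k) - ∑ i, (v l.1 i : k) * (v 1 i : k)
          + ∑ i, (v l.1 i : k) * (v m.1 i : k) := by
        rw [← Finset.sum_sub_distrib, ← Finset.sum_sub_distrib, ← Finset.sum_add_distrib]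
        refine Finset.sum_congr rfl fun i _ => ?_
        simp only [u]; push_cast; ring
      rw [e]
      push_cast at a1 a2 a3 a4 ⊢
      linear_combination a1 - a2 - a3 + a4
    have h2 := mul_left_cancel₀ (by norm_num) h1
    exact_mod_cast h2
  have hnorm : ∀ l : Λ, ∑ i, u l i * u l i = 4 := by
    intro l
    have h1 := huu l l
    rcases conjRel_card S l.1 l.1 l.2 with h | h
    · exfalso
      rw [Finset.card_eq_zero, Finset.filter_eq_empty_iff] at h
      exact h (Finset.mem_univ 1) (conjRel_self l.1)
    · rw [h] at h1; push_cast at h1; omega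
  have h34 : ∀ l m : Λ, u l ≠ u m → ∑ i, u l i * u m i = 3 := by
    intro l m hne
    have h1 := huu l m
    rcases conjRel_card S l.1 m.1 m.2 with h | h
    · rw [h] at h1; push_cast at h1; omega
    · exfalso
      rw [h] at h1
      have h4 : ∑ i, u l i * u m i = 4 := by push_cast at h1; omega
      have h5 : ∑ i, (u l i - u m i) ^ 2 = 0 := by
        have : ∑ i, (u l i - u m i) ^ 2 = ∑ i, u l i * u l i - 2 * ∑ i, u l i * u m i
            + ∑ i, u m i * u m i := by
          rw [Finset.mul_sum, ← Finset.sum_sub_distrib, ← Finset.sum_add_distrib]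
          exact Finset.sum_congr rfl fun i _ => by ring
        rw [this, hnorm, hnorm, h4]; norm_num
      apply hne
      funext i
      have h6 := (Finset.sum_eq_zero_iff_of_nonneg (fun i _ => sq_nonneg _)).1 h5 i (Finset.mem_univ i)
      have := pow_eq_zero_iff (two_ne_zero) |>.1 h6
      omega
  have hfib : ∀ l : Λ, (univ.filter fun m => u m = u l).card ≤ 3 := by
    intro l
    have h871 : ∀ m : Λ, u m = u l → (univ.filter (ConjRel N l.1 m.1)).card = 871 := by
      intro m hm
      have h1 := huu l m
      rw [hm, hnorm] at h1
      omega
    let B : Finset Λ := univ.filter fun m => u m = u l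
    have hdis : (B.biUnion fun m => univ.filter (ConjRel N l.1 m.1)).card = B.card * 871 := by
      rw [Finset.card_biUnion]
      · rw [Finset.sum_congr rfl (fun m hm => h871 m (Finset.mem_filter.1 hm).2), Finset.sum_const,
          smul_eq_mul]
      · intro m _ m' _ hne
        rw [Function.onFun, Finset.disjoint_left]
        intro x hx hx'
        apply hne
        exact Subtype.ext (conjRel_unique S l.1 m.1 m'.1 x (Finset.mem_filter.1 hx).2
          (Finset.mem_filter.1 hx').2)
    have hle : (B.biUnion fun m => univ.filter (ConjRel N l.1 m.1)).card ≤ 2613 := by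
      rw [← S.cardN, Nat.card_eq_fintype_card, Fintype.card_subtype]
      apply Finset.card_le_card
      intro x hx
      obtain ⟨m, -, hm⟩ := Finset.mem_biUnion.1 hx
      simp only [Finset.mem_filter, Finset.mem_univ, true_and] at hm ⊢
      exact hm.1
    rw [hdis] at hle
    show B.card ≤ 3
    omega
  have hi1char : ∀ g, wChar φ i1 g = 1 := by
    intro g; unfold wChar; rw [htriv]; simp [hi1]
  refine ⟨Λ, inferInstance, fun l h => ((l.1 h : kˣ) : k), v 1, u, i1, hLam, ?_, hi1, htriv, huniq,
    ?_, hnorm, h34, hfib, ?_, ?_, ?_, ?_⟩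
  · intro h hh
    have := hsub (fun l => ((l h : kˣ) : k))
    rw [dual_sum hcomm h hh] at this
    simp only [MonoidHom.one_apply, Units.val_one] at this
    linear_combination -this
  · intro l
    have h1 := hv 1 i1
    have h2 := hv l.1 i1
    simp only [hi1char, MonoidHom.one_apply, Units.val_one, mul_one] at h1 h2
    rw [Finset.sum_const, Finset.card_univ, hH] at h1
    have h3 := hom_sum_zero l.1 (1 : H →* kˣ) l.2
    simp only [MonoidHom.one_apply, Units.val_one, mul_one] at h3
    rw [h3] at h2
    push_cast at h1 h2
    have e1 : (v 1 i1 : k) = 1 := by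
      have : (871 : k) * (v 1 i1 : k) = 871 * 1 := by rw [← h1]; norm_num
      exact mul_left_cancel₀ (by norm_num) this
    have e2 : (v l.1 i1 : k) = 0 := by
      rcases mul_eq_zero.1 h2.symm with h | h
      · norm_num at h
      · exact h
    have e1' : v 1 i1 = 1 := by exact_mod_cast e1
    have e2' : v l.1 i1 = 0 := by exact_mod_cast e2
    simp [u, e1', e2']
  · intro i
    have h1 := hinv i 1
    have h2 := hsub (fun l => (v l i : k))
    simp only [map_one, Units.val_one, mul_one, Subgroup.coe_one, wChar_one] at h1
    rw [h1] at h2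
    have h3 : ((d i : ℤ) : k) = ((871 * v 1 i - ∑ l, u l i : ℤ) : k) := by
      push_cast
      rw [h2]
      simp only [u]
      push_cast
      rw [Finset.sum_sub_distrib, Finset.sum_const, Finset.card_univ, hLam, nsmul_eq_mul]
      push_cast; ring
    exact_mod_cast h3
  · intro i h hh
    have h1 := hinv i h
    rw [hsub (fun l => (v l i : k) * ((l h : kˣ) : k))] at h1
    have h2 := hsub (fun l => ((l h : kˣ) : k))
    rw [dual_sum hcomm h hh] at h2
    simp only [MonoidHom.one_apply, Units.val_one, mul_one] at h1 h2
    rw [← h1, ← Finset.sum_neg_distrib]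
    have : ∀ l : Λ, -((u l i : k) * ((l.1 h : kˣ) : k)) =
        (v l.1 i : k) * ((l.1 h : kˣ) : k) - (v 1 i : k) * ((l.1 h : kˣ) : k) := by
      intro l; simp only [u]; push_cast; ring
    rw [Finset.sum_congr rfl (fun l _ => this l), Finset.sum_sub_distrib, ← Finset.mul_sum]
    linear_combination (-(v 1 i : k)) * h2
  · intro i
    have h1 := hv 1 i
    simp only [MonoidHom.one_apply, Units.val_one, one_mul] at h1
    rw [h1]; push_cast; ring
  · intro x hx l
    have key : ∀ m : H →* kˣ, (871 : k) * ∑ i, (v m i : k) * wChar φ i x =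
        if x = 1 then (Fintype.card G : k) else 0 := by
      intro m
      have e : ∀ i, (871 : k) * ((v m i : k) * wChar φ i x) =
          ∑ a : H, ((m a⁻¹ : kˣ) : k) * (wChar φ i x * wChar φ i (a⁻¹ : G)⁻¹) := by
        intro i
        have := hv m i
        push_cast at this
        rw [← mul_assoc, ← this, Finset.sum_mul]
        refine Finset.sum_congr rfl fun a _ => ?_
        rw [inv_inv]; ring
      rw [Finset.mul_sum, Finset.sum_congr rfl (fun i _ => e i), Finset.sum_comm]
      simp only [← Finset.mul_sum, wChar_orth φ]
      rw [Finset.sum_eq_single (1 : H)]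
      · split_ifs with h
        · subst h; simp
        · simp [h]
      · intro a _ ha
        rw [Finset.card_eq_zero.2, Nat.cast_zero, mul_zero]
        rw [Finset.filter_eq_empty_iff]
        intro y _ hy
        rw [inv_inv] at hy
        have hxy : y⁻¹ * x * y = (a : G)⁻¹ := by
          rw [eq_inv_iff_mul_eq_one, mul_assoc, mul_assoc, ← mul_assoc x, hy]; simp
        rcases hx with rfl | hx
        · apply ha
          apply Subtype.ext
          simp at hxy
          simpa using hxy
        · apply hx y
          rw [hxy]; exact H.inv_mem a.2
      · simp
    have k1 := key 1
    have k2 := key l.1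
    have : (871 : k) * ∑ i, (u l i : k) * wChar φ i x = 0 := by
      have e : ∑ i, (u l i : k) * wChar φ i x =
          ∑ i, (v 1 i : k) * wChar φ i x - ∑ i, (v l.1 i : k) * wChar φ i x := by
        rw [← Finset.sum_sub_distrib]
        refine Finset.sum_congr rfl fun i _ => ?_
        simp only [u]; push_cast; ring
      rw [e, mul_sub, k1, k2, sub_self]
    rcases mul_eq_zero.1 this with h | h
    · norm_num at h
    · exact h

end Coh8
end

section
open Finset

theorem num_deg (d : ℕ) (v : ℕ) (δ : ℤ) (hδ : δ = 1 ∨ δ = -1) (h : (d : ℤ) = 871 * v - 870 * δ)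
    (hN : d ∣ 2 ^ 5 * 3 * 5 * 7 ^ 2 * 13 * 29 ^ 3 * 67)
    (hb : d ^ 2 ≤ 2 ^ 5 * 3 * 5 * 7 ^ 2 * 13 * 29 ^ 3 * 67) :
    δ * d = 1 ∨ δ * d = -870 ∨ δ * d = 7840 ∨ δ * d = 24389 := by
  have k1 : ∀ t < 813, (871 * t + 1 ∣ 2 ^ 5 * 3 * 5 * 7 ^ 2 * 13 * 29 ^ 3 * 67) →
      (871 * t + 1 = 1 ∨ 871 * t + 1 = 7840 ∨ 871 * t + 1 = 24389) := by decide +kernel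
  have k2 : ∀ t < 813, (871 * t + 870 ∣ 2 ^ 5 * 3 * 5 * 7 ^ 2 * 13 * 29 ^ 3 * 67) →
      (871 * t + 870 = 870) := by decide +kernel
  have hb' : d < 871 * 813 := by
    by_contra hc
    have := Nat.pow_le_pow_left (not_lt.1 hc) 2
    norm_num at this hb
    omega
  rcases hδ with rfl | rfl
  · obtain ⟨t, ht⟩ : ∃ t, d = 871 * t + 1 := ⟨v - 1, by omega⟩
    have := k1 t (by omega) (ht ▸ hN)
    omega
  · obtain ⟨t, ht⟩ : ∃ t, d = 871 * t + 870 := ⟨v, by omega⟩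
    have := k2 t (by omega) (ht ▸ hN)
    omega

theorem num_three (x y : ℤ) (c : ℕ)
    (hx : x = 1 ∨ x = -870 ∨ x = 7840 ∨ x = 24389) (hy : y = 1 ∨ y = -870 ∨ y = 7840 ∨ y = 24389)
    (e : ℤ) (he : e = 1 ∨ e = -1) (h : 1 + x + y + e * c = 0)
    (hN : c ∣ 2 ^ 5 * 3 * 5 * 7 ^ 2 * 13 * 29 ^ 3 * 67) :
    x = 1 ∨ (x = -870 ∧ y = 24389) ∨ (y = -870 ∧ x = 24389) := by
  have key : ∀ n : ℕ, c = n → ¬ (n ∣ 2 ^ 5 * 3 * 5 * 7 ^ 2 * 13 * 29 ^ 3 * 67) → False := by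
    rintro n rfl h; exact h hN
  rcases hx with rfl | rfl | rfl | rfl <;> rcases hy with rfl | rfl | rfl | rfl <;>
  rcases he with rfl | rfl <;> first | (simp; done) | (exfalso; omega) | (
    exfalso
    first
    | exact key 1739 (by omega) (by decide +kernel)
    | exact key 868 (by omega) (by decide +kernel)
    | exact key 6971 (by omega) (by decide +kernel)
    | exact key 7842 (by omega) (by decide +kernel)
    | exact key 15681 (by omega) (by decide +kernel)
    | exact key 32230 (by omega) (by decide +kernel)
    | exact key 24391 (by omega) (by decide +kernel)
    | exact key 48779 (by omega) (by decide +kernel))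

universe uk ug
section Coh9

variable {k : Type uk} [Field k] [CharZero k] [IsAlgClosed k] {G : Type ug} [Group G] [Fintype G]
  {ι : Type*} [Fintype ι] {d : ι → ℕ}
  (φ : MonoidAlgebra k G ≃ₐ[k] (∀ i, Matrix (Fin (d i)) (Fin (d i)) k))
  {H N : Subgroup G}

theorem deg_one_trivial [Fintype H] (S : CohSetup H N) (a : ι) (ha : d a = 1)
    (hs : ∑ h : H, wChar φ a h = 871) (g : G) : wRep φ a g = 1 := by
  classical
  have hH : Fintype.card H = 871 := by rw [← Nat.card_eq_fintype_card]; exact S.cardH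
  let j : Fin (d a) := ⟨0, by omega⟩
  have hss : ∀ i : Fin (d a), i = j := by
    intro i; apply Fin.ext; have := i.2; simp only [j]; omega
  have hsub : Subsingleton (Fin (d a)) := ⟨fun x y => by rw [hss x, hss y]⟩
  have htr : ∀ M : Matrix (Fin (d a)) (Fin (d a)) k, M.trace = M j j := by
    intro M; rw [Matrix.trace, Fintype.sum_eq_single j (fun i hi => absurd (hss i) hi)]; rfl
  let f0 : G →* k :=
    { toFun := fun g => wRep φ a g j j
      map_one' := by simp
      map_mul' := by
        intro x y
        rw [map_mul, Matrix.mul_apply, Fintype.sum_eq_single j (fun i hi => absurd (hss i) hi)] }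
  let f : H →* kˣ := (f0.toHomUnits).comp H.subtype
  have hf : f = 1 := by
    by_contra hne
    have := hom_sum_zero 1 f (Ne.symm hne)
    simp only [MonoidHom.one_apply, Units.val_one, one_mul] at this
    have h2 : ∑ a_1 : H, ((f a_1 : kˣ) : k) = ∑ h : H, wChar φ a h := by
      refine Finset.sum_congr rfl fun h _ => ?_
      rw [wChar, htr]; rfl
    rw [h2, hs] at this
    norm_num at this
  have hK : (wRep φ a).ker = ⊤ := by
    apply S.perf _ (MonoidHom.normal_ker _)
    intro h hh
    rw [MonoidHom.mem_ker]
    ext x y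
    rw [hss x, hss y]
    have := congrArg (fun m : H →* kˣ => ((m ⟨h, hh⟩ : kˣ) : k)) hf
    simp only [MonoidHom.one_apply, Units.val_one] at this
    rw [Matrix.one_apply_eq]
    exact this
  have : g ∈ (wRep φ a).ker := by rw [hK]; trivial
  exact this

theorem coh_deg [Fintype H] [DecidableEq ι] (hd : ∀ i, d i ≠ 0) (S : CohSetup H N) :
    ∃ (Λ : Type (max uk ug)) (_ : Fintype Λ) (ev : Λ → H → k) (i1 a b : ι) (c : Λ → ι),
      Fintype.card Λ = 870 ∧ (∀ h : H, h ≠ 1 → ∑ l, ev l h = -1) ∧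
      d i1 = 1 ∧ (∀ g, wRep φ i1 g = 1) ∧ a ≠ i1 ∧ b ≠ i1 ∧ a ≠ b ∧ d a = 870 ∧ d b = 24389 ∧
      (∀ l, c l ≠ i1 ∧ c l ≠ a ∧ c l ≠ b ∧ d (c l) = 23520) ∧
      290 ≤ (univ.image c).card ∧
      (∀ i, i ≠ i1 → i ≠ a → i ≠ b → (∀ l, c l ≠ i) → 871 ∣ d i) ∧
      (∀ i, i ≠ i1 → i ≠ a → i ≠ b → ∀ h : H, h ≠ 1 →
        wChar φ i h = ∑ l, if c l = i then ev l h else 0) ∧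
      (∀ x, (x = 1 ∨ ∀ y, y⁻¹ * x * y ∉ H) → ∀ l,
        wChar φ (c l) x = 1 - wChar φ a x + wChar φ b x) := by
  classical
  obtain ⟨Λ, hF, ev, v1, u, i1, hLam, hev, hi1, htriv, huniq, hu1, hn4, h34, hfib, hdeg, hchar,
    hsum, hrel⟩ := coh_core φ hd S
  have himg : 290 ≤ (univ.image u).card := by
    have := Finset.card_le_mul_card_image (s := (univ : Finset Λ)) (f := u) 3 (by
      intro b hb
      obtain ⟨l, -, rfl⟩ := Finset.mem_image.1 hb
      exact hfib l)
    rw [Finset.card_univ, hLam] at this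
    omega
  obtain ⟨a, b, ha1, hb1, hab, da, db, hda, hdb, hua, hub, c, hc⟩ :=
    signed_core u i1 hu1 hn4 h34 (by omega)
  have hcardG : Fintype.card G = 2 ^ 5 * 3 * 5 * 7 ^ 2 * 13 * 29 ^ 3 * 67 := by
    rw [← Nat.card_eq_fintype_card]; exact S.cardG
  have hdvd : ∀ i, d i ∣ 2 ^ 5 * 3 * 5 * 7 ^ 2 * 13 * 29 ^ 3 * 67 := by
    intro i; rw [← hcardG]; exact deg_dvd φ i (hd i)
  have hsq : ∀ i, d i ^ 2 ≤ 2 ^ 5 * 3 * 5 * 7 ^ 2 * 13 * 29 ^ 3 * 67 := by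
    intro i; rw [← hcardG, ← sum_sq_deg φ]
    exact Finset.single_le_sum (f := fun i => d i ^ 2) (fun _ _ => Nat.zero_le _) (Finset.mem_univ i)
  obtain ⟨l0⟩ : Nonempty Λ := by
    rw [← Fintype.card_pos_iff, hLam]; norm_num
  -- relation expanded
  have hex : ∀ x, (x = 1 ∨ ∀ y, y⁻¹ * x * y ∉ H) → ∀ l,
      (1 : k) + da * wChar φ a x + db * wChar φ b x + u l (c l) * wChar φ (c l) x = 0 := by
    intro x hx l
    have h := hrel x hx l
    obtain ⟨c1, c2, c3, c4, c5⟩ := hc l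
    have hs : ∑ i, (u l i : k) * wChar φ i x = ∑ i ∈ ({i1, a, b, c l} : Finset ι), (u l i : k) * wChar φ i x := by
      symm
      apply Finset.sum_subset (Finset.subset_univ _)
      intro i _ hi
      simp only [Finset.mem_insert, Finset.mem_singleton, not_or] at hi
      rw [c5 i hi.1 hi.2.1 hi.2.2.1 hi.2.2.2]; simp
    rw [hs, Finset.sum_insert (by simp [ha1.symm, hb1.symm, c1.symm]),
      Finset.sum_insert (by simp [hab, c2.symm]), Finset.sum_insert (by simp [c3.symm]),
      Finset.sum_singleton, hu1, hua, hub] at h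
    have : wChar φ i1 x = 1 := by rw [wChar, htriv]; simp [hi1]
    rw [this] at h
    push_cast at h
    linear_combination h
  have hdega : (d a : ℤ) = 871 * v1 a - 870 * da := by
    rw [hdeg a, Finset.sum_congr rfl (fun l _ => hua l), Finset.sum_const, Finset.card_univ, hLam]
    simp
  have hdegb : (d b : ℤ) = 871 * v1 b - 870 * db := by
    rw [hdeg b, Finset.sum_congr rfl (fun l _ => hub l), Finset.sum_const, Finset.card_univ, hLam]
    simp
  have hrel1 : ∀ l, (1 : ℤ) + da * d a + db * d b + u l (c l) * d (c l) = 0 := by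
    intro l
    have := hex 1 (Or.inl rfl) l
    simp only [wChar_one] at this
    exact_mod_cast this
  have na := num_deg (d a) (v1 a) da hda hdega (hdvd a) (hsq a)
  have nb := num_deg (d b) (v1 b) db hdb hdegb (hdvd b) (hsq b)
  have hnot1 : ∀ (a : ι) (da : ℤ) (hda : da = 1 ∨ da = -1) (ha1 : a ≠ i1)
      (hdega : (d a : ℤ) = 871 * v1 a - 870 * da), da * d a ≠ 1 := by
    intro a da hda ha1 hdega h
    have h1 : da = 1 := by
      rcases hda with h' | h'
      · exact h'
      · subst h'; omega
    subst h1
    have h2 : d a = 1 := by omega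
    have h3 : v1 a = 1 := by omega
    apply ha1
    apply huniq
    apply deg_one_trivial φ S a h2
    rw [hsum, h3]; norm_num
  have hfin : ∀ (a b : ι) (da db : ℤ), a ≠ i1 → b ≠ i1 → a ≠ b → (∀ l, u l a = da) →
      (∀ l, u l b = db) → (da = 1 ∨ da = -1) → (db = 1 ∨ db = -1) →
      (da * d a = -870 ∧ db * d b = 24389) →
      (∀ x, (x = 1 ∨ ∀ y, y⁻¹ * x * y ∉ H) → ∀ l,
      (1 : k) + da * wChar φ a x + db * wChar φ b x + u l (c l) * wChar φ (c l) x = 0) →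
      (∀ l, (1 : ℤ) + da * d a + db * d b + u l (c l) * d (c l) = 0) →
      (∀ l, c l ≠ i1 ∧ c l ≠ a ∧ c l ≠ b ∧ (u l (c l) = 1 ∨ u l (c l) = -1) ∧
        ∀ i, i ≠ i1 → i ≠ a → i ≠ b → i ≠ c l → u l i = 0) → 
      ∃ (Λ : Type (max uk ug)) (_ : Fintype Λ) (ev : Λ → H → k) (i1 a b : ι) (c : Λ → ι),
      Fintype.card Λ = 870 ∧ (∀ h : H, h ≠ 1 → ∑ l, ev l h = -1) ∧
      d i1 = 1 ∧ (∀ g, wRep φ i1 g = 1) ∧ a ≠ i1 ∧ b ≠ i1 ∧ a ≠ b ∧ d a = 870 ∧ d b = 24389 ∧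
      (∀ l, c l ≠ i1 ∧ c l ≠ a ∧ c l ≠ b ∧ d (c l) = 23520) ∧
      290 ≤ (univ.image c).card ∧
      (∀ i, i ≠ i1 → i ≠ a → i ≠ b → (∀ l, c l ≠ i) → 871 ∣ d i) ∧
      (∀ i, i ≠ i1 → i ≠ a → i ≠ b → ∀ h : H, h ≠ 1 →
        wChar φ i h = ∑ l, if c l = i then ev l h else 0) ∧
      (∀ x, (x = 1 ∨ ∀ y, y⁻¹ * x * y ∉ H) → ∀ l,
        wChar φ (c l) x = 1 - wChar φ a x + wChar φ b x) := by
    clear hex hrel1 hua hub hc ha1 hb1 hab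
    intro a b da db ha1 hb1 hab hua hub hda hdb hval hex hrel1 hc
    have hda' : da = -1 := by rcases hda with h | h <;> subst h <;> omega
    have hdb' : db = 1 := by rcases hdb with h | h <;> subst h <;> omega
    subst hda' hdb'
    have hA : d a = 870 := by omega
    have hB : d b = 24389 := by omega
    have hC : ∀ l, u l (c l) = -1 ∧ d (c l) = 23520 := by
      intro l
      have h := hrel1 l
      rw [hA, hB] at h
      rcases (hc l).2.2.2.1 with h' | h' <;> rw [h'] at h ⊢ <;> push_cast at h <;> omega
    refine ⟨Λ, hF, ev, i1, a, b, c, hLam, hev, hi1, htriv, ha1, hb1, hab, hA, hB,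
      fun l => ⟨(hc l).1, (hc l).2.1, (hc l).2.2.1, (hC l).2⟩, ?_, ?_, ?_, ?_⟩
    · refine himg.trans ?_
      -- u determined by c
      have : univ.image u ⊆ (univ.image c).image (fun j i => if i = i1 then (1 : ℤ) else if i = a then -1
          else if i = b then 1 else if i = j then -1 else 0) := by
        intro f hf
        obtain ⟨l, -, rfl⟩ := Finset.mem_image.1 hf
        refine Finset.mem_image.2 ⟨c l, Finset.mem_image_of_mem c (Finset.mem_univ l), ?_⟩
        funext i
        split_ifs with h1 h2 h3 h4
        · rw [h1, hu1]
        · rw [h2, hua]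
        · rw [h3, hub]
        · rw [h4, (hC l).1]
        · rw [(hc l).2.2.2.2 i h1 h2 h3 h4]
      exact (Finset.card_le_card this).trans Finset.card_image_le
    · intro i h1 h2 h3 h4
      have : ∑ l, u l i = 0 := Finset.sum_eq_zero fun l _ =>
        (hc l).2.2.2.2 i h1 h2 h3 (fun h => h4 l h.symm)
      have h5 := hdeg i
      rw [this] at h5
      exact ⟨v1 i, by omega⟩
    · intro i h1 h2 h3 h hh
      rw [hchar i h hh, ← Finset.sum_neg_distrib]
      refine Finset.sum_congr rfl fun l _ => ?_
      split_ifs with h4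
      · subst h4; rw [(hC l).1]; push_cast; ring
      · rw [(hc l).2.2.2.2 i h1 h2 h3 (fun h => h4 h.symm)]; simp
    · intro x hx l
      have h := hex x hx l
      rw [(hC l).1] at h
      push_cast at h
      linear_combination -h
  rcases num_three (da * d a) (db * d b) (d (c l0)) na nb _ (hc l0).2.2.2.1 (hrel1 l0) (hdvd _) with
    h | h | h
  · exact absurd h (hnot1 a da hda ha1 hdega)
  · exact hfin a b da db ha1 hb1 hab hua hub hda hdb h hex hrel1 hc
  · refine hfin b a db da hb1 ha1 hab.symm hub hua hdb hda ⟨h.1, h.2⟩ ?_ ?_ ?_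
    · intro x hx l; linear_combination hex x hx l
    · intro l; linear_combination hrel1 l
    · intro l
      obtain ⟨c1, c2, c3, c4, c5⟩ := hc l
      exact ⟨c1, c3, c2, c4, fun i h1 h2 h3 h4 => c5 i h1 h3 h2 h4⟩

end Coh9
end

section
open Finset

section Coh10a
variable {k : Type} [Field k] [CharZero k] [IsAlgClosed k] {G : Type*} [Group G] [Fintype G]
  {ι : Type*} [Fintype ι] {d : ι → ℕ}
  (φ : MonoidAlgebra k G ≃ₐ[k] (∀ i, Matrix (Fin (d i)) (Fin (d i)) k))

theorem cent_sum_le (e : k →+* ℂ) (x : G) (J : Finset ι) (z : ι → ℤ)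
    (hz : ∀ i ∈ J, wChar φ i x = z i) :
    ∑ i ∈ J, z i ^ 2 ≤ (Nat.card (Subgroup.centralizer {x}) : ℤ) := by
  classical
  have hcard : (univ.filter fun y : G => x * y * x⁻¹ = y).card = Nat.card (Subgroup.centralizer {x}) := by
    rw [Nat.card_eq_fintype_card, Fintype.card_subtype]
    congr 1
    ext y
    simp only [Finset.mem_filter, Finset.mem_univ, true_and, Subgroup.mem_centralizer_singleton_iff]
    rw [mul_inv_eq_iff_eq_mul]
    exact eq_comm
  have h := wChar_orth φ x x
  rw [hcard] at h
  have h2 := congrArg e h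
  rw [map_sum] at h2
  have h3 : ∀ i, e (wChar φ i x * wChar φ i x⁻¹) = ((Complex.normSq (e (wChar φ i x)) : ℝ) : ℂ) := by
    intro i
    let ρ : G →* Matrix (Fin (d i)) (Fin (d i)) ℂ := (RingHom.toMonoidHom (e.mapMatrix (m := Fin (d i)))).comp (wRep φ i)
    have hρ : ∀ g, (ρ g).trace = e (wChar φ i g) := by
      intro g
      simp only [ρ, wChar, MonoidHom.comp_apply]
      exact (AddMonoidHom.map_trace (e : k →+ ℂ) (wRep φ i g)).symm
    have h4 := star_trace ρ x
    rw [hρ, hρ] at h4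
    rw [map_mul, ← h4, Complex.mul_conj]
  rw [Finset.sum_congr rfl (fun i _ => h3 i), ← Complex.ofReal_sum, map_natCast] at h2
  have h5 : ∑ i, Complex.normSq (e (wChar φ i x)) = (Nat.card (Subgroup.centralizer {x}) : ℝ) := by
    exact_mod_cast h2
  have h6 : ∑ i ∈ J, Complex.normSq (e (wChar φ i x)) ≤ (Nat.card (Subgroup.centralizer {x}) : ℝ) := by
    rw [← h5]
    exact Finset.sum_le_sum_of_subset_of_nonneg (Finset.subset_univ J)
      (fun i _ _ => Complex.normSq_nonneg _)
  have h7 : ∑ i ∈ J, Complex.normSq (e (wChar φ i x)) = ((∑ i ∈ J, z i ^ 2 : ℤ) : ℝ) := by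
    push_cast
    refine Finset.sum_congr rfl fun i hi => ?_
    rw [hz i hi, map_intCast, Complex.normSq_intCast]; ring
  rw [h7] at h6
  exact_mod_cast h6

theorem class_card (x : G) (m : ℕ) (hm : Nat.card (Subgroup.centralizer {x}) * m = Nat.card G) 
    [DecidablePred (fun g => IsConj x g)] :
    (univ.filter fun g => IsConj x g).card = m := by
  classical
  have h1 : Nat.card (ConjClasses.mk x).carrier * Nat.card (Subgroup.centralizer {x}) = Nat.card G := by
    have := Subgroup.nat_card_centralizer_nat_card_stabilizer x
    rw [this]
    have h2 := MulAction.card_orbit_mul_card_stabilizer_eq_card_group (ConjAct G) x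
    rw [← Nat.card_eq_fintype_card, ← Nat.card_eq_fintype_card, ← Nat.card_eq_fintype_card] at h2
    rw [← ConjAct.orbit_eq_carrier_conjClasses]
    exact h2
  have h3 : (univ.filter fun g => IsConj x g).card = Nat.card (ConjClasses.mk x).carrier := by
    rw [Nat.card_eq_fintype_card, ← Set.toFinset_card]
    congr 1
    ext g
    rw [Finset.mem_filter, Set.mem_toFinset, ConjClasses.mem_carrier_iff_mk_eq,
      ConjClasses.mk_eq_mk_iff_isConj]
    exact ⟨fun h => h.2.symm, fun h => ⟨Finset.mem_univ g, h.symm⟩⟩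
  have hpos : 0 < Nat.card (Subgroup.centralizer {x}) := Nat.card_pos
  rw [h3]
  apply Nat.eq_of_mul_eq_mul_left hpos
  rw [hm, mul_comm, h1]

theorem class_dvd (hd : ∀ i, d i ≠ 0) (i : ι) (x : G) (m : ℕ)
    (hm : Nat.card (Subgroup.centralizer {x}) * m = Nat.card G) (z : ℤ) (hz : wChar φ i x = z) :
    (d i : ℤ) ∣ m * z := by
  classical
  have h := class_integral φ i (hd i) x
  rw [class_card x m hm, hz] at h
  apply dvd_of_integral (k := k) (m * z) (d i) (by exact_mod_cast hd i)
  push_cast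
  exact h

theorem class_conv (hd : ∀ i, d i ≠ 0) (y h : G) (m : ℕ)
    (hm : Nat.card (Subgroup.centralizer {y}) * m = Nat.card G) :
    ∃ n : ℕ, (Nat.card G : k) * n = ∑ i, (m : k) ^ 2 * wChar φ i y ^ 2 * wChar φ i h⁻¹ / d i := by
  classical
  let f : G → k := fun g => if IsConj y g then 1 else 0
  refine ⟨∑ g, if IsConj y g ∧ IsConj y (g⁻¹ * h) then 1 else 0, ?_⟩
  have h1 := coeff_formula φ (fun x => ∑ g, f g * f (g⁻¹ * x)) h
  have h2 : ((∑ g, if IsConj y g ∧ IsConj y (g⁻¹ * h) then 1 else 0 : ℕ) : k) =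
      ∑ g, f g * f (g⁻¹ * h) := by
    push_cast
    refine Finset.sum_congr rfl fun g _ => ?_
    simp only [f]
    by_cases h3 : IsConj y g <;> by_cases h4 : IsConj y (g⁻¹ * h)
    · rw [if_pos ⟨h3, h4⟩, if_pos h3, if_pos h4, one_mul]
    · rw [if_neg (fun h => h4 h.2), if_neg h4, mul_zero]
    · rw [if_neg (fun h => h3 h.1), if_neg h3, zero_mul]
    · rw [if_neg (fun h => h3 h.1), if_neg h3, zero_mul]
  rw [h2, Nat.card_eq_fintype_card, h1]
  refine Finset.sum_congr rfl fun i _ => ?_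
  rw [conv_image]
  simp only [f]
  rw [class_sum_scalar φ i (hd i) y, class_card y m hm]
  rw [Matrix.smul_mul, Matrix.one_mul, smul_smul, Matrix.smul_mul, Matrix.one_mul, Matrix.trace_smul,
    smul_eq_mul]
  have : (d i : k) ≠ 0 := by exact_mod_cast hd i
  rw [wChar, wChar]
  field_simp

end Coh10a

structure CharIface {G : Type*} [Group G] (H : Subgroup G) (α β : G → ℤ) : Prop where
  one : α 1 = 870
  conj : ∀ x g, α (x * g * x⁻¹) = α g
  bound : ∀ x, (∀ y, y⁻¹ * x * y ∉ H) → 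
    1 + α x ^ 2 + β x ^ 2 + 290 * (1 - α x + β x) ^ 2 ≤ (Nat.card (Subgroup.centralizer {x}) : ℤ)
  dvd : ∀ x, (∀ y, y⁻¹ * x * y ∉ H) → ∀ m : ℕ,
    Nat.card (Subgroup.centralizer {x}) * m = Nat.card G →
    (870 : ℤ) ∣ m * α x ∧ (24389 : ℤ) ∣ m * β x ∧ (23520 : ℤ) ∣ m * (1 - α x + β x)
  sub : ∀ (A : Subgroup G) (_ : Fintype A), ∃ m : ℕ, ∑ a : A, α a = Nat.card A * m
  frob : ∀ x t, x ^ (29 ^ t) = 1 → (29 : ℤ) ∣ α x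
  conv : ∀ x, (∀ y, y⁻¹ * x * y ∉ H) → α x = 0 → β x = 0 → ∀ m : ℕ,
    Nat.card (Subgroup.centralizer {x}) * m = Nat.card G →
    ∃ n : ℕ, 23520 * Nat.card G * n = m ^ 2 * 23519

theorem sum_J {ι : Type*} (d : ι → ℕ) (J : Finset ι) (i : ι) (hi : i ∈ J) (hd : ∀ i, d i ≠ 0) 
    (h : ∑ j ∈ J, d j ^ 2 = d i ^ 2) : J = {i} := by
  classical
  rw [← Finset.add_sum_erase J _ hi] at h
  have h1 : ∑ j ∈ J.erase i, d j ^ 2 = 0 := by omega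
  rw [Finset.sum_eq_zero_iff] at h1
  have h2 : J.erase i = ∅ := by
    rw [Finset.eq_empty_iff_forall_notMem]
    intro j hj
    exact hd j (pow_eq_zero_iff two_ne_zero |>.1 (h1 j hj))
  rw [← Finset.insert_erase hi, h2]
  rfl

theorem char_iface_aux {G : Type*} [Group G] [Fintype G] {H N : Subgroup G} [Fintype H]
    (S : CohSetup H N)
    {k : Type} [Field k] [CharZero k] [IsAlgClosed k] (e : k →+* ℂ)
    (hIntegral : ∀ x : k, IsIntegral ℤ x → (∀ σ : k →+* k, σ x = x) → ∃ z : ℤ, (z : k) = x)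
    {n : ℕ} {d : Fin n → ℕ} (hd : ∀ i, d i ≠ 0)
    (φ : MonoidAlgebra k G ≃ₐ[k] (∀ i, Matrix (Fin (d i)) (Fin (d i)) k)) :
    ∃ α β : G → ℤ, CharIface H α β := by
  classical
  obtain ⟨Λ, hF, ev, i1, a, b, c, hLam, hev, hi1, htriv, ha1, hb1, hab, hA, hB, hC, himg, hother,
    hchar, hrel⟩ := coh_deg φ hd S
  have hJa : ∀ J : Finset (Fin n), ∑ j ∈ J, d j ^ 2 = d a ^ 2 → J = {a} := by
    intro J hJ
    by_cases haJ : a ∈ J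
    · exact sum_J d J a haJ hd hJ
    exfalso
    have h1 : J ⊆ {i1} := by
      intro j hj
      have hle : d j ^ 2 ≤ 870 ^ 2 := by
        rw [← hA, ← hJ]
        exact Finset.single_le_sum (f := fun i => d i ^ 2) (fun _ _ => Nat.zero_le _) hj
      have hle' : d j ≤ 870 := (Nat.pow_le_pow_iff_left two_ne_zero).1 hle
      rw [Finset.mem_singleton]
      by_contra hne1
      have hja : j ≠ a := fun h => haJ (h ▸ hj)
      have hjb : j ≠ b := by rintro rfl; omega
      have hjc : ∀ l, c l ≠ j := by
        rintro l rfl; have := (hC l).2.2.2; omega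
      obtain ⟨t, ht⟩ := hother j hne1 hja hjb hjc
      have := hd j
      rcases t with _ | t <;> omega
    have h2 : ∑ j ∈ J, d j ^ 2 ≤ ∑ j ∈ {i1}, d j ^ 2 :=
      Finset.sum_le_sum_of_subset h1
    rw [Finset.sum_singleton, hi1, hJ, hA] at h2
    omega
  have hJb : ∀ J : Finset (Fin n), ∑ j ∈ J, d j ^ 2 = d b ^ 2 → J = {b} := by
    intro J hJ
    by_cases hbJ : b ∈ J
    · exact sum_J d J b hbJ hd hJ
    exfalso
    have hsplit : ∀ (J : Finset (Fin n)) , b ∉ J → ∃ s1 sa nc R : ℕ, s1 ≤ 1 ∧ sa ≤ 1 ∧ 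
        ∑ j ∈ J, d j ^ 2 = s1 + sa * 756900 + nc * 553190400 + 758641 * R ∧ 
        (i1 ∉ J → s1 = 0) ∧ (a ∉ J → sa = 0) := by
      intro J
      induction J using Finset.induction_on with
      | empty => intro _; exact ⟨0, 0, 0, 0, by simp⟩
      | insert j J hj ih =>
        intro hbJ
        rw [Finset.mem_insert, not_or] at hbJ
        obtain ⟨s1, sa, nc, R, k1, k2, k3, k4, k5⟩ := ih hbJ.2
        rw [Finset.sum_insert hj, k3]
        by_cases h1 : j = i1
        · subst h1
          refine ⟨1, sa, nc, R, le_refl _, k2, ?_, ?_, ?_⟩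
          · rw [hi1, k4 hj]; ring
          · simp
          · intro h; exact k5 (fun h' => h (Finset.mem_insert_of_mem h'))
        by_cases h2 : j = a
        · subst h2
          refine ⟨s1, 1, nc, R, k1, le_refl _, ?_, ?_, ?_⟩
          · rw [hA, k5 hj]; ring
          · intro h; exact k4 (fun h' => h (Finset.mem_insert_of_mem h'))
          · simp
        have k4' : i1 ∉ insert j J → s1 = 0 := fun h => k4 (fun h' => h (Finset.mem_insert_of_mem h'))
        have k5' : a ∉ insert j J → sa = 0 := fun h => k5 (fun h' => h (Finset.mem_insert_of_mem h'))
        by_cases h3 : ∃ l, c l = j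
        · obtain ⟨l, rfl⟩ := h3
          refine ⟨s1, sa, nc + 1, R, k1, k2, ?_, k4', k5'⟩
          rw [(hC l).2.2.2]; ring
        · push Not at h3
          obtain ⟨t, ht⟩ := hother j h1 h2 (Ne.symm hbJ.1) h3
          refine ⟨s1, sa, nc, R + t ^ 2, k1, k2, ?_, k4', k5'⟩
          rw [ht]; ring
    obtain ⟨s1, sa, nc, R, k1, k2, k3, -⟩ := hsplit J hbJ
    rw [hJ, hB] at k3
    have : nc ≤ 1 := by omega
    interval_cases s1 <;> interval_cases sa <;> interval_cases nc <;> omega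
  have hα : ∀ g, ∃ z : ℤ, (z : k) = wChar φ a g := fun g =>
    hIntegral _ (wChar_integral φ a g) (fun σ => galois_fix φ hd a hJa σ g)
  have hβ : ∀ g, ∃ z : ℤ, (z : k) = wChar φ b g := fun g =>
    hIntegral _ (wChar_integral φ b g) (fun σ => galois_fix φ hd b hJb σ g)
  choose α hα using hα
  choose β hβ using hβ
  have hγ : ∀ x, (∀ y, y⁻¹ * x * y ∉ H) → ∀ l, wChar φ (c l) x = ((1 - α x + β x : ℤ) : k) := by
    intro x hx l
    rw [hrel x (Or.inr hx) l, ← hα, ← hβ]; push_cast; ring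
  have hi1c : ∀ x, wChar φ i1 x = ((1 : ℤ) : k) := by
    intro x; rw [wChar, htriv]; simp [hi1]
  obtain ⟨l0⟩ : Nonempty Λ := by
    rw [← Fintype.card_pos_iff, hLam]; norm_num
  refine ⟨α, β, ?_, ?_, ?_, ?_, ?_, ?_, ?_⟩
  · have := hα 1
    rw [wChar_one, hA] at this
    exact_mod_cast this
  · intro x g
    have : (α (x * g * x⁻¹) : k) = α g := by rw [hα, hα, wChar_conj]
    exact_mod_cast this
  · intro x hx
    let z : Fin n → ℤ := fun i => if i = i1 then 1 else if i = a then α x else if i = b then β x else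
      1 - α x + β x
    have h := cent_sum_le φ e x ({i1, a, b} ∪ univ.image c) z (by
      intro i hi
      simp only [Finset.mem_union, Finset.mem_insert, Finset.mem_singleton, Finset.mem_image,
        Finset.mem_univ, true_and] at hi
      simp only [z]
      split_ifs with h1 h2 h3
      · rw [h1, hi1c]
      · rw [h2, hα]
      · rw [h3, hβ]
      · rcases hi with hi | ⟨l, rfl⟩
        · tauto
        · rw [hγ x hx])
    rw [Finset.sum_union, Finset.sum_insert (by simp [ha1.symm, hb1.symm]),
      Finset.sum_insert (by simp [hab]), Finset.sum_singleton] at h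
    · have h5 : ∑ i ∈ univ.image c, z i ^ 2 = (univ.image c).card * (1 - α x + β x) ^ 2 := by
        rw [Finset.sum_congr rfl (g := fun _ => (1 - α x + β x) ^ 2), Finset.sum_const, nsmul_eq_mul]
        intro i hi
        obtain ⟨l, -, rfl⟩ := Finset.mem_image.1 hi
        simp [z, (hC l).1, (hC l).2.1, (hC l).2.2.1]
      rw [h5] at h
      have h6 : z i1 = 1 := by simp [z]
      have h7 : z a = α x := by simp [z, ha1]
      have h8 : z b = β x := by simp [z, hb1, hab.symm]
      rw [h6, h7, h8] at h
      have h9 : (290 : ℤ) ≤ (univ.image c).card := by exact_mod_cast himg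
      nlinarith [sq_nonneg (1 - α x + β x)]
    · rw [Finset.disjoint_right]
      intro i hi
      obtain ⟨l, -, rfl⟩ := Finset.mem_image.1 hi
      simp [(hC l).1, (hC l).2.1, (hC l).2.2.1]
  · intro x hx m hm
    refine ⟨?_, ?_, ?_⟩
    · have := class_dvd φ hd a x m hm (α x) (hα x).symm
      rw [hA] at this; exact_mod_cast this
    · have := class_dvd φ hd b x m hm (β x) (hβ x).symm
      rw [hB] at this; exact_mod_cast this
    · have := class_dvd φ hd (c l0) x m hm _ (hγ x hx l0)
      rw [(hC l0).2.2.2] at this; exact_mod_cast this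
  · intro A _
    obtain ⟨m, hm⟩ := sub_mult φ A 1 a
    refine ⟨m, ?_⟩
    have : ((∑ a : A, α a : ℤ) : k) = ((Nat.card A * m : ℤ) : k) := by
      push_cast
      rw [Nat.card_eq_fintype_card, ← hm]
      refine Finset.sum_congr rfl fun g _ => ?_
      rw [hα]; simp
    exact_mod_cast this
  · intro x t hx
    have : Fact (Nat.Prime 29) := ⟨by norm_num⟩
    have h := frob_trace (p := 29) (t := t) (wRep φ a x) (by rw [← map_pow, hx, map_one]) (α x)
      (hα x).symm
    rw [hA] at h
    have h2 : (29 : ℤ) ∣ 870 := by norm_num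
    have := dvd_add h h2
    simpa using this
  · intro x hx h0 h0' m hm
    obtain ⟨h, hh⟩ : ∃ h : H, h ≠ 1 := by
      have : Nontrivial H := Finite.one_lt_card_iff_nontrivial.1 (by rw [S.cardH]; norm_num)
      exact exists_ne 1
    obtain ⟨n', hn'⟩ := class_conv φ hd x (h : G)⁻¹ m hm
    refine ⟨n', ?_⟩
    have hT : ∀ i, (m : k) ^ 2 * wChar φ i x ^ 2 * wChar φ i ((h : G)⁻¹)⁻¹ / d i =
        (if i1 = i then (m : k) ^ 2 else 0) + ∑ l, if c l = i then (m : k) ^ 2 * ev l h / 23520 else 0 := by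
      intro i
      rw [inv_inv]
      by_cases h1 : i1 = i
      · subst h1
        rw [Finset.sum_eq_zero (fun l _ => by rw [if_neg (hC l).1])]
        simp [hi1c, hi1]
      by_cases h2 : i = a
      · subst h2
        rw [Finset.sum_eq_zero (fun l _ => by rw [if_neg (hC l).2.1]), ← hα x, h0]
        simp [h1]
      by_cases h3 : i = b
      · subst h3
        rw [Finset.sum_eq_zero (fun l _ => by rw [if_neg (hC l).2.2.1]), ← hβ x, h0']
        simp [h1]
      rw [hchar i (Ne.symm h1) h2 h3 h hh, if_neg h1, zero_add, Finset.mul_sum, Finset.sum_div]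
      refine Finset.sum_congr rfl fun l _ => ?_
      split_ifs with h4
      · subst h4
        rw [hγ x hx l, h0, h0', (hC l).2.2.2]
        simp
      · simp
    rw [Finset.sum_congr rfl (fun i _ => hT i), Finset.sum_add_distrib, Finset.sum_comm] at hn'
    simp only [Finset.sum_ite_eq, Finset.mem_univ, if_true] at hn'
    rw [← Finset.sum_div, ← Finset.mul_sum, hev h hh] at hn'
    have : ((23520 * Nat.card G * n' : ℕ) : k) = ((m ^ 2 * 23519 : ℕ) : k) := by
      push_cast
      rw [mul_assoc, hn']
      ring
    exact_mod_cast this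

theorem char_iface {G : Type*} [Group G] [Finite G] {H N : Subgroup G} (S : CohSetup H N) :
    ∃ α β : G → ℤ, CharIface H α β := by
  classical
  have _ : Fintype G := Fintype.ofFinite G
  have hss : IsSemisimpleRing (MonoidAlgebra (AlgebraicClosure ℚ) G) := inferInstance
  obtain ⟨n, d, hne, ⟨φ⟩⟩ :=
    IsSemisimpleRing.exists_algEquiv_pi_matrix_of_isAlgClosed (AlgebraicClosure ℚ)
      (MonoidAlgebra (AlgebraicClosure ℚ) G)
  have : IsAlgClosure ℚ (AlgebraicClosure ℚ) := by
    convert @AlgebraicClosure.instIsAlgClosure ℚ _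
    · rfl
    · exact Subsingleton.elim _ _
  have : Algebra.IsAlgebraic ℚ (AlgebraicClosure ℚ) := IsAlgClosure.isAlgebraic
  exact char_iface_aux S
    (IsAlgClosed.lift (R := ℚ) (S := AlgebraicClosure ℚ) (M := ℂ) : AlgebraicClosure ℚ →ₐ[ℚ] ℂ).toRingHom
    int_of_fixed (fun i => (hne i).out) φ
end

section
/-- `p` has at most one neighbour -/
def UniqNbr (G : Type*) [Group G] (p : ℕ) : Prop :=
  ∀ r r' : ℕ, r.Prime → r'.Prime → r ≠ p → r' ≠ p → (∃ x : G, orderOf x = p * r) →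
    (∃ x : G, orderOf x = p * r') → r = r'

theorem uniqNbr_of_deg {G : Type*} [Group G] [Finite G] {p : ℕ} (hp : p.Prime)
    (hdeg : primeGraphDeg G p = 1) : UniqNbr G p := by
  intro r r' hr hr' hne hne' ⟨x, hx⟩ ⟨x', hx'⟩
  classical
  have key : ∀ r : ℕ, r.Prime → r ≠ p → (∃ x : G, orderOf x = p * r) → 
      r ∈ (Nat.card G).primeFactors.filter (fun r => primeGraphAdj G p r) := by
    rintro r hr hne ⟨x, hx⟩
    have hd : p * r ∣ Nat.card G := hx ▸ orderOf_dvd_natCard x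
    have hr' : r ∣ Nat.card G := (Dvd.intro_left p rfl).trans hd
    rw [Finset.mem_filter, Nat.mem_primeFactors]
    exact ⟨⟨hr, hr', Nat.card_pos.ne'⟩, Ne.symm hne, hp, hr, (Dvd.intro r rfl).trans hd, hr', x, hx⟩
  unfold primeGraphDeg at hdeg
  exact Finset.card_le_one.1 (le_of_eq (by convert hdeg)) r (key r hr hne ⟨x, hx⟩) r' (key r' hr' hne' ⟨x', hx'⟩)

theorem cent_prime {G : Type*} [Group G] [Finite G] {p r : ℕ} (hp : p.Prime) (hr : r.Prime)
    (hne : r ≠ p) (g : G) (hg : orderOf g = p) (h : r ∣ Nat.card (Subgroup.centralizer {g})) :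
    ∃ x : G, orderOf x = p * r := by
  have : Fact r.Prime := ⟨hr⟩
  obtain ⟨y, hy⟩ := exists_prime_orderOf_dvd_card' r h
  have hy' : orderOf (y : G) = r := by rw [Subgroup.orderOf_coe]; exact hy
  have hc : Commute g (y : G) := by
    exact (Subgroup.mem_centralizer_singleton_iff.1 y.2).symm
  refine ⟨g * y, ?_⟩
  rw [hc.orderOf_mul_eq_mul_orderOf_of_coprime, hg, hy']
  rw [hg, hy']
  exact (Nat.coprime_primes hp hr).2 hne.symm

theorem dvd_form {m : ℕ} (hm : m ∣ 2 ^ 5 * 3 * 5 * 7 ^ 2 * 13 * 29 ^ 3) :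
    ∃ a < 6, ∃ b < 2, ∃ c < 2, ∃ d < 3, ∃ e < 2, ∃ f < 4,
      m = 2 ^ a * 3 ^ b * 5 ^ c * 7 ^ d * 13 ^ e * 29 ^ f := by
  obtain ⟨m1, f, h1, hf, rfl⟩ := (Nat.dvd_mul).1 hm
  obtain ⟨m2, e, h2, he, rfl⟩ := (Nat.dvd_mul).1 h1
  obtain ⟨m3, d, h3, hd, rfl⟩ := (Nat.dvd_mul).1 h2
  obtain ⟨m4, c, h4, hc, rfl⟩ := (Nat.dvd_mul).1 h3
  obtain ⟨a, b, h5, hb, rfl⟩ := (Nat.dvd_mul).1 h4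
  obtain ⟨a', ha', rfl⟩ := (Nat.dvd_prime_pow (by norm_num)).1 h5
  obtain ⟨d', hd', rfl⟩ := (Nat.dvd_prime_pow (by norm_num)).1 hd
  obtain ⟨f', hf', rfl⟩ := (Nat.dvd_prime_pow (by norm_num)).1 hf
  obtain ⟨b', hb', rfl⟩ := (Nat.dvd_prime_pow (i := b) (m := 1) (by norm_num : Nat.Prime 3)).1 (by simpa using hb)
  obtain ⟨c', hc', rfl⟩ := (Nat.dvd_prime_pow (i := c) (m := 1) (by norm_num : Nat.Prime 5)).1 (by simpa using hc)
  obtain ⟨e', he', rfl⟩ := (Nat.dvd_prime_pow (i := e) (m := 1) (by norm_num : Nat.Prime 13)).1 (by simpa using he)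
  exact ⟨a', by omega, b', by omega, c', by omega, d', by omega, e', by omega, f', by omega, rfl⟩

def chk67 (m t : ℕ) : Bool :=
  !([2, 3, 5, 7, 13, 29].all fun r => [2, 3, 5, 7, 13, 29].all fun r' =>
      (!(m % r == 0) || !(m % r' == 0) || r == r')) ||
    !(m * t % 67 == 39) || !(t == 1 || t == 2 || t == 3 || t == 6) || (m == 13 && t == 3)

theorem num67 {m t : ℕ} (hm : m ∣ 2 ^ 5 * 3 * 5 * 7 ^ 2 * 13 * 29 ^ 3)
    (hu : ∀ r r' : ℕ, r.Prime → r'.Prime → r ∣ m → r' ∣ m → r = r')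
    (ht : t ∣ 66) (htm : m * t ∣ 2 ^ 5 * 3 * 5 * 7 ^ 2 * 13 * 29 ^ 3) (h : m * t % 67 = 39) : m = 13 ∧ t = 3 := by
  obtain ⟨a, ha, b, hb, c, hc, d, hd, e, he, f, hf, hm'⟩ := dvd_form hm
  have ht' : t = 1 ∨ t = 2 ∨ t = 3 ∨ t = 6 := by
    have h1 : t ∈ Nat.divisors 66 := Nat.mem_divisors.2 ⟨ht, by norm_num⟩
    have h2 : Nat.divisors 66 = {1, 2, 3, 6, 11, 22, 33, 66} := by decide +kernel
    rw [h2] at h1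
    simp only [Finset.mem_insert, Finset.mem_singleton] at h1
    have h3 : ¬ 11 ∣ t := by
      intro h
      have : 11 ∣ 2 ^ 5 * 3 * 5 * 7 ^ 2 * 13 * 29 ^ 3 := (h.trans (Dvd.intro_left m rfl)).trans htm
      revert this; decide +kernel
    rcases h1 with h | h | h | h | h | h | h | h <;> subst h <;> simp at h3 ⊢
  have key : ((List.range 6).all fun a => (List.range 2).all fun b => (List.range 2).all fun c =>
      (List.range 3).all fun d => (List.range 2).all fun e => (List.range 4).all fun f =>
      (List.range 7).all fun t =>
      chk67 (2 ^ a * 3 ^ b * 5 ^ c * 7 ^ d * 13 ^ e * 29 ^ f) t) = true := by decide +kernel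
  simp only [List.all_eq_true, List.mem_range] at key
  have h7 := key a ha b hb c hc d hd e he f hf t (by omega)
  rw [← hm'] at h7
  have hpr : ∀ r ∈ [2, 3, 5, 7, 13, 29], Nat.Prime r := by
    intro r hr; fin_cases hr <;> norm_num
  have h8 : ([2, 3, 5, 7, 13, 29].all fun r => [2, 3, 5, 7, 13, 29].all fun r' =>
      (!(m % r == 0) || !(m % r' == 0) || r == r')) = true := by
    rw [List.all_eq_true]; intro r hr
    rw [List.all_eq_true]; intro r' hr'
    by_cases k1 : m % r = 0
    · by_cases k2 : m % r' = 0
      · have := hu r r' (hpr r hr) (hpr r' hr') (Nat.dvd_of_mod_eq_zero k1) (Nat.dvd_of_mod_eq_zero k2)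
        simp [this]
      · simp [k2]
    · simp [k1]
  unfold chk67 at h7
  rw [h8] at h7
  have h9 : (t == 1 || t == 2 || t == 3 || t == 6) = true := by
    rcases ht' with h | h | h | h <;> rw [h] <;> rfl
  rw [h9] at h7
  simp only [h, Bool.not_true, Bool.false_or, Bool.or_eq_true, Bool.and_eq_true, beq_iff_eq,
    beq_self_eq_true] at h7
  simpa using h7

theorem step67 {G : Type*} [Group G] [Finite G]
    (hcard : Nat.card G = 2 ^ 5 * 3 * 5 * 7 ^ 2 * 13 * 29 ^ 3 * 67) (hu : UniqNbr G 67)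
    (g : G) (hg : orderOf g = 67) :
    Nat.card (Subgroup.centralizer {g}) = 871 ∧
    Nat.card (Subgroup.normalizer (Subgroup.zpowers g : Set G)) = 2613 := by
  have : Fact (Nat.Prime 67) := ⟨by norm_num⟩
  have hP : Nat.card (Subgroup.zpowers g) = 67 := by rw [Nat.card_zpowers, hg]
  have hfac : (Nat.card G).factorization 67 = 1 := by
    rw [hcard]
    rw [Nat.factorization_mul (by norm_num) (by norm_num)]
    rw [Finsupp.add_apply, Nat.Prime.factorization_self (by norm_num),
      Nat.factorization_eq_zero_of_not_dvd (by decide +kernel)]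
  let P : Sylow 67 G := Sylow.ofCard (Subgroup.zpowers g) (by rw [hP, hfac, pow_one])
  have hPc : (P : Subgroup G) = Subgroup.zpowers g := rfl
  have h1 := card_sylow_modEq_one 67 G
  rw [P.card_eq_index_normalizer] at h1
  have hcent : Subgroup.centralizer ((Subgroup.zpowers g : Subgroup G) : Set G) = Subgroup.centralizer {g} := by
    rw [Subgroup.zpowers_eq_closure, Subgroup.centralizer_closure]
  set C := Subgroup.centralizer {g} with hC
  set Nm := Subgroup.normalizer (Subgroup.zpowers g : Set G) with hNm
  have hCN : C ≤ Nm := by rw [← hcent]; exact Subgroup.centralizer_le_normalizer _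
  have hker := Subgroup.card_dvd_of_injective _ (QuotientGroup.kerLift_injective (Subgroup.zpowers g).normalizerMonoidHom)
  rw [Subgroup.normalizerMonoidHom_ker, ← Subgroup.index, ← Subgroup.relIndex, IsCyclic.card_mulAut, hP,
    hcent, Nat.totient_prime (by norm_num)] at hker
  have hidx : Nat.card C * C.relIndex Nm = Nat.card Nm := by
    rw [← Subgroup.card_mul_index (C.subgroupOf Nm), Nat.card_congr (Subgroup.subgroupOfEquivOfLe hCN).toEquiv]
    rfl
  have hgC : Subgroup.zpowers g ≤ C := by
    rw [Subgroup.zpowers_le, hC, Subgroup.mem_centralizer_singleton_iff]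
  obtain ⟨m, hm⟩ : 67 ∣ Nat.card C := hP ▸ Subgroup.card_dvd_of_le hgC
  have hNidx : Nat.card Nm * Nm.index = Nat.card G := Subgroup.card_mul_index Nm
  set t := C.relIndex Nm
  have e1 : m * t * Nm.index = 2 ^ 5 * 3 * 5 * 7 ^ 2 * 13 * 29 ^ 3 := by
    apply Nat.eq_of_mul_eq_mul_left (by norm_num : 0 < 67)
    rw [← mul_assoc, ← mul_assoc, ← hm, hidx, hNidx, hcard]; ring
  have hmod : m * t % 67 = 39 := by
    have h2 : m * t * Nm.index ≡ m * t * 1 [MOD 67] := Nat.ModEq.mul_left _ h1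
    rw [e1, mul_one] at h2
    have h3 : (2 ^ 5 * 3 * 5 * 7 ^ 2 * 13 * 29 ^ 3) % 67 = m * t % 67 := h2
    rw [← h3]; norm_num
  have hmt : m * t ∣ 2 ^ 5 * 3 * 5 * 7 ^ 2 * 13 * 29 ^ 3 := ⟨_, e1.symm⟩
  have hmd := (Dvd.intro t rfl).trans hmt
  obtain ⟨h4, h5⟩ := num67 hmd (by
    intro r r' hr hr' hrm hr'm
    have hne : ∀ r, r ∣ m → r ≠ 67 := by
      rintro r h rfl
      have := h.trans hmd
      revert this; decide +kernel
    have hd : ∀ r, r ∣ m → r ∣ Nat.card C := fun r h => by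
      rw [hm]; exact h.trans (Dvd.intro_left _ rfl)
    exact hu r r' hr hr' (hne r hrm) (hne r' hr'm)
      (cent_prime (by norm_num) hr (hne r hrm) g hg (hd r hrm))
      (cent_prime (by norm_num) hr' (hne r' hr'm) g hg (hd r' hr'm))) hker hmt hmod
  rw [h4] at hm
  refine ⟨by rw [hm], ?_⟩
  rw [← hidx, hm, h5]
end

section
theorem pow_gen {G : Type*} [Group G] {p : ℕ} (hp : p.Prime) {g : G} (hg : orderOf g = p) {n : ℕ}
    (h : g ^ n ≠ 1) : ∃ m : ℕ, (g ^ n) ^ m = g := by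
  apply exists_pow_eq_self_of_coprime
  rw [hg]
  rw [Nat.coprime_comm, Nat.Prime.coprime_iff_not_dvd hp]
  rwa [← hg, orderOf_dvd_iff_pow_eq_one]

theorem num13 {m : ℕ} (hm : m ∣ 2 ^ 5 * 3 * 5 * 7 ^ 2 * 29 ^ 3 * 67)
    (h67 : 67 ∣ m) (hu : ∀ r : ℕ, r.Prime → r ∣ m → r = 67) : m = 67 := by
  obtain ⟨t, rfl⟩ := h67
  have ht : t ∣ 2 ^ 5 * 3 * 5 * 7 ^ 2 * 29 ^ 3 := by
    apply Nat.dvd_of_mul_dvd_mul_left (by norm_num : 0 < 67)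
    refine hm.trans (by norm_num)
  by_cases h1 : t = 1
  · simp [h1]
  obtain ⟨r, hr, hrt⟩ := Nat.exists_prime_and_dvd h1
  have := hu r hr (hrt.trans (Dvd.intro_left _ rfl))
  subst this
  have := hrt.trans ht
  exact absurd this (by decide +kernel)

theorem step13 {G : Type*} [Group G] [Finite G]
    (hcard : Nat.card G = 2 ^ 5 * 3 * 5 * 7 ^ 2 * 13 * 29 ^ 3 * 67) (hu : UniqNbr G 13)
    (g y : G) (hg : orderOf g = 67) (hy : orderOf y = 13) (hc : Commute g y)
    (hC : Nat.card (Subgroup.centralizer {g}) = 871)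
    (hle : Subgroup.centralizer {g} ≤ Subgroup.centralizer {y}) :
    Subgroup.centralizer {y} = Subgroup.centralizer {g} := by
  have hx : ∃ x : G, orderOf x = 13 * 67 := by
    refine ⟨y * g, ?_⟩
    rw [hc.symm.orderOf_mul_eq_mul_orderOf_of_coprime, hg, hy]
    rw [hg, hy]; norm_num
  have h1 : 871 ∣ Nat.card (Subgroup.centralizer {y}) := hC ▸ Subgroup.card_dvd_of_le hle
  obtain ⟨m, hm⟩ : 13 ∣ Nat.card (Subgroup.centralizer {y}) := (by norm_num : 13 ∣ 871).trans h1
  have hd : Nat.card (Subgroup.centralizer {y}) ∣ Nat.card G := Subgroup.card_subgroup_dvd_card _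
  rw [hm, hcard] at hd
  have hmd : m ∣ 2 ^ 5 * 3 * 5 * 7 ^ 2 * 29 ^ 3 * 67 := by
    apply Nat.dvd_of_mul_dvd_mul_left (by norm_num : 0 < 13)
    exact hd.trans (by norm_num)
  have h67 : 67 ∣ m := by
    rw [hm] at h1
    apply Nat.dvd_of_mul_dvd_mul_left (by norm_num : 0 < 13)
    exact h1
  have := num13 hmd h67 (by
    intro r hr hrm
    have hne : r ≠ 13 := by
      rintro rfl
      have := hrm.trans hmd
      revert this; decide +kernel
    exact hu r 67 hr (by norm_num) hne (by norm_num)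
      (cent_prime (by norm_num) hr hne y hy (hm ▸ hrm.trans (Dvd.intro_left _ rfl))) hx)
  rw [this] at hm
  symm
  apply Subgroup.eq_of_le_of_card_ge hle
  rw [hm, hC]

/-- an element `y` of order `p` normalizing a group of prime order `r` with `p ∤ r - 1` centralizes it. -/
theorem prime_norm_cent {G : Type*} [Group G] [Finite G] {p r : ℕ} (hp : p.Prime) (hr : r.Prime)
    (hpr : ¬ p ∣ r - 1) (R : Subgroup G) (hR : Nat.card R = r)
    (hne : r ≠ p)
    (hn : p ∣ Nat.card (Subgroup.normalizer (R : Set G))) : ∃ x : G, orderOf x = p * r := by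
  have : Fact p.Prime := ⟨hp⟩
  have : Fact r.Prime := ⟨hr⟩
  obtain ⟨y, hy⟩ := exists_prime_orderOf_dvd_card' p hn
  have hcyc : IsCyclic R := isCyclic_of_prime_card hR
  have h1 : R.normalizerMonoidHom y = 1 := by
    have h2 : orderOf (R.normalizerMonoidHom y) ∣ p := hy ▸ orderOf_map_dvd _ y
    have h3 : orderOf (R.normalizerMonoidHom y) ∣ r - 1 := by
      have := orderOf_dvd_natCard (R.normalizerMonoidHom y)
      rwa [IsCyclic.card_mulAut, hR, Nat.totient_prime hr] at this
    rcases (Nat.dvd_prime hp).1 h2 with h | h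
    · exact orderOf_eq_one_iff.1 h
    · rw [h] at h3; exact absurd h3 hpr
  have h4 : y ∈ (R.normalizerMonoidHom).ker := h1
  rw [Subgroup.normalizerMonoidHom_ker, Subgroup.mem_subgroupOf] at h4
  have hy' : orderOf (y : G) = p := by rw [Subgroup.orderOf_coe]; exact hy
  apply cent_prime hp hr hne (y : G) hy'
  rw [← hR]
  apply Subgroup.card_dvd_of_le
  intro z hz
  rw [Subgroup.mem_centralizer_singleton_iff]
  exact Subgroup.mem_centralizer_iff.1 h4 z hz

theorem no_index3 {G : Type*} [Group G] [Finite G]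
    (hcard : Nat.card G = 2 ^ 5 * 3 * 5 * 7 ^ 2 * 13 * 29 ^ 3 * 67) (hu : UniqNbr G 67)
    (g : G) (hg : orderOf g = 67) (h13 : ∃ x : G, orderOf x = 67 * 13)
    (hC : Nat.card (Subgroup.centralizer {g}) = 871)
    (hN : Nat.card (Subgroup.normalizer (Subgroup.zpowers g : Set G)) = 2613)
    (K : Subgroup G) (hKn : K.Normal) (hle : Subgroup.centralizer {g} ≤ K) : K = ⊤ := by
  have f67 : Fact (Nat.Prime 67) := ⟨by norm_num⟩
  have f5 : Fact (Nat.Prime 5) := ⟨by norm_num⟩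
  have hP : Nat.card (Subgroup.zpowers g) = 67 := by rw [Nat.card_zpowers, hg]
  have hgC : g ∈ Subgroup.centralizer {g} := by
    rw [Subgroup.mem_centralizer_singleton_iff]
  have hgK : g ∈ K := hle hgC
  have hcent : Subgroup.centralizer ((Subgroup.zpowers g : Subgroup G) : Set G) = Subgroup.centralizer {g} := by
    rw [Subgroup.zpowers_eq_closure, Subgroup.centralizer_closure]
  have hCN : Subgroup.centralizer {g} ≤ Subgroup.normalizer (Subgroup.zpowers g : Set G) := by
    rw [← hcent]; exact Subgroup.centralizer_le_normalizer _
  have fac67 : ∀ n : ℕ, n ∣ 2 ^ 5 * 3 * 5 * 7 ^ 2 * 13 * 29 ^ 3 * 67 → 67 ∣ n → n.factorization 67 = 1 := by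
    intro n hn h
    have hn0 : n ≠ 0 := by rintro rfl; norm_num at hn
    obtain ⟨t, rfl⟩ := h
    have : ¬ 67 ∣ t := by
      intro h2
      have : 67 * 67 ∣ 2 ^ 5 * 3 * 5 * 7 ^ 2 * 13 * 29 ^ 3 * 67 := (mul_dvd_mul_left 67 h2).trans hn
      revert this; decide +kernel
    rw [Nat.factorization_mul (by norm_num) (by rintro rfl; simp at hn0), Finsupp.add_apply, Nat.Prime.factorization_self (by norm_num),
      Nat.factorization_eq_zero_of_not_dvd this]
  have hKd : Nat.card K ∣ 2 ^ 5 * 3 * 5 * 7 ^ 2 * 13 * 29 ^ 3 * 67 := hcard ▸ Subgroup.card_subgroup_dvd_card K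
  -- Sylow of G
  let P : Sylow 67 G := Sylow.ofCard (Subgroup.zpowers g) (by
    rw [hP, fac67 _ (hcard ▸ dvd_refl _) (hg ▸ orderOf_dvd_natCard g), pow_one])
  have hfr := Sylow.normalizer_sup_eq_top' P (N := K) (by
    show Subgroup.zpowers g ≤ K
    rwa [Subgroup.zpowers_le])
  change Subgroup.normalizer (Subgroup.zpowers g : Set G) ⊔ K = ⊤ at hfr
  set Nm := Subgroup.normalizer (Subgroup.zpowers g : Set G) with hNm
  have hidx : K.index = K.relIndex Nm := by
    rw [← Subgroup.relIndex_sup_left, sup_comm, hfr, Subgroup.relIndex_top_right]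
  have hrel : Nat.card (K ⊓ Nm : Subgroup G) * K.relIndex Nm = 2613 := by
    rw [← hN, ← Subgroup.card_mul_index (K.subgroupOf Nm)]
    congr 1
    rw [← Subgroup.inf_subgroupOf_right]
    exact (Nat.card_congr (Subgroup.subgroupOfEquivOfLe inf_le_right).toEquiv).symm
  have h871 : 871 ∣ Nat.card (K ⊓ Nm : Subgroup G) := hC ▸ Subgroup.card_dvd_of_le (le_inf hle hCN)
  obtain ⟨s, hs⟩ := h871
  rw [hs] at hrel
  have hst : s * K.relIndex Nm = 3 := by
    apply Nat.eq_of_mul_eq_mul_left (by norm_num : 0 < 871)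
    rw [← mul_assoc, hrel]
  by_cases hs1 : s = 1
  swap
  · have hr1 : K.relIndex Nm = 1 := by
      have : s ∣ 3 := ⟨_, hst.symm⟩
      rcases (Nat.dvd_prime (by norm_num)).1 this with h | h
      · exact absurd h hs1
      · rw [h] at hst; omega
    rw [← Subgroup.index_eq_one, hidx, hr1]
  exfalso
  subst hs1
  have hKN : (K ⊓ Nm : Subgroup G) = Subgroup.centralizer {g} := by
    symm
    apply Subgroup.eq_of_le_of_card_ge (le_inf hle hCN)
    rw [hs, hC]
  have hK3 : Nat.card K * 3 = Nat.card G := by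
    rw [← Subgroup.card_mul_index K, hidx]; rw [one_mul] at hst; rw [hst]
  -- inside K
  let gK : K := ⟨g, hgK⟩
  have hgK67 : orderOf gK = 67 := by rw [← hg, ← Subgroup.orderOf_coe]
  have hPK : Nat.card (Subgroup.zpowers gK) = 67 := by rw [Nat.card_zpowers, hgK67]
  let PK : Sylow 67 K := Sylow.ofCard (Subgroup.zpowers gK) (by
    rw [hPK, fac67 _ hKd (hgK67 ▸ orderOf_dvd_natCard gK), pow_one])
  have hNC : Subgroup.normalizer (PK : Set K) ≤ Subgroup.centralizer (PK : Set K) := by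
    intro x hx
    have hx2 : (x : G) ∈ Subgroup.normalizer (Subgroup.zpowers g : Set G) := by
      have hx' : x ∈ Subgroup.normalizer ((Subgroup.zpowers gK : Subgroup K) : Set K) := hx
      rw [Subgroup.mem_normalizer_iff] at hx' ⊢
      have hz : ∀ z : K, z ∈ Subgroup.zpowers gK ↔ (z : G) ∈ Subgroup.zpowers g := by
        intro z
        simp only [Subgroup.mem_zpowers_iff]
        constructor
        · rintro ⟨k, rfl⟩; exact ⟨k, by simp [gK]⟩
        · rintro ⟨k, hk⟩; exact ⟨k, Subtype.ext (by simpa [gK] using hk)⟩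
      intro z
      by_cases hzK : z ∈ K
      · have := hx' ⟨z, hzK⟩
        rw [hz, hz] at this
        simpa using this
      · constructor
        · intro h; exact absurd ((Subgroup.zpowers_le.2 hgK) h) hzK
        · intro h
          have h2 := (Subgroup.zpowers_le.2 hgK) h
          exfalso; apply hzK
          have := K.mul_mem (K.mul_mem (K.inv_mem x.2) h2) x.2
          simpa [mul_assoc] using this
    have hx3 : (x : G) ∈ Subgroup.centralizer {g} := by
      rw [← hKN]; exact ⟨x.2, hx2⟩
    have : x ∈ Subgroup.centralizer ((Subgroup.zpowers gK : Subgroup K) : Set K) := by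
      rw [Subgroup.zpowers_eq_closure, Subgroup.centralizer_closure, Subgroup.mem_centralizer_singleton_iff]
      exact Subtype.ext (Subgroup.mem_centralizer_singleton_iff.1 hx3)
    exact this
  have hcomp := MonoidHom.ker_transferSylow_isComplement' PK hNC
  set Q := (MonoidHom.transferSylow PK hNC).ker with hQ
  have hQn : Q.Normal := MonoidHom.normal_ker _
  have hQc : Nat.card Q * 67 = Nat.card K := by
    rw [← hPK]; exact hcomp.card_mul
  have hQ201 : Nat.card Q * 201 = 2 ^ 5 * 3 * 5 * 7 ^ 2 * 13 * 29 ^ 3 * 67 := by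
    rw [← hcard, ← hK3, ← hQc]; ring
  have hQv : Nat.card Q = 5 * (2 ^ 5 * 7 ^ 2 * 13 * 29 ^ 3) := by
    apply Nat.eq_of_mul_eq_mul_right (by norm_num : 0 < 201)
    rw [hQ201]; norm_num
  obtain ⟨R⟩ : Nonempty (Sylow 5 Q) := inferInstance
  have hRc : Nat.card R = 5 := by
    rw [R.card_eq_multiplicity, hQv, Nat.factorization_mul (by norm_num) (by norm_num), Finsupp.add_apply,
      Nat.Prime.factorization_self (by norm_num),
      Nat.factorization_eq_zero_of_not_dvd (by decide +kernel)]
    rfl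
  have hfr2 := Sylow.normalizer_sup_eq_top R
  set RK := (R : Subgroup Q).map Q.subtype with hRK
  have hRKc : Nat.card RK = 5 := by
    rw [hRK, Nat.card_congr (Subgroup.equivMapOfInjective _ _ Q.subtype_injective).toEquiv.symm, hRc]
  have h67 : 67 ∣ Nat.card (Subgroup.normalizer (RK : Set K)) := by
    have e1 : Q.index = Q.relIndex (Subgroup.normalizer (RK : Set K)) := by
      rw [← Subgroup.relIndex_sup_left, sup_comm, hfr2, Subgroup.relIndex_top_right]
    have e2 : Q.index = 67 := by
      have := Subgroup.card_mul_index Q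
      rw [← hQc] at this
      exact Nat.eq_of_mul_eq_mul_left Nat.card_pos this
    rw [← e2, e1]
    exact Subgroup.index_dvd_card _
  obtain ⟨x, hx⟩ := prime_norm_cent (by norm_num : Nat.Prime 67) (by norm_num : Nat.Prime 5) (by norm_num)
    RK hRKc (by norm_num) h67
  have := hu 5 13 (by norm_num) (by norm_num) (by norm_num) (by norm_num)
    ⟨x, by rw [Subgroup.orderOf_coe]; exact hx⟩ h13
  norm_num at this

theorem exists_setup {G : Type*} [Group G] [Finite G]
    (hcard : Nat.card G = 2 ^ 5 * 3 * 5 * 7 ^ 2 * 13 * 29 ^ 3 * 67) (hu : UniqNbr G 67)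
    (hu13 : UniqNbr G 13) : ∃ H N : Subgroup G, CohSetup H N := by
  classical
  have f67 : Fact (Nat.Prime 67) := ⟨by norm_num⟩
  have f13 : Fact (Nat.Prime 13) := ⟨by norm_num⟩
  obtain ⟨g, hg⟩ := exists_prime_orderOf_dvd_card' (G := G) 67 (by rw [hcard]; exact Dvd.intro_left _ rfl)
  obtain ⟨hC, hN⟩ := step67 hcard hu g hg
  obtain ⟨y0, hy0⟩ := exists_prime_orderOf_dvd_card' (G := Subgroup.centralizer {g}) 13 (by rw [hC]; norm_num)
  obtain ⟨y, hyC⟩ := y0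
  have hy : orderOf y = 13 := by rw [← hy0, ← Subgroup.orderOf_coe]
  have hgy : Commute g y := (Subgroup.mem_centralizer_singleton_iff.1 hyC).symm
  have hgC : g ∈ Subgroup.centralizer {g} := by
    rw [Subgroup.mem_centralizer_singleton_iff]
  have hw : orderOf (g * y) = 871 := by
    rw [hgy.orderOf_mul_eq_mul_orderOf_of_coprime, hg, hy]
    rw [hg, hy]; norm_num
  have hwz : Subgroup.zpowers (g * y) = Subgroup.centralizer {g} := by
    apply Subgroup.eq_of_le_of_card_ge
    · rw [Subgroup.zpowers_le]; exact Subgroup.mul_mem _ hgC hyC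
    · rw [hC, Nat.card_zpowers, hw]
  have hform : ∀ h ∈ Subgroup.centralizer {g}, ∃ j : ℕ, h = g ^ j * y ^ j := by
    intro h hh
    rw [← hwz, mem_zpowers_iff_mem_range_orderOf (x := g * y)] at hh
    obtain ⟨j, -, rfl⟩ := Finset.mem_image.1 hh
    exact ⟨j, hgy.mul_pow j⟩
  have hcomm : ∀ a ∈ Subgroup.centralizer {g}, ∀ b ∈ Subgroup.centralizer {g}, a * b = b * a := by
    intro a ha b hb
    rw [← hwz] at ha hb
    obtain ⟨i, rfl⟩ := Subgroup.mem_zpowers_iff.1 ha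
    obtain ⟨j, rfl⟩ := Subgroup.mem_zpowers_iff.1 hb
    rw [← zpow_add, ← zpow_add, add_comm]
  have hCy : Subgroup.centralizer {y} = Subgroup.centralizer {g} :=
    step13 hcard hu13 g y hg hy hgy hC (by
      intro x hx
      rw [Subgroup.mem_centralizer_singleton_iff]
      exact hcomm x hx y hyC)
  have hcent : ∀ h ∈ Subgroup.centralizer {g}, h ≠ 1 → ∀ x, x * h = h * x → x ∈ Subgroup.centralizer {g} := by
    intro h hh h1 x hx
    obtain ⟨j, rfl⟩ := hform h hh
    have hxc : Commute x (g ^ j * y ^ j) := hx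
    by_cases hj : g ^ (j * 13) = 1
    · have hj' : y ^ (j * 67) ≠ 1 := by
        intro hj'
        apply h1
        have d1 : 67 ∣ j * 13 := hg ▸ orderOf_dvd_of_pow_eq_one hj
        have d2 : 13 ∣ j * 67 := hy ▸ orderOf_dvd_of_pow_eq_one hj'
        have d3 : 67 ∣ j := (Nat.Coprime.dvd_of_dvd_mul_right (by norm_num) d1)
        have d4 : 13 ∣ j := (Nat.Coprime.dvd_of_dvd_mul_right (by norm_num) d2)
        rw [orderOf_dvd_iff_pow_eq_one.1 (hg ▸ d3), orderOf_dvd_iff_pow_eq_one.1 (hy ▸ d4), one_mul]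
      have e : (g ^ j * y ^ j) ^ 67 = y ^ (j * 67) := by
        rw [(hgy.pow_pow j j).mul_pow, ← pow_mul, ← pow_mul, mul_comm j 67, pow_mul, ← hg, pow_orderOf_eq_one,
          one_pow, one_mul]
      obtain ⟨m, hm⟩ := pow_gen (by norm_num) hy hj'
      rw [← hCy, Subgroup.mem_centralizer_singleton_iff, ← hm, ← e, ← pow_mul]
      exact hxc.pow_right _
    · have e : (g ^ j * y ^ j) ^ 13 = g ^ (j * 13) := by
        rw [(hgy.pow_pow j j).mul_pow, ← pow_mul, ← pow_mul, mul_comm j 13, pow_mul y, ← hy, pow_orderOf_eq_one,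
          one_pow, mul_one]
      obtain ⟨m, hm⟩ := pow_gen (by norm_num) hg hj
      rw [Subgroup.mem_centralizer_singleton_iff, ← hm, ← e, ← pow_mul]
      exact hxc.pow_right _
  have hCN : Subgroup.centralizer {g} ≤ Subgroup.normalizer (Subgroup.zpowers g : Set G) := by
    rw [← Subgroup.centralizer_closure, ← Subgroup.zpowers_eq_closure]
    exact Subgroup.centralizer_le_normalizer _
  refine ⟨Subgroup.centralizer {g}, Subgroup.normalizer (Subgroup.zpowers g : Set G), hcard, hC, hN, hCN,
    hcomm, hcent, ?_, ?_, ?_⟩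
  · intro x hx h hh
    have h1 := (Subgroup.mem_normalizer_iff.1 hx g).1 (Subgroup.mem_zpowers g)
    obtain ⟨k, hk⟩ := Subgroup.mem_zpowers_iff.1 h1
    have hc : Commute h (x * g * x⁻¹) := by
      rw [← hk]
      exact Commute.zpow_right (Subgroup.mem_centralizer_singleton_iff.1 hh) k
    rw [Subgroup.mem_centralizer_singleton_iff]
    have := hc.eq
    calc x⁻¹ * h * x * g = x⁻¹ * (h * (x * g * x⁻¹)) * x := by group
      _ = x⁻¹ * ((x * g * x⁻¹) * h) * x := by rw [this]
      _ = g * (x⁻¹ * h * x) := by group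
  · intro x h hh h1 hx
    -- x⁻¹ g x commutes with x⁻¹ h x
    have e1 : x⁻¹ * g * x ∈ Subgroup.centralizer {g} := by
      apply hcent _ hx
      · intro h2
        apply h1
        have : h = x * (x⁻¹ * h * x) * x⁻¹ := by group
        rw [this, h2]; group
      · have := Subgroup.mem_centralizer_singleton_iff.1 hh
        calc x⁻¹ * g * x * (x⁻¹ * h * x) = x⁻¹ * (g * h) * x := by group
          _ = x⁻¹ * (h * g) * x := by rw [this]
          _ = _ := by group
    obtain ⟨j, hj⟩ := hform _ e1
    have hord : orderOf (x⁻¹ * g * x) = 67 := by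
      have := orderOf_injective (MulAut.conj x⁻¹).toMonoidHom (MulAut.conj x⁻¹).injective g
      simpa [hg] using this
    have hj13 : y ^ j = 1 := by
      have h2 : (x⁻¹ * g * x) ^ 67 = 1 := hord ▸ pow_orderOf_eq_one _
      rw [hj, (hgy.pow_pow j j).mul_pow, ← pow_mul, ← pow_mul, mul_comm j 67, pow_mul g,
        orderOf_dvd_iff_pow_eq_one.1 (dvd_of_eq hg), one_pow, one_mul] at h2
      have d2 : 13 ∣ 67 * j := hy ▸ orderOf_dvd_of_pow_eq_one h2
      have d4 : 13 ∣ j := (Nat.Coprime.dvd_of_dvd_mul_left (by norm_num) d2)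
      exact orderOf_dvd_iff_pow_eq_one.1 (hy ▸ d4)
    rw [hj13, mul_one] at hj
    have hmap : (Subgroup.zpowers g).map (MulAut.conj x⁻¹ : G →* G) = Subgroup.zpowers g := by
      rw [MonoidHom.map_zpowers]
      have e : (MulAut.conj x⁻¹ : G →* G) g = g ^ j := by rw [← hj]; simp
      rw [e]
      apply Subgroup.eq_of_le_of_card_ge
      · rw [Subgroup.zpowers_le]; exact Subgroup.pow_mem _ (Subgroup.mem_zpowers g) j
      · rw [Nat.card_zpowers, Nat.card_zpowers, ← hj, hord, hg]
    have := Subgroup.mem_normalizer_iff_map_conj_eq.2 hmap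
    simpa using (Subgroup.normalizer _).inv_mem this
  · intro K hK hle
    exact no_index3 hcard hu g hg ⟨g * y, by rw [hw]⟩ hC hN K hK hle
end

section
def chkD (g c : ℕ) (n : ℕ) (t b : ℤ) : Bool :=
  let be : ℤ := (29 : ℤ) ^ n * b
  let ga : ℤ := (g : ℤ) * t
  let al : ℤ := 1 + be - ga
  !(al % 29 == 0) || !(decide (1 + al ^ 2 + be ^ 2 + 290 * ga ^ 2 ≤ (c : ℤ))) ||
    (al == 0 && be == 0 && (c == 841 || c == 24389)) ||
    (al == 29 && be == 0 && (c == 341446 || c == 682892)) || !((574288624 * al) % (c:ℤ) == 0)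

theorem chkD_all : ((List.range 6).all fun a => (List.range 2).all fun b => (List.range 2).all fun c =>
      (List.range 3).all fun d => (List.range 3).all fun n => (List.range 19).all fun t =>
      (List.range 3).all fun s =>
      chkD (2 ^ a * 3 ^ b * 5 ^ c * 7 ^ d) (2 ^ a * 3 ^ b * 5 ^ c * 7 ^ d * 29 ^ (n + 1)) (n + 1)
        ((t : ℤ) - 9) ((s : ℤ) - 1)) = true := by decide +kernel

theorem bndD {g Q t b al : ℤ} (hg : 1 ≤ g) (hq0 : 29 ≤ Q) (hq : Q ≤ 24389) (ht : t ≠ 0)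
    (h : 1 + al ^ 2 + (Q * b) ^ 2 + 290 * (g * t) ^ 2 ≤ g * Q) : (-9 ≤ t ∧ t ≤ 9) ∧ (-1 ≤ b ∧ b ≤ 1) := by
  have t2 : 1 ≤ t ^ 2 := by
    have := sq_nonneg t
    have h0 : t ^ 2 ≠ 0 := pow_ne_zero 2 ht
    omega
  have s1 := sq_nonneg al
  have s2 := sq_nonneg (Q * b)
  have s3 := sq_nonneg (g * t)
  have hgt : g * t ^ 2 ≤ 84 := by
    have h1 : g * (290 * (g * t ^ 2)) ≤ g * Q := by
      have : g * (290 * (g * t ^ 2)) = 290 * (g * t) ^ 2 := by ring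
      linarith
    have := le_of_mul_le_mul_left h1 (by omega)
    omega
  have hg84 : g ≤ 84 := by nlinarith
  have htt : t ^ 2 ≤ 84 := by nlinarith
  refine ⟨by constructor <;> nlinarith, ?_⟩
  have h1 : Q * (Q * b ^ 2) ≤ Q * 84 := by
    have : Q * (Q * b ^ 2) = (Q * b) ^ 2 := by ring
    nlinarith
  have := le_of_mul_le_mul_left h1 (by omega)
  have hbb : b ^ 2 ≤ 2 := by nlinarith [sq_nonneg b]
  constructor <;> nlinarith

theorem numD {c m : ℕ} {al be : ℤ} (hcm : c * m = 2 ^ 5 * 3 * 5 * 7 ^ 2 * 13 * 29 ^ 3 * 67)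
    (h13 : ¬ 13 ∣ c) (h67 : ¬ 67 ∣ c) (h29 : 29 ∣ c) (hal : (29 : ℤ) ∣ al)
    (hb : 1 + al ^ 2 + be ^ 2 + 290 * (1 - al + be) ^ 2 ≤ (c : ℤ))
    (d1 : (870 : ℤ) ∣ m * al) (d2 : (24389 : ℤ) ∣ m * be) (d3 : (23520 : ℤ) ∣ m * (1 - al + be)) :
    (al = 0 ∧ be = 0 ∧ (c = 841 ∨ c = 24389)) ∨ (al = 29 ∧ be = 0 ∧ (c = 341446 ∨ c = 682892)) := by
  have hc : c ∣ 2 ^ 5 * 3 * 5 * 7 ^ 2 * 13 * 29 ^ 3 :=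
    Nat.Coprime.dvd_of_dvd_mul_right ((Nat.Prime.coprime_iff_not_dvd (by norm_num)).2 h67).symm ⟨m, hcm.symm⟩
  obtain ⟨i, hi, j, hj, k, hk, l, hl, e, he, f, hf, hform⟩ := dvd_form hc
  have he0 : e = 0 := by
    by_contra h
    apply h13
    rw [hform]
    exact ((dvd_pow_self 13 h).mul_left _).mul_right _
  subst he0
  have hf0 : f ≠ 0 := by
    rintro rfl
    rw [hform] at h29
    have h5 : ∀ p a : ℕ, p.Prime → p ≠ 29 → ¬ 29 ∣ p ^ a := by
      intro p a hp hne h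
      have := (Nat.prime_dvd_prime_iff_eq (by norm_num) hp).1 (Nat.Prime.dvd_of_dvd_pow (by norm_num : Nat.Prime 29) h)
      omega
    have p29 : Nat.Prime 29 := by norm_num
    simp only [pow_zero, mul_one, p29.dvd_mul] at h29
    rcases h29 with ((h | h) | h) | h
    · exact h5 2 _ (by norm_num) (by norm_num) h
    · exact h5 3 _ (by norm_num) (by norm_num) h
    · exact h5 5 _ (by norm_num) (by norm_num) h
    · exact h5 7 _ (by norm_num) (by norm_num) h
  obtain ⟨n, rfl⟩ := Nat.exists_eq_succ_of_ne_zero hf0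
  rw [pow_zero, mul_one] at hform
  set g := 2 ^ i * 3 ^ j * 5 ^ k * 7 ^ l with hg
  have hg0 : 0 < g := by positivity
  have hcm' : (c : ℤ) * m = 2 ^ 5 * 3 * 5 * 7 ^ 2 * 13 * 29 ^ 3 * 67 := by exact_mod_cast hcm
  have ea : (c : ℤ) ∣ 574288624 * al := by
    obtain ⟨K, hK⟩ := d1
    refine ⟨K, ?_⟩
    have : 870 * (574288624 * al) = 870 * (c * K) := by linear_combination (-al) * hcm' + c * hK
    omega
  have eb : (c : ℤ) ∣ 20485920 * be := by
    obtain ⟨K, hK⟩ := d2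
    refine ⟨K, ?_⟩
    have : 24389 * (20485920 * be) = 24389 * (c * K) := by linear_combination (-be) * hcm' + c * hK
    omega
  have eg : (c : ℤ) ∣ 21242819 * (1 - al + be) := by
    obtain ⟨K, hK⟩ := d3
    refine ⟨K, ?_⟩
    have : 23520 * (21242819 * (1 - al + be)) = 23520 * (c * K) := by
      linear_combination (-(1 - al + be)) * hcm' + c * hK
    omega
  have cg : Nat.Coprime g 21242819 := by
    rw [hg]
    refine Nat.Coprime.mul_left (Nat.Coprime.mul_left (Nat.Coprime.mul_left ?_ ?_) ?_) ?_ <;>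
      exact Nat.Coprime.pow_left _ (by norm_num)
  have c29 : Nat.Coprime (29 ^ (n + 1)) 20485920 := Nat.Coprime.pow_left _ (by norm_num)
  obtain ⟨t, ht⟩ : (g : ℤ) ∣ 1 - al + be := by
    have h1 : (g : ℤ) ∣ 21242819 * (1 - al + be) := by
      refine dvd_trans ?_ eg
      rw [hform]; push_cast; exact Dvd.intro _ rfl
    exact IsCoprime.dvd_of_dvd_mul_left (by exact_mod_cast Nat.isCoprime_iff_coprime.2 cg) h1
  obtain ⟨b, hb'⟩ : (29 : ℤ) ^ (n + 1) ∣ be := by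
    have h1 : (29 : ℤ) ^ (n + 1) ∣ 20485920 * be := by
      refine dvd_trans ?_ eb
      rw [hform]; push_cast; exact Dvd.intro_left _ rfl
    exact IsCoprime.dvd_of_dvd_mul_left (by exact_mod_cast Nat.isCoprime_iff_coprime.2 c29) h1
  have hal' : al = 1 + (29 : ℤ) ^ (n + 1) * b - g * t := by rw [← hb', ← ht]; ring
  have ht0 : t ≠ 0 := by
    rintro rfl
    rw [hal'] at hal
    obtain ⟨w, hw⟩ := hal
    rw [pow_succ] at hw
    have : (29 : ℤ) * (w - 29 ^ n * b) = 1 := by linear_combination -hw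
    omega
  have hn : n < 3 := by omega
  have hq : (29 : ℤ) ^ (n + 1) ≤ 24389 := by
    interval_cases n <;> norm_num
  have hq0 : (29 : ℤ) ≤ 29 ^ (n + 1) := by
    interval_cases n <;> norm_num
  have hcz : (c : ℤ) = g * 29 ^ (n + 1) := by rw [hform]; push_cast; rfl
  have hgz : (1 : ℤ) ≤ g := by exact_mod_cast hg0
  obtain ⟨ht9, hb1⟩ := bndD (g := g) (Q := 29 ^ (n + 1)) (t := t) (b := b) (al := al) hgz hq0 hq ht0 (by
    rw [← hb', ← ht, ← hcz]; exact hb)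
  have key := chkD_all
  simp only [List.all_eq_true, List.mem_range] at key
  have := key i hi j hj k hk l hl n hn (t + 9).toNat (by omega) (b + 1).toNat (by omega)
  rw [← hg, ← hform, Int.toNat_of_nonneg (by omega), Int.toNat_of_nonneg (by omega),
    add_sub_cancel_right, add_sub_cancel_right] at this
  unfold chkD at this
  simp only [] at this
  rw [← hal', ← hb', ← ht, Int.emod_eq_zero_of_dvd hal, Int.emod_eq_zero_of_dvd ea, decide_eq_true hb] at this
  simpa [and_assoc] using this
end

section
section
variable {G : Type*} [Group G] [Finite G] {H N : Subgroup G} {α β : G → ℤ}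

theorem conj_into (S : CohSetup H N) {p : ℕ} (hp : p.Prime) (hpH : p ∣ 871)
    (hpG : (Nat.card G).factorization p = 1) (w : G) (hw : orderOf w = p) :
    ∃ y : G, y⁻¹ * w * y ∈ H := by
  have : Fact p.Prime := ⟨hp⟩
  obtain ⟨h, hh⟩ := exists_prime_orderOf_dvd_card' (G := H) p (by rw [S.cardH]; exact hpH)
  have hh' : orderOf (h : G) = p := by rw [Subgroup.orderOf_coe]; exact hh
  let P : Sylow p G := Sylow.ofCard (Subgroup.zpowers w) (by rw [Nat.card_zpowers, hw, hpG, pow_one])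
  let Q : Sylow p G := Sylow.ofCard (Subgroup.zpowers (h : G)) (by rw [Nat.card_zpowers, hh', hpG, pow_one])
  obtain ⟨g, hg⟩ := MulAction.exists_smul_eq G P Q
  refine ⟨g⁻¹, ?_⟩
  have hwP : w ∈ P := by
    show w ∈ Subgroup.zpowers w
    exact Subgroup.mem_zpowers w
  have : MulAut.conj g • w ∈ (g • P : Sylow p G) := by
    exact Subgroup.smul_mem_pointwise_smul w (MulAut.conj g) (P : Subgroup G) hwP
  rw [hg] at this
  have h2 : Subgroup.zpowers (h : G) ≤ H := by rw [Subgroup.zpowers_le]; exact h.2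
  have := h2 this
  simpa using this

theorem type29 (S : CohSetup H N) (I : CharIface H α β) {x : G} (h1 : x ≠ 1) {k : ℕ}
    (hx : x ^ (29 ^ k) = 1) :
    (α x = 0 ∧ Nat.card (Subgroup.centralizer {x}) = 841) ∨
    (α x = 29 ∧ (Nat.card (Subgroup.centralizer {x}) = 341446 ∨ Nat.card (Subgroup.centralizer {x}) = 682892)) := by
  have hnc : ∀ y, y⁻¹ * x * y ∉ H := by
    intro y hy
    have e1 : (y⁻¹ * x * y) ^ 871 = 1 := by
      rw [← S.cardH]
      have := pow_card_eq_one' (x := (⟨_, hy⟩ : H))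
      exact congrArg Subtype.val this
    have e2 : (y⁻¹ * x * y) ^ (29 ^ k) = 1 := by
      have := conj_pow (i := 29 ^ k) (a := y⁻¹) (b := x)
      rw [inv_inv] at this
      rw [this, hx]; simp
    have e3 : orderOf (y⁻¹ * x * y) ∣ Nat.gcd 871 (29 ^ k) :=
      Nat.dvd_gcd (orderOf_dvd_of_pow_eq_one e1) (orderOf_dvd_of_pow_eq_one e2)
    rw [Nat.Coprime.gcd_eq_one (Nat.Coprime.pow_right _ (by norm_num)), Nat.dvd_one, orderOf_eq_one_iff] at e3
    apply h1
    have : x = y * (y⁻¹ * x * y) * y⁻¹ := by group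
    rw [this, e3]; group
  set C := Subgroup.centralizer {x} with hC
  have hcop : ∀ p : ℕ, p.Prime → p ∣ 871 → (Nat.card G).factorization p = 1 → ¬ p ∣ Nat.card C := by
    intro p hp h871 hf hd
    have : Fact p.Prime := ⟨hp⟩
    obtain ⟨w, hw⟩ := exists_prime_orderOf_dvd_card' p hd
    have hw' : orderOf (w : G) = p := by rw [Subgroup.orderOf_coe]; exact hw
    obtain ⟨y, hy⟩ := conj_into S hp h871 hf w hw'
    apply hnc y
    apply S.cent _ hy
    · intro h
      have : (w : G) = y * (y⁻¹ * w * y) * y⁻¹ := by group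
      rw [h] at this
      have h3 : (w : G) = 1 := by rw [this]; group
      rw [h3, orderOf_one] at hw'
      exact hp.one_lt.ne hw'
    · have := Subgroup.mem_centralizer_singleton_iff.1 w.2
      calc y⁻¹ * x * y * (y⁻¹ * w * y) = y⁻¹ * (x * w) * y := by group
        _ = y⁻¹ * (w * x) * y := by rw [this]
        _ = _ := by group
  have fac : ∀ p n : ℕ, p.Prime → Nat.card G = p * n → ¬ p ∣ n → (Nat.card G).factorization p = 1 := by
    intro p n hp h hn
    rw [h, Nat.factorization_mul hp.ne_zero (by rintro rfl; simp at hn), Finsupp.add_apply,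
      hp.factorization_self, Nat.factorization_eq_zero_of_not_dvd hn]
  have f13 := fac 13 (2 ^ 5 * 3 * 5 * 7 ^ 2 * 29 ^ 3 * 67) (by norm_num) (by rw [S.cardG]; norm_num) (by decide +kernel)
  have f67 := fac 67 (2 ^ 5 * 3 * 5 * 7 ^ 2 * 29 ^ 3 * 13) (by norm_num) (by rw [S.cardG]; norm_num) (by decide +kernel)
  have h29 : 29 ∣ Nat.card C := by
    have hxC : x ∈ C := by rw [hC, Subgroup.mem_centralizer_singleton_iff]
    have d := Subgroup.orderOf_dvd_natCard C hxC
    obtain ⟨j, -, hj⟩ := (Nat.dvd_prime_pow (by norm_num)).1 (orderOf_dvd_of_pow_eq_one hx)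
    rw [hj] at d
    refine (dvd_pow_self 29 ?_).trans d
    rintro rfl
    rw [pow_zero, orderOf_eq_one_iff] at hj
    exact h1 hj
  obtain ⟨m, hm⟩ := Subgroup.card_subgroup_dvd_card C
  obtain ⟨d1, d2, d3⟩ := I.dvd x hnc m hm.symm
  rcases numD (hm.symm.trans S.cardG) (hcop 13 (by norm_num) (by norm_num) f13)
    (hcop 67 (by norm_num) (by norm_num) f67) h29 (I.frob x k hx) (I.bound x hnc) d1 d2 d3 with
    ⟨a, b, c | c⟩ | ⟨a, b, c⟩
  · exact Or.inl ⟨a, c⟩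
  · exfalso
    obtain ⟨n, hn⟩ := I.conv x hnc a b m hm.symm
    have hm' : m = 20485920 := by
      rw [S.cardG, c] at hm
      omega
    rw [S.cardG, hm'] at hn
    omega
  · exact Or.inr ⟨a, c⟩
end
end

section
def TT {G : Type*} [Group G] (α : G → ℤ) : Set G := {x | x ≠ 1 ∧ (∃ k : ℕ, x ^ (29 ^ k) = 1) ∧ α x = 29}

instance fact29 : Fact (Nat.Prime 29) := ⟨by norm_num⟩

section
variable {G : Type*} [Group G] [Finite G] {H N : Subgroup G} {α β : G → ℤ}

theorem card_syl29 (hG : Nat.card G = 2 ^ 5 * 3 * 5 * 7 ^ 2 * 13 * 29 ^ 3 * 67) (P : Sylow 29 G) :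
    Nat.card P = 24389 := by
  rw [P.card_eq_multiplicity, hG, show 2 ^ 5 * 3 * 5 * 7 ^ 2 * 13 * 29 ^ 3 * 67 = 29 ^ 3 * 20485920 by norm_num,
    Nat.factorization_mul (by norm_num) (by norm_num), Nat.factorization_pow, Finsupp.add_apply,
    Finsupp.smul_apply, Nat.Prime.factorization_self (by norm_num),
    Nat.factorization_eq_zero_of_not_dvd (by norm_num)]
  norm_num

theorem pow_of_card {A : Subgroup G} {k : ℕ} (hA : Nat.card A = 29 ^ k) {x : G} (hx : x ∈ A) :
    x ^ (29 ^ k) = 1 := by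
  rw [← hA]
  exact congrArg Subtype.val (pow_card_eq_one' (x := (⟨x, hx⟩ : A)))

theorem countT (S : CohSetup H N) (I : CharIface H α β) (A : Subgroup G) (k : ℕ) (hA : Nat.card A = 29 ^ k) :
    ∃ n : ℕ, 870 + 29 * ((A : Set G) ∩ TT α).ncard = 29 ^ k * n := by
  classical
  have : Fintype A := Fintype.ofFinite A
  obtain ⟨n, hn⟩ := I.sub A inferInstance
  refine ⟨n, ?_⟩
  have h1 : ∀ a : A, α a = (if a = 1 then 870 else 0) + (if (a : G) ∈ TT α then 29 else 0) := by
    intro a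
    by_cases h : a = 1
    · subst h
      have : (1 : G) ∉ TT α := fun h => h.1 rfl
      simp [this, I.one]
    · have h' : (a : G) ≠ 1 := by simpa using h
      by_cases ht : (a : G) ∈ TT α
      · simp [h, ht, ht.2.2]
      · rcases type29 S I h' (pow_of_card hA a.2) with ⟨h2, -⟩ | ⟨h2, -⟩
        · simp [h, ht, h2]
        · exact absurd ⟨h', ⟨k, pow_of_card hA a.2⟩, h2⟩ ht
  rw [Finset.sum_congr rfl (fun a _ => h1 a), Finset.sum_add_distrib, Finset.sum_ite_eq' Finset.univ (1 : A),
    ← Finset.sum_filter, Finset.sum_const, hA] at hn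
  have h2 : ((A : Set G) ∩ TT α).ncard = (Finset.univ.filter (fun a : A => (a : G) ∈ TT α)).card := by
    have : ((A : Set G) ∩ TT α) = ((Finset.univ.filter (fun a : A => (a : G) ∈ TT α)).map
        ⟨Subtype.val, Subtype.val_injective⟩ : Finset G) := by
      ext x; simp [and_comm]
    rw [this, Set.ncard_coe_finset, Finset.card_map]
  rw [h2]
  simp only [Finset.mem_univ, if_true, nsmul_eq_mul] at hn
  push_cast at hn
  zify
  linarith

theorem mem_TT_of (S : CohSetup H N) (I : CharIface H α β) {x : G} (h1 : x ≠ 1) {k : ℕ}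
    (hx : x ^ (29 ^ k) = 1) (hc : 24389 ∣ Nat.card (Subgroup.centralizer {x})) : x ∈ TT α := by
  rcases type29 S I h1 hx with ⟨-, h⟩ | ⟨h, -⟩
  · rw [h] at hc; norm_num at hc
  · exact ⟨h1, ⟨k, hx⟩, h⟩

theorem TT_card (S : CohSetup H N) (I : CharIface H α β) {x : G} (h : x ∈ TT α) :
    Nat.card (Subgroup.centralizer {x}) = 341446 ∨ Nat.card (Subgroup.centralizer {x}) = 682892 := by
  obtain ⟨h1, ⟨k, hk⟩, h2⟩ := h
  rcases type29 S I h1 hk with ⟨h3, -⟩ | ⟨-, h3⟩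
  · omega
  · exact h3

theorem TT_zero (S : CohSetup H N) (I : CharIface H α β) {x : G} (h1 : x ≠ 1) {k : ℕ}
    (hx : x ^ (29 ^ k) = 1) (h : x ∉ TT α) : Nat.card (Subgroup.centralizer {x}) = 841 := by
  rcases type29 S I h1 hx with ⟨-, h3⟩ | ⟨h3, -⟩
  · exact h3
  · exact absurd ⟨h1, ⟨k, hx⟩, h3⟩ h

/-- the Sylow subgroup of the centralizer of a `T`-element -/
theorem TT_syl (S : CohSetup H N) (I : CharIface H α β) {z : G} (hz : z ∈ TT α) :
    ∃ P : Sylow 29 G, ∀ x : G, x ∈ P ↔ (x * z = z * x ∧ ∃ k : ℕ, x ^ (29 ^ k) = 1) := by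
  set C := Subgroup.centralizer {z} with hC
  obtain ⟨Q⟩ : Nonempty (Sylow 29 C) := inferInstance
  have hu : ∃ u : ℕ, Nat.card C = 29 ^ 3 * u ∧ (u = 14 ∨ u = 28) := by
    rcases TT_card S I hz with h | h
    · exact ⟨14, h, Or.inl rfl⟩
    · exact ⟨28, h, Or.inr rfl⟩
  obtain ⟨u, hu, hu'⟩ := hu
  have hQ : Nat.card Q = 24389 := by
    rw [Q.card_eq_multiplicity, hu, 
      Nat.factorization_mul (by norm_num) (by omega), Nat.factorization_pow, Finsupp.add_apply,
      Finsupp.smul_apply, Nat.Prime.factorization_self (by norm_num),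
      Nat.factorization_eq_zero_of_not_dvd (by omega)]
    norm_num
  have hidx : (Q : Subgroup C).index = u := by
    have := Subgroup.card_mul_index (Q : Subgroup C)
    rw [hu] at this
    change Nat.card Q * _ = _ at this
    rw [hQ] at this
    omega
  have hn : Nat.card (Sylow 29 C) = 1 := by
    have h1 := card_sylow_modEq_one 29 C
    have h2 := Q.card_dvd_index
    rw [hidx] at h2
    have h3 := Nat.le_of_dvd (by omega) h2
    unfold Nat.ModEq at h1
    omega
  have hsub : Subsingleton (Sylow 29 C) := (Nat.card_eq_one_iff_unique.1 hn).1
  let P : Sylow 29 G := Sylow.ofCard ((Q : Subgroup C).map C.subtype) (by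
    rw [Nat.card_congr (Subgroup.equivMapOfInjective _ _ C.subtype_injective).toEquiv.symm]
    obtain ⟨R⟩ : Nonempty (Sylow 29 G) := inferInstance
    rw [← R.card_eq_multiplicity, card_syl29 S.cardG R]
    exact hQ)
  have hP : (P : Subgroup G) = (Q : Subgroup C).map C.subtype := rfl
  refine ⟨P, fun x => ⟨fun hx => ?_, fun hx => ?_⟩⟩
  · refine ⟨?_, 3, pow_of_card (A := P) (k := 3) (card_syl29 S.cardG P) hx⟩
    change x ∈ (P : Subgroup G) at hx
    rw [hP] at hx
    obtain ⟨y, -, rfl⟩ := hx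
    exact Subgroup.mem_centralizer_singleton_iff.1 y.2
  · obtain ⟨hx, k, hk⟩ := hx
    have hxC : x ∈ C := Subgroup.mem_centralizer_singleton_iff.2 hx
    let y : C := ⟨x, hxC⟩
    have hy : IsPGroup 29 (Subgroup.zpowers y) := by
      obtain ⟨j, -, hj⟩ := (Nat.dvd_prime_pow (by norm_num)).1 (orderOf_dvd_of_pow_eq_one
        (show y ^ (29 ^ k) = 1 from Subtype.ext hk))
      exact IsPGroup.of_card (n := j) (by rw [Nat.card_zpowers, hj])
    obtain ⟨R, hR⟩ := hy.exists_le_sylow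
    rw [Subsingleton.elim R Q] at hR
    show x ∈ (P : Subgroup G)
    rw [hP]
    exact ⟨y, hR (Subgroup.mem_zpowers y), rfl⟩

theorem syl_nonab (S : CohSetup H N) (I : CharIface H α β) (P : Sylow 29 G) :
    ¬ ∀ x ∈ P, ∀ y ∈ P, x * y = y * x := by
  intro hab
  have hP := card_syl29 S.cardG P
  obtain ⟨n, hn⟩ := countT S I P 3 hP
  have h1 : ((P : Set G) ∩ TT α) = (P : Set G) \ {1} := by
    ext x
    constructor
    · rintro ⟨h, h'⟩; exact ⟨h, h'.1⟩
    · rintro ⟨h, h'⟩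
      refine ⟨h, mem_TT_of S I (k := 3) h' (pow_of_card (A := P) hP h) ?_⟩
      rw [← hP]
      apply Subgroup.card_dvd_of_le
      intro y hy
      exact Subgroup.mem_centralizer_singleton_iff.2 (hab y hy x h)
  have h2 : ((P : Set G) \ {1}).ncard = 24388 := by
    rw [Set.ncard_sdiff_singleton_of_mem (by exact P.one_mem)]
    change Nat.card P - 1 = _
    rw [hP]
  change 870 + 29 * ((P : Set G) ∩ TT α).ncard = _ at hn
  rw [h1, h2] at hn
  omega
end
end

section
section
variable {G : Type*} [Group G] [Finite G] {H N : Subgroup G} {α β : G → ℤ}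

def ZZ (P : Subgroup G) : Subgroup G := P ⊓ Subgroup.centralizer (P : Set G)

theorem mem_ZZ {P : Subgroup G} {x : G} : x ∈ ZZ P ↔ x ∈ P ∧ ∀ y ∈ P, y * x = x * y := by
  unfold ZZ
  rw [Subgroup.mem_inf, Subgroup.mem_centralizer_iff]
  rfl

theorem ZZ_eq (P : Subgroup G) : ZZ P = (Subgroup.center P).map P.subtype := by
  ext x
  rw [mem_ZZ]
  constructor
  · rintro ⟨h, h'⟩
    exact ⟨⟨x, h⟩, Subgroup.mem_center_iff.2 fun y => Subtype.ext (h' y y.2), rfl⟩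
  · rintro ⟨y, hy, rfl⟩
    exact ⟨y.2, fun w hw => congrArg Subtype.val (Subgroup.mem_center_iff.1 hy ⟨w, hw⟩)⟩

theorem center_card {Q : Type*} [Group Q] [Finite Q] (hQ : Nat.card Q = 29 ^ 3)
    (hn : ¬ ∀ x y : Q, x * y = y * x) : Nat.card (Subgroup.center Q) = 29 ∧
    ∀ x y : Q, x * y * x⁻¹ * y⁻¹ ∈ Subgroup.center Q := by
  obtain ⟨k, hk, hk'⟩ := IsPGroup.card_center_eq_prime_pow hQ (by norm_num)
  have hidx := Subgroup.card_mul_index (Subgroup.center Q)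
  rw [hQ, hk'] at hidx
  have hk3 : k ≤ 3 := by
    have : 29 ^ k ∣ 29 ^ 3 := ⟨_, hidx.symm⟩
    exact (Nat.pow_dvd_pow_iff_le_right (by norm_num)).1 this
  have hqc : Nat.card (Q ⧸ Subgroup.center Q) = (Subgroup.center Q).index := rfl
  have h3 : k ≠ 3 := by
    rintro rfl
    apply hn
    have : Subgroup.center Q = ⊤ := Subgroup.eq_top_of_card_eq _ (by rw [hk', hQ])
    intro x y
    have hy : y ∈ Subgroup.center Q := by rw [this]; trivial
    exact Subgroup.mem_center_iff.1 hy x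
  have h2 : k ≠ 2 := by
    rintro rfl
    apply hn
    have hi : (Subgroup.center Q).index = 29 := by omega
    have : IsCyclic (Q ⧸ Subgroup.center Q) := isCyclic_of_prime_card (p := 29) (by rw [hqc, hi])
    have := (QuotientGroup.mk' (Subgroup.center Q)).isMulCommutative_of_isCyclic_of_ker_le_center (by simp)
    exact fun x y => mul_comm' x y
  have h1 : k = 1 := by omega
  subst h1
  refine ⟨by simpa using hk', ?_⟩
  intro x y
  have hi : (Subgroup.center Q).index = 29 ^ 2 := by omega
  have hc := IsPGroup.isMulCommutative_of_card_eq_prime_sq (p := 29) (G := Q ⧸ Subgroup.center Q) (by rw [hqc, hi])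
  have := mul_comm' (x : Q ⧸ Subgroup.center Q) y
  rw [← QuotientGroup.eq_one_iff]
  change (x : Q ⧸ Subgroup.center Q) * y * (x : Q ⧸ Subgroup.center Q)⁻¹ * (y : Q ⧸ Subgroup.center Q)⁻¹ = 1
  rw [this]; group

theorem ZZ_card (S : CohSetup H N) (I : CharIface H α β) (P : Sylow 29 G) :
    Nat.card (ZZ (P : Subgroup G)) = 29 ∧ ∀ x ∈ P, ∀ y ∈ P, x * y * x⁻¹ * y⁻¹ ∈ ZZ (P : Subgroup G) := by
  have hab := syl_nonab S I P
  obtain ⟨h1, h2⟩ := center_card (Q := P) (card_syl29 S.cardG P) (by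
    intro h; apply hab
    intro x hx y hy
    exact congrArg Subtype.val (h ⟨x, hx⟩ ⟨y, hy⟩))
  rw [ZZ_eq]
  constructor
  · rw [Nat.card_congr (Subgroup.equivMapOfInjective _ _ (P : Subgroup G).subtype_injective).toEquiv.symm]
    exact h1
  · intro x hx y hy
    exact ⟨_, h2 ⟨x, hx⟩ ⟨y, hy⟩, rfl⟩

theorem TT_pow (S : CohSetup H N) (I : CharIface H α β) {z : G} (hz : z ∈ TT α) : z ^ 29 = 1 := by
  obtain ⟨P, hP⟩ := TT_syl S I hz
  have hzz : z ∈ ZZ (P : Subgroup G) := by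
    rw [mem_ZZ]
    exact ⟨(hP z).2 ⟨rfl, hz.2.1⟩, fun y hy => ((hP y).1 hy).1⟩
  have := pow_of_card (k := 1) (by rw [(ZZ_card S I P).1, pow_one]) hzz
  simpa using this

theorem TT_order (S : CohSetup H N) (I : CharIface H α β) {z : G} (hz : z ∈ TT α) : orderOf z = 29 :=
  orderOf_eq_prime (TT_pow S I hz) hz.1

theorem TT_gen (S : CohSetup H N) (I : CharIface H α β) {z : G} (hz : z ∈ TT α) {n : ℕ}
    (hn : z ^ n ≠ 1) : z ^ n ∈ TT α := by
  have ho := TT_order S I hz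
  obtain ⟨m, hm⟩ := pow_gen (by norm_num) ho hn
  apply mem_TT_of S I (k := 1) hn
  · rw [pow_one, ← pow_mul, mul_comm, pow_mul, TT_pow S I hz, one_pow]
  · have h1 : Subgroup.centralizer {z} ≤ Subgroup.centralizer {z ^ n} := by
      intro x hx
      rw [Subgroup.mem_centralizer_singleton_iff] at hx ⊢
      exact (Commute.pow_right hx n)
    refine dvd_trans ?_ (Subgroup.card_dvd_of_le h1)
    rcases TT_card S I hz with h | h <;> rw [h] <;> norm_num

theorem ZZ_TT (S : CohSetup H N) (I : CharIface H α β) (P : Sylow 29 G) {x : G} (hx : x ∈ ZZ (P : Subgroup G))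
    (h1 : x ≠ 1) : x ∈ TT α := by
  apply mem_TT_of S I (k := 3) h1
  · exact pow_of_card (A := P) (card_syl29 S.cardG P) (mem_ZZ.1 hx).1
  · rw [← card_syl29 S.cardG P]
    apply Subgroup.card_dvd_of_le
    intro y hy
    exact Subgroup.mem_centralizer_singleton_iff.2 ((mem_ZZ.1 hx).2 y hy)

theorem TT_28 (S : CohSetup H N) (I : CharIface H α β) (A : Subgroup G) :
    28 ∣ ((A : Set G) ∩ TT α).ncard := by
  classical
  have : Fintype G := Fintype.ofFinite G
  set F := ((A : Set G) ∩ TT α).toFinset with hF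
  rw [Set.ncard_eq_toFinset_card', ← hF]
  rw [Finset.card_eq_sum_card_image (fun x => Subgroup.zpowers x) F]
  apply Finset.dvd_sum
  intro K hK
  obtain ⟨x, hx, rfl⟩ := Finset.mem_image.1 hK
  rw [hF, Set.mem_toFinset] at hx
  have e : F.filter (fun y => Subgroup.zpowers y = Subgroup.zpowers x) =
      ((Subgroup.zpowers x : Set G) \ {1}).toFinset := by
    ext y
    rw [Finset.mem_filter, hF, Set.mem_toFinset, Set.mem_toFinset]
    constructor
    · rintro ⟨h, h'⟩
      refine ⟨?_, h.2.1⟩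
      rw [← h']; exact Subgroup.mem_zpowers y
    · rintro ⟨h, h'⟩
      rw [SetLike.mem_coe, mem_zpowers_iff_mem_range_orderOf] at h
      obtain ⟨n, -, rfl⟩ := Finset.mem_image.1 h
      refine ⟨⟨A.pow_mem hx.1 n, TT_gen S I hx.2 h'⟩, ?_⟩
      obtain ⟨m, hm⟩ := pow_gen (by norm_num) (TT_order S I hx.2) (n := n) h'
      apply le_antisymm
      · rw [Subgroup.zpowers_le]; exact Subgroup.pow_mem _ (Subgroup.mem_zpowers x) n
      · rw [Subgroup.zpowers_le]
        have := Subgroup.pow_mem (Subgroup.zpowers (x ^ n)) (Subgroup.mem_zpowers (x ^ n)) m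
        rwa [hm] at this
  rw [e, ← Set.ncard_eq_toFinset_card', Set.ncard_sdiff_singleton_of_mem (by exact Subgroup.one_mem (Subgroup.zpowers x))]
  change 28 ∣ Nat.card (Subgroup.zpowers x) - 1
  rw [Nat.card_zpowers, TT_order S I hx.2]

theorem TT_841 (S : CohSetup H N) (I : CharIface H α β) (A : Subgroup G) (hA : Nat.card A = 841)
    (h : 28 < ((A : Set G) ∩ TT α).ncard) : ∀ x ∈ A, x ≠ 1 → x ∈ TT α := by
  obtain ⟨n, hn⟩ := countT S I A 2 hA
  obtain ⟨t, ht⟩ := TT_28 S I A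
  have hsub : ((A : Set G) ∩ TT α) ⊆ (A : Set G) \ {1} := fun x hx => ⟨hx.1, hx.2.1⟩
  have hc : ((A : Set G) \ {1}).ncard = 840 := by
    rw [Set.ncard_sdiff_singleton_of_mem (by exact A.one_mem)]
    change Nat.card A - 1 = 840
    rw [hA]
  have hle := Set.ncard_le_ncard hsub
  have heq := Set.eq_of_subset_of_ncard_le hsub (by omega)
  intro x hx h1
  have : x ∈ (A : Set G) \ {1} := ⟨hx, h1⟩
  rw [← heq] at this
  exact this.2
end
end

section
section
variable {G : Type*} [Group G]

def IsE (T : Set G) (E : Subgroup G) : Prop := Nat.card E = 841 ∧ ∀ x ∈ E, x ≠ 1 → x ∈ T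

/-- The outcome of the character theory: information about `29`-elements. -/
structure TSetup (G : Type*) [Group G] (T : Set G) : Prop where
  card : Nat.card G = 2 ^ 5 * 3 * 5 * 7 ^ 2 * 13 * 29 ^ 3 * 67
  ne_one : ∀ z ∈ T, z ≠ 1
  pow : ∀ z ∈ T, z ^ 29 = 1
  conj : ∀ z ∈ T, ∀ g : G, g * z * g⁻¹ ∈ T
  gen : ∀ z ∈ T, ∀ n : ℕ, z ^ n ≠ 1 → z ^ n ∈ T
  cent : ∀ z ∈ T, Nat.card (Subgroup.centralizer {z}) = 341446 ∨ Nat.card (Subgroup.centralizer {z}) = 682892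
  syl : ∀ z ∈ T, ∃ P : Sylow 29 G, ∀ x : G, x ∈ P ↔ (x * z = z * x ∧ ∃ k : ℕ, x ^ (29 ^ k) = 1)
  zz : ∀ P : Sylow 29 G, Nat.card (ZZ (P : Subgroup G)) = 29 ∧
    ∀ x ∈ P, ∀ y ∈ P, x * y * x⁻¹ * y⁻¹ ∈ ZZ (P : Subgroup G)
  zzT : ∀ P : Sylow 29 G, ∀ x ∈ ZZ (P : Subgroup G), x ≠ 1 → x ∈ T
  two : ∀ P : Sylow 29 G, ∃ E1 E2 : Subgroup G, E1 ≠ E2 ∧ IsE T E1 ∧ IsE T E2 ∧ E1 ≤ P ∧ E2 ≤ P ∧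
    ZZ (P : Subgroup G) ≤ E1 ∧ ZZ (P : Subgroup G) ≤ E2 ∧ ∀ x ∈ P, x ∈ T → x ∈ E1 ∨ x ∈ E2

variable [Finite G] {H N : Subgroup G} {α β : G → ℤ}

theorem card_ZZ_sup (S : CohSetup H N) (I : CharIface H α β) (P : Sylow 29 G) {x : G} (hx : x ∈ P)
    (hxz : x ∉ ZZ (P : Subgroup G)) :
    Nat.card (ZZ (P : Subgroup G) ⊔ Subgroup.zpowers x : Subgroup G) = 841 ∧
      ZZ (P : Subgroup G) ⊔ Subgroup.zpowers x ≤ P := by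
  set Z := ZZ (P : Subgroup G) with hZ
  set K := Z ⊔ Subgroup.zpowers x with hK
  have hxK : x ∈ K := (le_sup_right : Subgroup.zpowers x ≤ K) (Subgroup.mem_zpowers x)
  have hKP : K ≤ P := sup_le inf_le_left (by rw [Subgroup.zpowers_le]; exact hx)
  refine ⟨?_, hKP⟩
  have hKC : K ≤ Subgroup.centralizer {x} := by
    refine sup_le ?_ ?_
    · intro z hz
      rw [Subgroup.mem_centralizer_singleton_iff]
      exact ((mem_ZZ.1 hz).2 x hx).symm
    · rw [Subgroup.zpowers_le, Subgroup.mem_centralizer_singleton_iff]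
  have hP : Nat.card (P : Subgroup G) = 29 ^ 3 := card_syl29 S.cardG P
  obtain ⟨k, hk, hk'⟩ := (Nat.dvd_prime_pow (by norm_num)).1 (hP ▸ Subgroup.card_dvd_of_le hKP)
  have h3 : k ≠ 3 := by
    rintro rfl
    have : K = P := Subgroup.eq_of_le_of_card_ge hKP (by rw [hk', hP])
    apply hxz
    rw [mem_ZZ]
    refine ⟨hx, fun y hy => ?_⟩
    rw [← this] at hy
    exact Subgroup.mem_centralizer_singleton_iff.1 (hKC hy)
  have hZc : Nat.card Z = 29 := (ZZ_card S I P).1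
  have hZK : Z ≤ K := le_sup_left
  have h1 : 29 < Nat.card K := by
    have := Subgroup.card_le_of_le hZK
    rw [hZc] at this
    rcases this.lt_or_eq with h | h
    · exact h
    · exfalso
      apply hxz
      have : Z = K := Subgroup.eq_of_le_of_card_ge hZK (by rw [hZc, h])
      rw [this]; exact hxK
  rw [hk'] at h1 ⊢
  interval_cases k <;> simp_all

theorem TT_two (S : CohSetup H N) (I : CharIface H α β) (P : Sylow 29 G) :
    ∃ E1 E2 : Subgroup G, E1 ≠ E2 ∧ IsE (TT α) E1 ∧ IsE (TT α) E2 ∧ E1 ≤ P ∧ E2 ≤ P ∧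
    ZZ (P : Subgroup G) ≤ E1 ∧ ZZ (P : Subgroup G) ≤ E2 ∧ ∀ x ∈ P, x ∈ TT α → x ∈ E1 ∨ x ∈ E2 := by
  classical
  have : Fintype G := Fintype.ofFinite G
  set Z := ZZ (P : Subgroup G) with hZ
  have hP : Nat.card (P : Subgroup G) = 29 ^ 3 := card_syl29 S.cardG P
  have hZc : Nat.card Z = 29 := (ZZ_card S I P).1
  have hZP : Z ≤ P := inf_le_left
  set f : G → Subgroup G := fun x => Z ⊔ Subgroup.zpowers x with hf
  set F := (((P : Set G) ∩ TT α) \ (Z : Set G)).toFinset with hF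
  have hmf : ∀ x, x ∈ f x := fun x => (le_sup_right : Subgroup.zpowers x ≤ f x) (Subgroup.mem_zpowers x)
  have hZf : ∀ x, Z ≤ f x := fun x => le_sup_left
  have hallT : ∀ x ∈ F, IsE (TT α) (f x) ∧ f x ≤ P := by
    intro x hx
    rw [hF, Set.mem_toFinset] at hx
    obtain ⟨h1, h2⟩ := card_ZZ_sup S I P hx.1.1 hx.2
    refine ⟨⟨h1, TT_841 S I _ h1 ?_⟩, h2⟩
    have hs : insert x ((Z : Set G) \ {1}) ⊆ ((f x : Subgroup G) : Set G) ∩ TT α := by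
      intro y hy
      rcases hy with rfl | hy
      · exact ⟨hmf y, hx.1.2⟩
      · exact ⟨hZf x hy.1, ZZ_TT S I P hy.1 hy.2⟩
    have := Set.ncard_le_ncard hs
    rw [Set.ncard_insert_of_notMem (fun h => hx.2 h.1), Set.ncard_sdiff_singleton_of_mem (by exact Z.one_mem)] at this
    change Nat.card Z - 1 + 1 ≤ _ at this
    rw [hZc] at this
    omega
  have hfib : ∀ x ∈ F, (F.filter (fun y => f y = f x)).card = 812 := by
    intro x hx
    obtain ⟨⟨h1, h2⟩, h3⟩ := hallT x hx
    have e : F.filter (fun y => f y = f x) = (((f x : Subgroup G) : Set G) \ (Z : Set G)).toFinset := by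
      ext y
      rw [Finset.mem_filter, Set.mem_toFinset (s := ((f x : Subgroup G) : Set G) \ (Z : Set G))]
      constructor
      · rintro ⟨h, h'⟩
        refine ⟨h' ▸ hmf y, ?_⟩
        rw [hF, Set.mem_toFinset] at h
        exact h.2
      · rintro ⟨h, h'⟩
        have hyF : y ∈ F := by
          rw [hF, Set.mem_toFinset]
          exact ⟨⟨h3 h, h2 y h (fun h0 => h' (by rw [h0]; exact Z.one_mem))⟩, h'⟩
        refine ⟨hyF, ?_⟩
        apply Subgroup.eq_of_le_of_card_ge
        · exact sup_le (hZf x) (by rw [Subgroup.zpowers_le]; exact h)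
        · rw [h1, (hallT y hyF).1.1]
    rw [e, ← Set.ncard_eq_toFinset_card', Set.ncard_sdiff (by exact hZf x)]
    change Nat.card (f x) - Nat.card Z = 812
    rw [h1, hZc]
  have hcF : F.card = (F.image f).card * 812 := by
    rw [Finset.card_eq_sum_card_image f F]
    apply Finset.sum_const_nat
    intro K hK
    obtain ⟨x, hx, rfl⟩ := Finset.mem_image.1 hK
    exact hfib x hx
  obtain ⟨n, hn⟩ := countT S I P 3 hP
  have hFle : F.card ≤ 24360 := by
    rw [hF, ← Set.ncard_eq_toFinset_card']
    have : (((P : Set G) ∩ TT α) \ (Z : Set G)) ⊆ (P : Set G) \ Z := fun x hx => ⟨hx.1.1, hx.2⟩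
    refine (Set.ncard_le_ncard this).trans ?_
    rw [Set.ncard_sdiff (by exact hZP)]
    change Nat.card (P : Subgroup G) - Nat.card Z ≤ _
    rw [hP, hZc]; norm_num
  have hm : ((P : Set G) ∩ TT α).ncard = F.card + 28 := by
    rw [hF, ← Set.ncard_eq_toFinset_card', ← Set.ncard_inter_add_ncard_sdiff_eq_ncard ((P : Set G) ∩ TT α) (Z : Set G), add_comm]
    congr 1
    have : (P : Set G) ∩ TT α ∩ (Z : Set G) = (Z : Set G) \ {1} := by
      ext x
      constructor
      · rintro ⟨⟨h, h'⟩, h''⟩; exact ⟨h'', h'.1⟩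
      · rintro ⟨h, h'⟩; exact ⟨⟨hZP h, ZZ_TT S I P h h'⟩, h⟩
    rw [this, Set.ncard_sdiff_singleton_of_mem (by exact Z.one_mem)]
    change Nat.card Z - 1 = 28
    rw [hZc]
  change 870 + 29 * ((P : Set G) ∩ TT α).ncard = _ at hn
  rw [hm] at hn
  have h2 : (F.image f).card = 2 := by omega
  obtain ⟨E1, E2, hne, him⟩ := Finset.card_eq_two.1 h2
  have hE : ∀ K ∈ F.image f, IsE (TT α) K ∧ K ≤ P ∧ Z ≤ K := by
    intro K hK
    obtain ⟨x, hx, rfl⟩ := Finset.mem_image.1 hK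
    exact ⟨(hallT x hx).1, (hallT x hx).2, hZf x⟩
  have m1 := hE E1 (by rw [him]; simp)
  have m2 := hE E2 (by rw [him]; simp)
  refine ⟨E1, E2, hne, m1.1, m2.1, m1.2.1, m2.2.1, m1.2.2, m2.2.2, ?_⟩
  intro x hx hxT
  by_cases hz : x ∈ Z
  · exact Or.inl (m1.2.2 hz)
  · have hxF : x ∈ F := by rw [hF, Set.mem_toFinset]; exact ⟨⟨hx, hxT⟩, hz⟩
    have : f x ∈ F.image f := Finset.mem_image_of_mem f hxF
    rw [him] at this
    simp only [Finset.mem_insert, Finset.mem_singleton] at this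
    rcases this with h | h
    · exact Or.inl (h ▸ hmf x)
    · exact Or.inr (h ▸ hmf x)

theorem exists_TSetup (S : CohSetup H N) : ∃ T : Set G, TSetup G T := by
  obtain ⟨α, β, I⟩ := char_iface S
  refine ⟨TT α, S.cardG, fun z hz => hz.1, fun z hz => TT_pow S I hz, ?_, fun z hz n h => TT_gen S I hz h,
    fun z hz => TT_card S I hz, fun z hz => TT_syl S I hz, ZZ_card S I, fun P x hx h => ZZ_TT S I P hx h, TT_two S I⟩
  rintro z ⟨h1, ⟨k, hk⟩, h2⟩ g
  refine ⟨?_, ⟨k, ?_⟩, ?_⟩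
  · rw [Ne, conj_eq_one_iff]; exact h1
  · rw [conj_pow, hk]; simp
  · rw [I.conj, h2]
end
end

section
section
variable {G : Type*} [Group G] [Finite G] {T : Set G}

/-- The vertices: the subgroups of order `841` all of whose nonidentity elements lie in `T`. -/
@[ext] structure VV (S : TSetup G T) where
  sg : Subgroup G
  isE : IsE T sg

theorem T_ord (S : TSetup G T) {z : G} (hz : z ∈ T) : orderOf z = 29 :=
  orderOf_eq_prime (S.pow z hz) (S.ne_one z hz)

theorem VV_card {S : TSetup G T} (v : VV S) : Nat.card v.sg = 841 := v.isE.1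

theorem VV_T {S : TSetup G T} (v : VV S) {x : G} (hx : x ∈ v.sg) (h1 : x ≠ 1) : x ∈ T := v.isE.2 x hx h1

theorem VV_comm {S : TSetup G T} (v : VV S) {x y : G} (hx : x ∈ v.sg) (hy : y ∈ v.sg) : x * y = y * x := by
  have h : Nat.card v.sg = 29 ^ 2 := v.isE.1
  have := (IsPGroup.isMulCommutative_of_card_eq_prime_sq h).is_comm.comm (⟨x, hx⟩ : v.sg) ⟨y, hy⟩
  exact congrArg Subtype.val this

theorem localz (S : TSetup G T) {z : G} (hz : z ∈ T) : ∃ P : Subgroup G, Nat.card P = 29 ^ 3 ∧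
    (∀ x, x ∈ P ↔ x * z = z * x ∧ ∃ k : ℕ, x ^ 29 ^ k = 1) ∧
    (∀ x ∈ P, ∀ y ∈ P, x * y * x⁻¹ * y⁻¹ ∈ Subgroup.zpowers z) ∧
    (∀ x ∈ P, (∀ y ∈ P, y * x = x * y) → x ∈ Subgroup.zpowers z) ∧
    ∃ E1 E2 : Subgroup G, E1 ≠ E2 ∧ IsE T E1 ∧ IsE T E2 ∧ E1 ≤ P ∧ E2 ≤ P ∧ z ∈ E1 ∧ z ∈ E2 ∧
      ∀ x ∈ P, x ∈ T → x ∈ E1 ∨ x ∈ E2 := by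
  obtain ⟨P, hP⟩ := S.syl z hz
  have hzP : z ∈ P := (hP z).2 ⟨rfl, 1, by rw [pow_one]; exact S.pow z hz⟩
  have hzZ : z ∈ ZZ (P : Subgroup G) := mem_ZZ.2 ⟨hzP, fun y hy => ((hP y).1 hy).1⟩
  have hZ : Subgroup.zpowers z = ZZ (P : Subgroup G) := by
    apply Subgroup.eq_of_le_of_card_ge
    · rw [Subgroup.zpowers_le]; exact hzZ
    · rw [(S.zz P).1, Nat.card_zpowers, T_ord S hz]
  obtain ⟨E1, E2, h1, h2, h3, h4, h5, h6, h7, h8⟩ := S.two P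
  refine ⟨P, card_syl29 S.card P, hP, ?_, ?_, E1, E2, h1, h2, h3, h4, h5, h6 hzZ, h7 hzZ, h8⟩
  · rw [hZ]; exact (S.zz P).2
  · intro x hx h
    rw [hZ]; exact mem_ZZ.2 ⟨hx, h⟩

theorem sub_of_union {A B C : Subgroup G} (h : ∀ x ∈ A, x ∈ B ∨ x ∈ C) : A ≤ B ∨ A ≤ C := by
  by_contra hh
  push Not at hh
  obtain ⟨h1, h2⟩ := hh
  obtain ⟨x, hx, hxB⟩ := SetLike.not_le_iff_exists.1 h1
  obtain ⟨y, hy, hyC⟩ := SetLike.not_le_iff_exists.1 h2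
  have hxC := (h x hx).resolve_left hxB
  have hyB := (h y hy).resolve_right hyC
  rcases h (x * y) (A.mul_mem hx hy) with h' | h'
  · exact hxB ((Subgroup.mul_mem_cancel_right B hyB).1 h')
  · exact hyC ((Subgroup.mul_mem_cancel_left C hxC).1 h')

theorem VV_leP {S : TSetup G T} {z : G} {P : Subgroup G}
    (hP : ∀ x, x ∈ P ↔ x * z = z * x ∧ ∃ k : ℕ, x ^ 29 ^ k = 1) (v : VV S) (hv : z ∈ v.sg) : v.sg ≤ P := by
  intro x hx
  refine (hP x).2 ⟨VV_comm v hx hv, 1, ?_⟩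
  rw [pow_one]
  by_cases h1 : x = 1
  · rw [h1]; simp
  · exact S.pow x (VV_T v hx h1)

theorem VV_eq_of_le {S : TSetup G T} {v w : VV S} (h : v.sg ≤ w.sg) : v = w := by
  apply VV.ext
  exact Subgroup.eq_of_le_of_card_ge h (by rw [v.isE.1, w.isE.1])

theorem two_of (S : TSetup G T) {z : G} (hz : z ∈ T) : ∃ v w : VV S, v ≠ w ∧ z ∈ v.sg ∧ z ∈ w.sg ∧
    (∀ u : VV S, z ∈ u.sg → u = v ∨ u = w) ∧ ∀ x ∈ T, x * z = z * x → x ∈ v.sg ∨ x ∈ w.sg := by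
  obtain ⟨P, hc, hP, h1, h2, E1, E2, h3, h4, h5, h6, h7, h8, h9, h10⟩ := localz S hz
  refine ⟨⟨E1, h4⟩, ⟨E2, h5⟩, fun h => h3 (congrArg VV.sg h), h8, h9, ?_, ?_⟩
  · intro u hu
    have hle := VV_leP hP u hu
    have : ∀ x ∈ u.sg, x ∈ E1 ∨ x ∈ E2 := by
      intro x hx
      by_cases hx1 : x = 1
      · rw [hx1]; exact Or.inl E1.one_mem
      · exact h10 x (hle hx) (VV_T u hx hx1)
    rcases sub_of_union this with h | h
    · exact Or.inl (VV_eq_of_le h)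
    · exact Or.inr (VV_eq_of_le h)
  · intro x hx hxz
    exact h10 x ((hP x).2 ⟨hxz, 1, by rw [pow_one]; exact S.pow x hx⟩) hx

theorem comm_zp {S : TSetup G T} {v w : VV S} {z x y : G} (h1 : z ≠ 1) (hzv : z ∈ v.sg)
    (hzw : z ∈ w.sg) (hx : x ∈ v.sg) (hy : y ∈ w.sg) : x * y * x⁻¹ * y⁻¹ ∈ Subgroup.zpowers z := by
  obtain ⟨P, hc, hP, h, -⟩ := localz S (VV_T v hzv h1)
  exact h x (VV_leP hP v hzv hx) y (VV_leP hP w hzw hy)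

theorem not_comm {S : TSetup G T} {v w : VV S} {z x y : G} (h1 : z ≠ 1) (hzv : z ∈ v.sg)
    (hzw : z ∈ w.sg) (hx : x ∈ v.sg) (hy : y ∈ w.sg) (hxy : x * y = y * x) : x ∈ w.sg ∨ y ∈ v.sg := by
  obtain ⟨P, hc, hP, -, h, -⟩ := localz S (VV_T v hzv h1)
  rw [or_iff_not_imp_right]
  intro hyv
  have hvP := VV_leP hP v hzv
  have hwP := VV_leP hP w hzw
  set C := P ⊓ Subgroup.centralizer {x} with hC
  have hvC : v.sg ≤ C := by
    intro t ht
    exact ⟨hvP ht, Subgroup.mem_centralizer_singleton_iff.2 (VV_comm v ht hx)⟩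
  have hyC : y ∈ C := ⟨hwP hy, Subgroup.mem_centralizer_singleton_iff.2 hxy.symm⟩
  have hCP : C ≤ P := inf_le_left
  have hlt : 841 < Nat.card C := by
    have := Subgroup.card_le_of_le hvC
    rw [v.isE.1] at this
    rcases this.lt_or_eq with h | h
    · exact h
    · exfalso
      apply hyv
      have : v.sg = C := Subgroup.eq_of_le_of_card_ge hvC (by rw [v.isE.1, h])
      rw [this]; exact hyC
  obtain ⟨k, hk, hk'⟩ := (Nat.dvd_prime_pow (by norm_num)).1 (hc ▸ Subgroup.card_dvd_of_le hCP)
  have h3 : k = 3 := by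
    rw [hk'] at hlt
    interval_cases k <;> simp_all
  have hCe : C = P := Subgroup.eq_of_le_of_card_ge hCP (by rw [hk', hc, h3])
  have : x ∈ Subgroup.zpowers z := by
    apply h x (hvP hx)
    intro t ht
    rw [← hCe] at ht
    exact Subgroup.mem_centralizer_singleton_iff.1 ht.2
  exact (Subgroup.zpowers_le.2 hzw) this

instance VV_finite (S : TSetup G T) : Finite (VV S) :=
  Finite.of_injective (fun v => v.sg) (fun v w h => VV.ext h)

instance VV_act (S : TSetup G T) : MulAction G (VV S) where
  smul g v := ⟨v.sg.map (MulAut.conj g).toMonoidHom, by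
    refine ⟨?_, ?_⟩
    · rw [← v.isE.1]
      exact (Nat.card_congr (v.sg.equivMapOfInjective _ (MulAut.conj g).injective).toEquiv).symm
    · rintro x ⟨y, hy, rfl⟩ h1
      refine S.conj y (v.isE.2 y hy ?_) g
      rintro rfl
      apply h1
      simp⟩
  one_smul v := by
    apply VV.ext
    change v.sg.map (MulAut.conj 1).toMonoidHom = v.sg
    ext x; simp
  mul_smul g h v := by
    apply VV.ext
    change v.sg.map (MulAut.conj (g * h)).toMonoidHom = (v.sg.map (MulAut.conj h).toMonoidHom).map (MulAut.conj g).toMonoidHom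
    rw [Subgroup.map_map]
    congr 1
    ext x; simp

theorem mem_smul {S : TSetup G T} {v : VV S} {g x : G} : x ∈ (g • v).sg ↔ g⁻¹ * x * g ∈ v.sg := by
  change x ∈ v.sg.map (MulAut.conj g).toMonoidHom ↔ _
  rw [Subgroup.mem_map]
  constructor
  · rintro ⟨y, hy, rfl⟩
    simpa [mul_assoc] using hy
  · intro h
    exact ⟨_, h, by simp [mul_assoc]⟩

theorem conj_mem_smul {S : TSetup G T} {v : VV S} {g x : G} (h : x ∈ v.sg) : g * x * g⁻¹ ∈ (g • v).sg := by
  rw [mem_smul]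
  simpa [mul_assoc] using h

/-- adjacency -/
def Ad {S : TSetup G T} (v w : VV S) : Prop := v ≠ w ∧ ∃ z, z ≠ 1 ∧ z ∈ v.sg ∧ z ∈ w.sg

theorem Ad.symm {S : TSetup G T} {v w : VV S} (h : Ad v w) : Ad w v :=
  ⟨h.1.symm, by obtain ⟨z, a, b, c⟩ := h.2; exact ⟨z, a, c, b⟩⟩

theorem Ad.smul {S : TSetup G T} {v w : VV S} (h : Ad v w) (g : G) : Ad (g • v) (g • w) := by
  obtain ⟨z, a, b, c⟩ := h.2
  refine ⟨fun e => h.1 (smul_left_cancel g e), g * z * g⁻¹, ?_, conj_mem_smul b, conj_mem_smul c⟩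
  rwa [Ne, conj_eq_one_iff]

theorem Ad_smul_iff {S : TSetup G T} {v w : VV S} {g : G} : Ad (g • v) (g • w) ↔ Ad v w := by
  refine ⟨fun h => ?_, fun h => h.smul g⟩
  have := h.smul g⁻¹
  rwa [inv_smul_smul, inv_smul_smul] at this

theorem third {S : TSetup G T} {u v w : VV S} {z : G} (h1 : z ≠ 1) (hu : z ∈ u.sg) (hv : z ∈ v.sg)
    (hw : z ∈ w.sg) (huv : u ≠ v) (huw : u ≠ w) : v = w := by
  obtain ⟨a, b, -, -, -, h, -⟩ := two_of S (VV_T u hu h1)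
  rcases h u hu with rfl | rfl <;> rcases h v hv with rfl | rfl <;> rcases h w hw with rfl | rfl <;> simp_all

theorem exists_other {S : TSetup G T} {u : VV S} {z : G} (h1 : z ≠ 1) (hu : z ∈ u.sg) :
    ∃ v : VV S, Ad u v ∧ z ∈ v.sg := by
  obtain ⟨a, b, hab, ha, hb, h, -⟩ := two_of S (VV_T u hu h1)
  rcases h u hu with rfl | rfl
  · exact ⟨b, ⟨hab, z, h1, ha, hb⟩, hb⟩
  · exact ⟨a, ⟨hab.symm, z, h1, hb, ha⟩, ha⟩

theorem comm_mem {S : TSetup G T} {v w : VV S} {x y : G} (h : Ad v w) (hx : x ∈ v.sg) (hy : y ∈ w.sg) :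
    x * y * x⁻¹ * y⁻¹ ∈ v.sg ∧ x * y * x⁻¹ * y⁻¹ ∈ w.sg := by
  obtain ⟨-, z, h1, hv, hw⟩ := h
  have := comm_zp h1 hv hw hx hy
  exact ⟨Subgroup.zpowers_le.2 hv this, Subgroup.zpowers_le.2 hw this⟩

theorem smul_of_norm {S : TSetup G T} {v : VV S} {g : G} (h : ∀ x ∈ v.sg, g * x * g⁻¹ ∈ v.sg) : g • v = v := by
  symm
  have : v.sg ≤ (g⁻¹ • v).sg := by
    intro x hx
    rw [mem_smul, inv_inv]; exact h x hx
  have := VV_eq_of_le this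
  nth_rewrite 2 [this]
  rw [smul_inv_smul]

theorem smul_self {S : TSetup G T} {v : VV S} {g : G} (h : g ∈ v.sg) : g • v = v :=
  smul_of_norm (fun _ hx => v.sg.mul_mem (v.sg.mul_mem h hx) (v.sg.inv_mem h))

theorem smul_nbr {S : TSetup G T} {v w : VV S} {g : G} (ha : Ad v w) (h : g ∈ v.sg) : g • w = w :=
  smul_of_norm (fun x hx => by
    have := w.sg.mul_mem (comm_mem ha h hx).2 hx
    rwa [inv_mul_cancel_right] at this)

/-- intersection of adjacent vertices -/
theorem Ad_inter {S : TSetup G T} {v w : VV S} (h : v ≠ w) {z x : G} (h1 : z ≠ 1) (hv : z ∈ v.sg)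
    (hw : z ∈ w.sg) (hxv : x ∈ v.sg) (hxw : x ∈ w.sg) : x ∈ Subgroup.zpowers z := by
  have hle : Subgroup.zpowers z ≤ v.sg ⊓ w.sg := le_inf (Subgroup.zpowers_le.2 hv) (Subgroup.zpowers_le.2 hw)
  have hd : Nat.card (v.sg ⊓ w.sg : Subgroup G) ∣ 29 ^ 2 := by
    have := Subgroup.card_dvd_of_le (inf_le_left : v.sg ⊓ w.sg ≤ v.sg)
    rwa [v.isE.1] at this
  obtain ⟨k, hk, hk'⟩ := (Nat.dvd_prime_pow (by norm_num)).1 hd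
  have hz : Nat.card (Subgroup.zpowers z) = 29 := by rw [Nat.card_zpowers, T_ord S (VV_T v hv h1)]
  have h2 : k ≠ 2 := by
    rintro rfl
    apply h
    apply VV_eq_of_le
    have : v.sg ⊓ w.sg = v.sg := Subgroup.eq_of_le_of_card_ge inf_le_left (by rw [hk', v.isE.1]; norm_num)
    exact inf_eq_left.1 this
  have : Subgroup.zpowers z = v.sg ⊓ w.sg := by
    apply Subgroup.eq_of_le_of_card_ge hle
    rw [hk', hz]
    interval_cases k <;> simp_all
  rw [this]; exact ⟨hxv, hxw⟩

/-- stabilizers -/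
theorem stab_nbr {S : TSetup G T} {v w u : VV S} (hvw : Ad v w) (hwu : Ad w u) (huv : u ≠ v) {g : G}
    (hg : g ∈ v.sg) (hgu : g • u = u) : g ∈ w.sg := by
  obtain ⟨hwu1, y, y1, yw, yu⟩ := hwu
  have hgw := smul_nbr hvw hg
  have m1 : g * y * g⁻¹ ∈ u.sg := by have := conj_mem_smul (g := g) yu; rwa [hgu] at this
  have m2 := comm_mem hvw hg yw
  have m3 : g * y * g⁻¹ * y⁻¹ ∈ u.sg := u.sg.mul_mem m1 (u.sg.inv_mem yu)
  by_cases hc : g * y * g⁻¹ * y⁻¹ = 1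
  · obtain ⟨_, z, z1, zv, zw⟩ := id hvw
    have : g * y = y * g := by
      rw [mul_inv_eq_one, mul_inv_eq_iff_eq_mul] at hc; exact hc
    rcases not_comm z1 zv zw hg yw this with h | h
    · exact h
    · exact absurd (third y1 yw h yu hvw.1.symm hwu1) huv.symm
  · exact absurd (third hc m2.2 m2.1 m3 hvw.1.symm hwu1) huv.symm
end
end

section
section
variable {G : Type*} [Group G] [Finite G] {T : Set G}

theorem conj_pow_aux {g y c : G} (h : g * y * g⁻¹ = c * y) (hc : g * c = c * g) (n : ℕ) :
    g ^ n * y * (g ^ n)⁻¹ = c ^ n * y := by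
  induction n with
  | zero => simp
  | succ n ih =>
    have e : g ^ (n + 1) * y * (g ^ (n + 1))⁻¹ = g * (g ^ n * y * (g ^ n)⁻¹) * g⁻¹ := by
      rw [pow_succ']; group
    have hcn : g * c ^ n = c ^ n * g := (Commute.pow_right (show Commute g c from hc) n)
    rw [e, ih, ← mul_assoc, hcn, mul_assoc (c ^ n), mul_assoc (c ^ n), h, pow_succ, mul_assoc]

theorem exists_not_mem {S : TSetup G T} {v w : VV S} (h : v ≠ w) : ∃ g ∈ v.sg, g ∉ w.sg := by
  by_contra hh
  push Not at hh
  exact h (VV_eq_of_le hh)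

theorem mem_zp_nat {c x : G} (h : x ∈ Subgroup.zpowers c) : ∃ n : ℕ, c ^ n = x := by
  rw [← mem_powers_iff_mem_zpowers] at h
  exact h

theorem transv {S : TSetup G T} {v w : VV S} (h : Ad v w) {y c : G} (hy : y ∈ w.sg) (hyv : y ∉ v.sg)
    (hcv : c ∈ v.sg) (hcw : c ∈ w.sg) : ∃ g ∈ v.sg, g * y * g⁻¹ = c * y := by
  obtain ⟨g0, hg0, hg0w⟩ := exists_not_mem h.1
  obtain ⟨_, z, z1, zv, zw⟩ := id h
  have hm := comm_mem h hg0 hy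
  set c0 := g0 * y * g0⁻¹ * y⁻¹ with hc0
  have c1 : c0 ≠ 1 := by
    intro hc
    rw [hc0, mul_inv_eq_one, mul_inv_eq_iff_eq_mul] at hc
    rcases not_comm z1 zv zw hg0 hy hc with h | h
    · exact hg0w h
    · exact hyv h
  obtain ⟨n, hn⟩ := mem_zp_nat (Ad_inter h.1 c1 hm.1 hm.2 hcv hcw)
  refine ⟨g0 ^ n, v.sg.pow_mem hg0 n, ?_⟩
  rw [conj_pow_aux (c := c0) (by rw [hc0]; group) (VV_comm v hg0 hm.1), hn]

/-- coordinates on a vertex -/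
def ww (c y : G) (p : ZMod 29 × ZMod 29) : G := c ^ p.1.val * y ^ p.2.val

theorem pow_val_add {c : G} (hc : c ^ 29 = 1) (i j : ZMod 29) : c ^ (i + j).val = c ^ i.val * c ^ j.val := by
  rw [ZMod.val_add, ← pow_add]
  conv_rhs => rw [← Nat.div_add_mod (i.val + j.val) 29, pow_add, pow_mul, hc, one_pow, one_mul]

theorem VV_pow {S : TSetup G T} (v : VV S) {x : G} (hx : x ∈ v.sg) : x ^ 29 = 1 := by
  by_cases h1 : x = 1
  · rw [h1]; simp
  · exact S.pow x (VV_T v hx h1)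

theorem ww_mem {S : TSetup G T} {v : VV S} {c y : G} (hc : c ∈ v.sg) (hy : y ∈ v.sg) (p : ZMod 29 × ZMod 29) :
    ww c y p ∈ v.sg := v.sg.mul_mem (v.sg.pow_mem hc _) (v.sg.pow_mem hy _)

theorem ww_add {S : TSetup G T} {v : VV S} {c y : G} (hc : c ∈ v.sg) (hy : y ∈ v.sg) (p q : ZMod 29 × ZMod 29) :
    ww c y (p + q) = ww c y p * ww c y q := by
  unfold ww
  rw [Prod.fst_add, Prod.snd_add, pow_val_add (VV_pow v hc), pow_val_add (VV_pow v hy), mul_assoc, mul_assoc]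
  congr 1
  rw [← mul_assoc, ← mul_assoc]
  congr 1
  exact VV_comm v (v.sg.pow_mem hc _) (v.sg.pow_mem hy _)

theorem ww_zero (c y : G) : ww c y 0 = 1 := by simp [ww]

theorem ww_eq_one {S : TSetup G T} {v : VV S} {c y : G} (hc : c ∈ v.sg) (hy : y ∈ v.sg) (c1 : c ≠ 1)
    (hyc : y ∉ Subgroup.zpowers c) {p : ZMod 29 × ZMod 29} (h : ww c y p = 1) : p = 0 := by
  have oc := T_ord S (VV_T v hc c1)
  have y1 : y ≠ 1 := by rintro rfl; exact hyc (Subgroup.one_mem _)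
  have oy := T_ord S (VV_T v hy y1)
  unfold ww at h
  have h2 : p.2 = 0 := by
    by_contra h0
    have hne : y ^ p.2.val ≠ 1 := by
      intro hh
      have := orderOf_dvd_of_pow_eq_one hh
      rw [oy] at this
      have hl := ZMod.val_lt p.2
      have := Nat.eq_zero_of_dvd_of_lt this hl
      exact h0 ((ZMod.val_eq_zero _).1 this)
    obtain ⟨m, hm⟩ := pow_gen (by norm_num) oy hne
    apply hyc
    rw [← hm]
    apply Subgroup.pow_mem
    rw [mul_eq_one_iff_inv_eq] at h
    rw [← h]
    exact Subgroup.inv_mem _ (Subgroup.pow_mem _ (Subgroup.mem_zpowers c) _)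
  have h1 : p.1 = 0 := by
    rw [h2, ZMod.val_zero, pow_zero, mul_one] at h
    have := orderOf_dvd_of_pow_eq_one h
    rw [oc] at this
    exact (ZMod.val_eq_zero _).1 (Nat.eq_zero_of_dvd_of_lt this (ZMod.val_lt p.1))
  exact Prod.ext h1 h2

theorem ww_inj {S : TSetup G T} {v : VV S} {c y : G} (hc : c ∈ v.sg) (hy : y ∈ v.sg) (c1 : c ≠ 1)
    (hyc : y ∉ Subgroup.zpowers c) : Function.Injective (ww c y) := by
  intro p q h
  have : ww c y (p - q) = 1 := by
    have e := ww_add hc hy (p - q) q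
    rw [sub_add_cancel, h] at e
    exact (mul_eq_right.1 e.symm)
  exact sub_eq_zero.1 (ww_eq_one hc hy c1 hyc this)

theorem ww_surj {S : TSetup G T} {v : VV S} {c y : G} (hc : c ∈ v.sg) (hy : y ∈ v.sg) (c1 : c ≠ 1)
    (hyc : y ∉ Subgroup.zpowers c) {x : G} (hx : x ∈ v.sg) : ∃ p, ww c y p = x := by
  have hb : Function.Bijective (fun p => (⟨ww c y p, ww_mem hc hy p⟩ : v.sg)) := by
    rw [Nat.bijective_iff_injective_and_card]
    refine ⟨fun p q h => ww_inj hc hy c1 hyc (congrArg Subtype.val h), ?_⟩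
    rw [v.isE.1]; simp
  obtain ⟨p, hp⟩ := hb.2 ⟨x, hx⟩
  exact ⟨p, congrArg Subtype.val hp⟩

theorem trans_nbr {S : TSetup G T} {v w u u' : VV S} (hvw : Ad v w) (hwu : Ad w u) (huv : u ≠ v)
    (hwu' : Ad w u') (huv' : u' ≠ v) : ∃ g ∈ v.sg, g • u = u' := by
  obtain ⟨_, z, z1, zv, zw⟩ := id hvw
  obtain ⟨_, y, y1, yw, yu⟩ := id hwu
  obtain ⟨_, y', y1', yw', yu'⟩ := id hwu'
  have hyv : y ∉ v.sg := fun h => huv (third y1 yw yu h hwu.1 hvw.1.symm)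
  have hyv' : y' ∉ v.sg := fun h => huv' (third y1' yw' yu' h hwu'.1 hvw.1.symm)
  obtain ⟨p, hp⟩ := ww_surj zw yw' z1 (fun h => hyv' (Subgroup.zpowers_le.2 zv h)) yw
  obtain ⟨g, hg, hg'⟩ := transv hvw yw hyv (c := (z ^ p.1.val)⁻¹) (v.sg.inv_mem (v.sg.pow_mem zv _))
    (w.sg.inv_mem (w.sg.pow_mem zw _))
  have e : g * y * g⁻¹ = y' ^ p.2.val := by
    rw [hg', ← hp, ww]; group
  refine ⟨g, hg, ?_⟩
  have hgw := smul_nbr hvw hg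
  have hne : w ≠ g • u := by
    intro h
    rw [← hgw] at h
    exact hwu.1 (smul_left_cancel g h)
  refine third (z := g * y * g⁻¹) (by rwa [Ne, conj_eq_one_iff]) (u := w) ?_ (conj_mem_smul yu) ?_ hne hwu'.1
  · rw [e]; exact w.sg.pow_mem yw' _
  · rw [e]; exact u'.sg.pow_mem yu' _

theorem no_tri {S : TSetup G T} {e w u : VV S} (h1 : Ad e w) (h2 : Ad w u) (h3 : Ad e u) : False := by
  obtain ⟨_, x, x1, xe, xu⟩ := id h3
  have := stab_nbr h1 h2 h3.1.symm xe (smul_self xu)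
  exact h2.1 (third x1 xe this xu h1.1 h3.1)

theorem uniq_par {S : TSetup G T} {e w u w' : VV S} (h1 : Ad e w) (h2 : Ad w u) (h1' : Ad e w')
    (h2' : Ad w' u) (hne : u ≠ e) : w = w' := by
  obtain ⟨_, x, x1, xe, xw⟩ := id h1'
  have := stab_nbr h1 h2 hne xe (smul_nbr h2' xw)
  exact third x1 xe this xw h1.1 h1'.1

theorem fix_near {S : TSetup G T} {e W : VV S} {g : G} (hg : g ∈ e.sg) (g1 : g ≠ 1) (hW : g • W = W) :
    W = e ∨ Ad e W ∨ ∃ w, Ad e w ∧ Ad w W := by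
  have hcl : ∀ h ∈ Subgroup.zpowers g, ∀ x ∈ W.sg, h * x * h⁻¹ ∈ W.sg := by
    intro h hh x hx
    obtain ⟨n, rfl⟩ := mem_zp_nat hh
    have : g ^ n • W = W := by
      have : g ∈ MulAction.stabilizer G W := hW
      exact Subgroup.pow_mem _ this n
    have h2 := conj_mem_smul (g := g ^ n) hx
    rwa [this] at h2
  let act : MulAction (Subgroup.zpowers g) W.sg :=
    { smul := fun h x => ⟨h.1 * x.1 * h.1⁻¹, hcl h.1 h.2 x.1 x.2⟩
      one_smul := fun x => by
        apply Subtype.ext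
        change (1 : G) * x.1 * (1 : G)⁻¹ = x.1
        simp
      mul_smul := fun a b x => by
        apply Subtype.ext
        change (a.1 * b.1) * x.1 * (a.1 * b.1)⁻¹ = a.1 * (b.1 * x.1 * b.1⁻¹) * a.1⁻¹
        group }
  have hp : IsPGroup 29 (Subgroup.zpowers g) := by
    apply IsPGroup.of_card (n := 1)
    rw [Nat.card_zpowers, T_ord S (VV_T e hg g1), pow_one]
  have hd := hp.card_modEq_card_fixedPoints W.sg
  rw [W.isE.1] at hd
  have hone : (1 : W.sg) ∈ MulAction.fixedPoints (Subgroup.zpowers g) W.sg := by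
    intro h
    apply Subtype.ext
    change h.1 * (1 : G) * h.1⁻¹ = 1
    simp
  have : ∃ x ∈ MulAction.fixedPoints (Subgroup.zpowers g) W.sg, x ≠ 1 := by
    by_contra hcon
    push Not at hcon
    have : MulAction.fixedPoints (Subgroup.zpowers g) W.sg = {1} := by
      ext x
      exact ⟨fun h => hcon x h, fun h => by rw [Set.mem_singleton_iff.1 h]; exact hone⟩
    rw [this] at hd
    simp at hd
    exact absurd hd (by decide)
  obtain ⟨⟨x, hx⟩, hfx, x1⟩ := this
  have hx1 : x ≠ 1 := fun h => x1 (Subtype.ext h)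
  have hgx : g * x * g⁻¹ = x := congrArg Subtype.val (hfx ⟨g, Subgroup.mem_zpowers g⟩)
  rw [mul_inv_eq_iff_eq_mul] at hgx
  have hxT := VV_T W hx hx1
  obtain ⟨a, b, hab, ha, hb, h, h'⟩ := two_of S hxT
  have key : ∀ w : VV S, x ∈ w.sg → g ∈ w.sg → W = e ∨ Ad e W ∨ ∃ w, Ad e w ∧ Ad w W := by
    intro w hxw hgw
    by_cases hwe : e = w
    · rcases eq_or_ne e W with h | h
      · exact Or.inl h.symm
      · exact Or.inr (Or.inl ⟨h, x, hx1, hwe ▸ hxw, hx⟩)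
    · have hew : Ad e w := ⟨hwe, g, g1, hg, hgw⟩
      rcases eq_or_ne w W with h | h
      · exact Or.inr (Or.inl (h ▸ hew))
      · exact Or.inr (Or.inr ⟨w, hew, h, x, hx1, hxw, hx⟩)
  rcases h' g (VV_T e hg g1) hgx with h | h
  · exact key a ha h
  · exact key b hb h

theorem conj_ind {S : TSetup G T} {v : VV S} {x y : G} (hx : x ∈ v.sg) (hy : y ∈ v.sg) (y1 : y ≠ 1)
    (hyx : x ∉ Subgroup.zpowers y) : ∃ g : G, g • v = v ∧ g * x * g⁻¹ = y * x := by
  obtain ⟨w, hw, hyw⟩ := exists_other y1 hy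
  have hxw : x ∉ w.sg := fun h => hyx (Ad_inter hw.1 y1 hy hyw hx h)
  obtain ⟨g, hg, e⟩ := transv hw.symm hx hxw hyw hy
  exact ⟨g, smul_nbr hw.symm hg, e⟩

theorem zp_swap {S : TSetup G T} {v : VV S} {x y : G} (hx : x ∈ v.sg) (x1 : x ≠ 1) (hy : y ∈ v.sg)
    (h : x ∈ Subgroup.zpowers y) : y ∈ Subgroup.zpowers x := by
  have y1 : y ≠ 1 := by
    rintro rfl
    rw [Subgroup.zpowers_one_eq_bot, Subgroup.mem_bot] at h
    exact x1 h
  have : Subgroup.zpowers x = Subgroup.zpowers y := by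
    apply Subgroup.eq_of_le_of_card_ge (Subgroup.zpowers_le.2 h)
    rw [Nat.card_zpowers, Nat.card_zpowers, T_ord S (VV_T v hx x1), T_ord S (VV_T v hy y1)]
  rw [this]; exact Subgroup.mem_zpowers y

theorem conj_ind2 {S : TSetup G T} {v : VV S} {x y : G} (hx : x ∈ v.sg) (hy : y ∈ v.sg) (x1 : x ≠ 1)
    (y1 : y ≠ 1) (hyx : x ∉ Subgroup.zpowers y) : ∃ g : G, g • v = v ∧ g * x * g⁻¹ = y := by
  obtain ⟨g, hg, e⟩ := conj_ind hx hy y1 hyx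
  obtain ⟨h, hh, e'⟩ := conj_ind hy hx x1 (fun h => hyx (zp_swap hy y1 hx h))
  refine ⟨h⁻¹ * g, ?_, ?_⟩
  · rw [mul_smul, hg, inv_smul_eq_iff, hh]
  · have : h⁻¹ * g * x * (h⁻¹ * g)⁻¹ = h⁻¹ * (g * x * g⁻¹) * h := by group
    rw [this, e, VV_comm v hy hx, ← e']; group

theorem exists_indep {S : TSetup G T} (v : VV S) {x : G} (hx : x ∈ v.sg) (x1 : x ≠ 1) :
    ∃ t ∈ v.sg, t ∉ Subgroup.zpowers x := by
  by_contra hh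
  push Not at hh
  have := Subgroup.card_le_of_le (show v.sg ≤ Subgroup.zpowers x from hh)
  rw [v.isE.1, Nat.card_zpowers, T_ord S (VV_T v hx x1)] at this
  omega

theorem conj_in {S : TSetup G T} {v : VV S} {x y : G} (hx : x ∈ v.sg) (hy : y ∈ v.sg) (x1 : x ≠ 1)
    (y1 : y ≠ 1) : ∃ g : G, g • v = v ∧ g * x * g⁻¹ = y := by
  by_cases hyx : x ∈ Subgroup.zpowers y
  · obtain ⟨t, ht, htx⟩ := exists_indep v hy y1
    have t1 : t ≠ 1 := by rintro rfl; exact htx (Subgroup.one_mem _)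
    obtain ⟨g, hg, e⟩ := conj_ind2 hx ht x1 t1
      (fun h => htx (Subgroup.zpowers_le.2 hyx (zp_swap hx x1 ht h)))
    obtain ⟨h, hh, e'⟩ := conj_ind2 ht hy t1 y1 htx
    refine ⟨h * g, by rw [mul_smul, hg, hh], ?_⟩
    have : h * g * x * (h * g)⁻¹ = h * (g * x * g⁻¹) * h⁻¹ := by group
    rw [this, e, e']
  · exact conj_ind2 hx hy x1 y1 hyx

theorem T_conj (S : TSetup G T) {x y : G} (hx : x ∈ T) (hy : y ∈ T) : ∃ g : G, g * x * g⁻¹ = y := by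
  obtain ⟨P, hP⟩ := S.syl x hx
  obtain ⟨Q, hQ⟩ := S.syl y hy
  have hyQ : y ∈ Q := (hQ y).2 ⟨rfl, 1, by rw [pow_one]; exact S.pow y hy⟩
  have hyZ : y ∈ ZZ (Q : Subgroup G) := mem_ZZ.2 ⟨hyQ, fun t ht => ((hQ t).1 ht).1⟩
  have hxP : x ∈ P := (hP x).2 ⟨rfl, 1, by rw [pow_one]; exact S.pow x hx⟩
  have hxZ : x ∈ ZZ (P : Subgroup G) := mem_ZZ.2 ⟨hxP, fun t ht => ((hP t).1 ht).1⟩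
  obtain ⟨g, rfl⟩ := MulAction.exists_smul_eq G P Q
  have hgx : g * x * g⁻¹ ∈ ZZ ((g • P : Sylow 29 G) : Subgroup G) := by
    rw [mem_ZZ]
    have hm : ∀ t, t ∈ ((g • P : Sylow 29 G) : Subgroup G) ↔ g⁻¹ * t * g ∈ P := by
      intro t
      rw [Sylow.coe_subgroup_smul, Subgroup.mem_pointwise_smul_iff_inv_smul_mem]
      simp [MulAut.smul_def, MulAut.inv_def, MulAut.conj_symm_apply]
      exact Iff.rfl
    refine ⟨(hm _).2 (by simpa [mul_assoc] using hxP), fun t ht => ?_⟩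
    have h2 := (mem_ZZ.1 hxZ).2 _ ((hm t).1 ht)
    have : t * (g * x * g⁻¹) = g * ((g⁻¹ * t * g) * x) * g⁻¹ := by group
    rw [this, h2]; group
  obtain ⟨E1, E2, -, hE, -, -, -, hZ, -⟩ := S.two (g • P)
  obtain ⟨h, -, e⟩ := conj_in (S := S) (v := ⟨E1, hE⟩) (hZ hgx) (hZ hyZ)
    (by rw [Ne, conj_eq_one_iff]; exact S.ne_one x hx) (S.ne_one y hy)
  refine ⟨h * g, ?_⟩
  rw [← e]; group
end
end

section
section
variable {G : Type*} [Group G] [Finite G] {T : Set G}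

theorem T_nonempty (S : TSetup G T) : ∃ z, z ∈ T := by
  obtain ⟨P⟩ : Nonempty (Sylow 29 G) := inferInstance
  have h : Nat.card (ZZ (P : Subgroup G)) = 29 := (S.zz P).1
  have : Nontrivial (ZZ (P : Subgroup G)) := by
    rw [← Finite.one_lt_card_iff_nontrivial, h]; norm_num
  obtain ⟨x, hx, hx1⟩ := Subgroup.exists_ne_one_of_nontrivial (ZZ (P : Subgroup G))
  exact ⟨x, S.zzT P x hx hx1⟩

theorem T_card_mul (S : TSetup G T) {z : G} (hz : z ∈ T) :
    Nat.card (Subgroup.centralizer {z}) * T.ncard = Nat.card G := by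
  have h1 : MulAction.orbit (ConjAct G) z = T := by
    ext x
    rw [ConjAct.orbit_eq_carrier_conjClasses, ConjClasses.mem_carrier_iff_mk_eq, ConjClasses.mk_eq_mk_iff_isConj,
      isConj_comm, isConj_iff]
    constructor
    · rintro ⟨g, rfl⟩; exact S.conj z hz g
    · intro hx; exact T_conj S hz hx
  have h2 := MulAction.index_stabilizer (ConjAct G) z
  rw [h1] at h2
  have h3 := Subgroup.card_mul_index (MulAction.stabilizer (ConjAct G) z)
  rw [h2, ← Subgroup.nat_card_centralizer_nat_card_stabilizer] at h3
  rw [h3]; rfl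

theorem T_28 (S : TSetup G T) : T.ncard = Nat.card (Sylow 29 G) * 28 := by
  classical
  have : Fintype G := Fintype.ofFinite G
  have : Fintype (Sylow 29 G) := Fintype.ofFinite _
  obtain ⟨z0, hz0⟩ := T_nonempty S
  obtain ⟨P0, -⟩ := S.syl z0 hz0
  choose! f hf using S.syl
  have hc := Finset.card_eq_sum_card_fiberwise (s := T.toFinset) (t := Finset.univ) (f := f) (by simp [Set.MapsTo])
  rw [Set.ncard_eq_toFinset_card', hc, Nat.card_eq_fintype_card, ← Finset.card_univ]
  apply Finset.sum_const_nat
  intro P _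
  have e : T.toFinset.filter (fun x => f x = P) = ((ZZ (P : Subgroup G) : Set G) \ {1}).toFinset := by
    ext z
    rw [Finset.mem_filter, Set.mem_toFinset, Set.mem_toFinset]
    constructor
    · rintro ⟨hz, rfl⟩
      refine ⟨mem_ZZ.2 ⟨(hf z hz z).2 ⟨rfl, 1, by rw [pow_one]; exact S.pow z hz⟩, fun t ht => ((hf z hz t).1 ht).1⟩,
        S.ne_one z hz⟩
    · rintro ⟨hz, hz1⟩
      have hzT := S.zzT P z hz hz1
      refine ⟨hzT, ?_⟩
      symm
      apply Sylow.ext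
      apply Subgroup.eq_of_le_of_card_ge
      · intro x hx
        exact (hf z hzT x).2 ⟨(mem_ZZ.1 hz).2 x hx, 3, pow_of_card (k := 3) (card_syl29 S.card P) hx⟩
      · exact le_of_eq ((card_syl29 S.card _).trans (card_syl29 S.card P).symm)
  rw [e, ← Set.ncard_eq_toFinset_card', Set.ncard_sdiff_singleton_of_mem (by exact Subgroup.one_mem (ZZ (P : Subgroup G)))]
  change Nat.card (ZZ (P : Subgroup G)) - 1 = 28
  rw [(S.zz P).1]

theorem T_card (S : TSetup G T) : T.ncard = 731640 := by
  obtain ⟨z, hz⟩ := T_nonempty S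
  have h1 := T_card_mul S hz
  have h2 := T_28 S
  have h3 := card_sylow_modEq_one 29 G
  rw [S.card] at h1
  unfold Nat.ModEq at h3
  rcases S.cent z hz with h | h <;> rw [h] at h1 <;> omega

theorem cent_card (S : TSetup G T) {z : G} (hz : z ∈ T) : Nat.card (Subgroup.centralizer {z}) = 682892 := by
  have h1 := T_card_mul S hz
  rw [T_card S, S.card] at h1
  omega

theorem V_card (S : TSetup G T) : Nat.card (VV S) = 1742 := by
  classical
  have : Fintype G := Fintype.ofFinite G
  have : Fintype (VV S) := Fintype.ofFinite _
  have hc := Finset.sum_card_bipartiteAbove_eq_sum_card_bipartiteBelow (s := (Finset.univ : Finset (VV S)))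
    (t := T.toFinset) (fun v z => z ∈ v.sg)
  have h1 : ∑ v : VV S, (Finset.bipartiteAbove (fun (v : VV S) z => z ∈ v.sg) T.toFinset v).card = Nat.card (VV S) * 840 := by
    rw [Nat.card_eq_fintype_card, ← Finset.card_univ]
    apply Finset.sum_const_nat
    intro v _
    have e : Finset.bipartiteAbove (fun (v : VV S) z => z ∈ v.sg) T.toFinset v = ((v.sg : Set G) \ {1}).toFinset := by
      ext z
      rw [Finset.mem_bipartiteAbove, Set.mem_toFinset, Set.mem_toFinset]
      exact ⟨fun h => ⟨h.2, S.ne_one z h.1⟩, fun h => ⟨VV_T v h.1 h.2, h.1⟩⟩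
    rw [e, ← Set.ncard_eq_toFinset_card', Set.ncard_sdiff_singleton_of_mem (by exact v.sg.one_mem)]
    change Nat.card v.sg - 1 = 840
    rw [v.isE.1]
  have h2 : ∑ z ∈ T.toFinset, (Finset.bipartiteBelow (fun (v : VV S) z => z ∈ v.sg) Finset.univ z).card = T.ncard * 2 := by
    rw [Set.ncard_eq_toFinset_card']
    apply Finset.sum_const_nat
    intro z hz
    rw [Set.mem_toFinset] at hz
    obtain ⟨a, b, hab, ha, hb, h, -⟩ := two_of S hz
    rw [Finset.card_eq_two]
    refine ⟨a, b, hab, ?_⟩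
    ext v
    rw [Finset.mem_bipartiteBelow]
    simp only [Finset.mem_univ, true_and, Finset.mem_insert, Finset.mem_singleton]
    refine ⟨h v, ?_⟩
    rintro (rfl | rfl) <;> assumption
  rw [h1, h2, T_card S] at hc
  omega

theorem deg_card {S : TSetup G T} (v : VV S) : {w : VV S | Ad v w}.ncard = 30 := by
  classical
  have : Fintype G := Fintype.ofFinite G
  have : Fintype (VV S) := Fintype.ofFinite _
  have hc := Finset.sum_card_bipartiteAbove_eq_sum_card_bipartiteBelow (s := {w : VV S | Ad v w}.toFinset)
    (t := ((v.sg : Set G) \ {1}).toFinset) (fun w z => z ∈ w.sg)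
  have h1 : ∑ w ∈ {w : VV S | Ad v w}.toFinset, (Finset.bipartiteAbove (fun (w : VV S) z => z ∈ w.sg)
      ((v.sg : Set G) \ {1}).toFinset w).card = {w : VV S | Ad v w}.ncard * 28 := by
    rw [Set.ncard_eq_toFinset_card']
    apply Finset.sum_const_nat
    intro w hw
    rw [Set.mem_toFinset] at hw
    obtain ⟨hne, z, z1, zv, zw⟩ := hw
    have e : Finset.bipartiteAbove (fun (v : VV S) z => z ∈ v.sg) ((v.sg : Set G) \ {1}).toFinset w =
        ((Subgroup.zpowers z : Set G) \ {1}).toFinset := by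
      ext x
      rw [Finset.mem_bipartiteAbove, Set.mem_toFinset, Set.mem_toFinset]
      exact ⟨fun h => ⟨Ad_inter hne z1 zv zw h.1.1 h.2, h.1.2⟩,
        fun h => ⟨⟨Subgroup.zpowers_le.2 zv h.1, h.2⟩, Subgroup.zpowers_le.2 zw h.1⟩⟩
    rw [e, ← Set.ncard_eq_toFinset_card', Set.ncard_sdiff_singleton_of_mem (by exact Subgroup.one_mem (Subgroup.zpowers z))]
    change Nat.card (Subgroup.zpowers z) - 1 = 28
    rw [Nat.card_zpowers, T_ord S (VV_T v zv z1)]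
  have h2 : ∑ z ∈ ((v.sg : Set G) \ {1}).toFinset, (Finset.bipartiteBelow (fun (w : VV S) z => z ∈ w.sg)
      {w : VV S | Ad v w}.toFinset z).card = 840 * 1 := by
    have : ((v.sg : Set G) \ {1}).toFinset.card = 840 := by
      rw [← Set.ncard_eq_toFinset_card', Set.ncard_sdiff_singleton_of_mem (by exact v.sg.one_mem)]
      change Nat.card v.sg - 1 = 840
      rw [v.isE.1]
    rw [← this]
    apply Finset.sum_const_nat
    intro z hz
    rw [Set.mem_toFinset] at hz
    obtain ⟨w, hw, hzw⟩ := exists_other hz.2 hz.1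
    rw [Finset.card_eq_one]
    refine ⟨w, ?_⟩
    ext u
    rw [Finset.mem_bipartiteBelow, Set.mem_toFinset, Finset.mem_singleton]
    constructor
    · rintro ⟨h, hz'⟩
      exact third hz.2 hz.1 hz' hzw h.1 hw.1
    · rintro rfl; exact ⟨hw, hzw⟩
  rw [h1, h2] at hc
  omega
end
end

section
section
variable {G : Type*} [Group G] [Finite G] {T : Set G} {S : TSetup G T}

def D1 (e : VV S) : Set (VV S) := {w | Ad e w}
def D2 (e : VV S) : Set (VV S) := {u | u ≠ e ∧ ∃ w, Ad e w ∧ Ad w u}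
def XX (e : VV S) : Set (VV S) := {x | x ≠ e ∧ x ∉ D1 e ∧ x ∉ D2 e}

theorem D2_not_D1 {e u : VV S} (h : u ∈ D2 e) : u ∉ D1 e := by
  obtain ⟨h1, w, h2, h3⟩ := h
  exact fun h4 => no_tri h2 h3 h4

theorem D1_card (e : VV S) : (D1 e).ncard = 30 := deg_card e

theorem nbr_inter_card {e w : VV S} (h : Ad e w) : ({u : VV S | Ad w u} \ {e}).ncard = 29 := by
  rw [Set.ncard_sdiff_singleton_of_mem (by exact h.symm), deg_card]

theorem D2_card (e : VV S) : (D2 e).ncard = 870 := by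
  classical
  have : Fintype (VV S) := Fintype.ofFinite _
  have hc := Finset.sum_card_bipartiteAbove_eq_sum_card_bipartiteBelow (s := (D1 e).toFinset)
    (t := (D2 e).toFinset) (fun w u => Ad w u)
  have h1 : ∑ w ∈ (D1 e).toFinset, (Finset.bipartiteAbove (fun w u => Ad w u) (D2 e).toFinset w).card
      = (D1 e).ncard * 29 := by
    rw [Set.ncard_eq_toFinset_card']
    apply Finset.sum_const_nat
    intro w hw
    rw [Set.mem_toFinset] at hw
    rw [← nbr_inter_card hw, Set.ncard_eq_toFinset_card']
    congr 1
    ext u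
    rw [Finset.mem_bipartiteAbove, Set.mem_toFinset, Set.mem_toFinset]
    exact ⟨fun h => ⟨h.2, h.1.1⟩, fun h => ⟨⟨h.2, w, hw, h.1⟩, h.1⟩⟩
  have h2 : ∑ u ∈ (D2 e).toFinset, (Finset.bipartiteBelow (fun w u => Ad w u) (D1 e).toFinset u).card
      = (D2 e).ncard * 1 := by
    rw [Set.ncard_eq_toFinset_card']
    apply Finset.sum_const_nat
    intro u hu
    rw [Set.mem_toFinset] at hu
    obtain ⟨h1, w, h2, h3⟩ := hu
    rw [Finset.card_eq_one]
    refine ⟨w, ?_⟩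
    ext w'
    rw [Finset.mem_bipartiteBelow, Set.mem_toFinset, Finset.mem_singleton]
    constructor
    · rintro ⟨h, h'⟩; exact uniq_par h h' h2 h3 h1
    · rintro rfl; exact ⟨h2, h3⟩
  rw [h1, h2, D1_card] at hc
  omega

theorem XX_card (e : VV S) : (XX e).ncard = 841 := by
  have h : XX e = (insert e (D1 e ∪ D2 e))ᶜ := by
    ext x
    simp only [XX, Set.mem_ofPred_eq, Set.mem_compl_iff, Set.mem_insert_iff, Set.mem_union, not_or]
  have h1 : (D1 e ∪ D2 e).ncard = 900 := by
    rw [Set.ncard_union_eq, D1_card, D2_card]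
    rw [Set.disjoint_left]
    intro u h1 h2
    exact D2_not_D1 h2 h1
  have h2 : (insert e (D1 e ∪ D2 e)).ncard = 901 := by
    rw [Set.ncard_insert_of_notMem, h1]
    rintro (h | h)
    · exact h.1 rfl
    · exact h.1 rfl
  rw [h, Set.ncard_compl, h2, V_card S]

theorem D2_smul {e u : VV S} {g : G} (hg : g • e = e) (h : u ∈ D2 e) : g • u ∈ D2 e := by
  obtain ⟨h1, w, h2, h3⟩ := h
  refine ⟨fun h => h1 (smul_left_cancel g (h.trans hg.symm)), g • w, ?_, h3.smul g⟩
  have := h2.smul g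
  rwa [hg] at this

theorem D1_smul {e u : VV S} {g : G} (hg : g • e = e) (h : u ∈ D1 e) : g • u ∈ D1 e := by
  have := Ad.smul h g
  rwa [hg] at this

theorem XX_smul {e u : VV S} {g : G} (hg : g • e = e) (h : u ∈ XX e) : g • u ∈ XX e := by
  have hg' : g⁻¹ • e = e := by rw [inv_smul_eq_iff, hg]
  obtain ⟨h1, h2, h3⟩ := h
  refine ⟨fun h => h1 (smul_left_cancel g (h.trans hg.symm)), fun h => h2 ?_, fun h => h3 ?_⟩
  · have := D1_smul hg' h
    rwa [inv_smul_smul] at this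
  · have := D2_smul hg' h
    rwa [inv_smul_smul] at this

theorem XX_free {e o : VV S} (ho : o ∈ XX e) {g : G} (hg : g ∈ e.sg) (h : g • o = o) : g = 1 := by
  by_contra h1
  obtain ⟨a, b, c⟩ := ho
  rcases fix_near hg h1 h with h | h | h
  · exact a h
  · exact b h
  · exact c ⟨a, h⟩

theorem XX_trans {e o x : VV S} (ho : o ∈ XX e) (hx : x ∈ XX e) : ∃ g ∈ e.sg, g • o = x := by
  have hb : Function.Bijective (fun g : e.sg => (⟨g.1 • o, XX_smul (smul_self g.2) ho⟩ : XX e)) := by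
    rw [Nat.bijective_iff_injective_and_card]
    constructor
    · intro g h hgh
      have h1 : g.1 • o = h.1 • o := congrArg Subtype.val hgh
      have h2 : (h.1⁻¹ * g.1) • o = o := by rw [mul_smul, h1, inv_smul_smul]
      have := XX_free ho (e.sg.mul_mem (e.sg.inv_mem h.2) g.2) h2
      apply Subtype.ext
      exact (inv_mul_eq_one.1 this).symm
    · rw [e.isE.1]
      exact (XX_card e).symm
  obtain ⟨g, hg⟩ := hb.2 ⟨x, hx⟩
  exact ⟨g.1, g.2, congrArg Subtype.val hg⟩

theorem D1_trans {e w w' : VV S} (h : Ad e w) (h' : Ad e w') : ∃ g : G, g • e = e ∧ g • w = w' := by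
  obtain ⟨_, z, z1, ze, zw⟩ := id h
  obtain ⟨_, z', z1', ze', zw'⟩ := id h'
  obtain ⟨g, hg, hz⟩ := conj_in ze ze' z1 z1'
  refine ⟨g, hg, ?_⟩
  have := h.smul g
  rw [hg] at this
  exact third z1' ze' (hz ▸ conj_mem_smul zw) zw' this.1 h'.1

theorem D2_trans {e u u' : VV S} (h : u ∈ D2 e) (h' : u' ∈ D2 e) : ∃ g : G, g • e = e ∧ g • u = u' := by
  obtain ⟨h1, w, h2, h3⟩ := h
  obtain ⟨h1', w', h2', h3'⟩ := h'
  obtain ⟨g, hg, rfl⟩ := D1_trans h2 h2'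
  have hu : g • u ≠ e := fun h => h1 (smul_left_cancel g (h.trans hg.symm))
  obtain ⟨k, hk, e'⟩ := trans_nbr h2' (h3.smul g) hu h3' h1'
  exact ⟨k * g, by rw [mul_smul, hg, smul_self hk], by rw [mul_smul, e']⟩

theorem D2_nbrs {e F L M M' : VV S} (hF : Ad e F) (hFL : Ad F L) (hL : L ≠ e) (hM : Ad L M) (hMD : M ∈ D2 e)
    (hM' : Ad L M') (hne : M' ≠ F) : M' ∈ D2 e := by
  have hMF : M ≠ F := by
    rintro rfl
    exact D2_not_D1 hMD hF
  obtain ⟨g, hg, rfl⟩ := trans_nbr hFL hM hMF hM' hne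
  obtain ⟨_, z, z1, ze, zF⟩ := id hF
  obtain ⟨_, y, y1, yF, yL⟩ := id hFL
  have hyz : y ∉ Subgroup.zpowers z := by
    intro h
    exact hL (third y1 yF yL (Subgroup.zpowers_le.2 ze h) hFL.1 hF.1.symm)
  obtain ⟨p, rfl⟩ := ww_surj zF yF z1 hyz hg
  have h1 : y ^ p.2.val • M = M := smul_nbr hM (L.sg.pow_mem yL _)
  rw [ww, mul_smul, h1]
  exact D2_smul (smul_self (e.sg.pow_mem ze _)) hMD

theorem XX_nonempty (e : VV S) : ∃ x, x ∈ XX e := by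
  by_contra h
  have : XX e = ∅ := Set.eq_empty_iff_forall_notMem.2 (fun x hx => h ⟨x, hx⟩)
  have h2 := XX_card e
  rw [this] at h2
  simp at h2

theorem D2_no_edge {e L M : VV S} (hL : L ∈ D2 e) (hM : M ∈ D2 e) (h : Ad L M) : False := by
  have stepc : ∀ L' ∈ D2 e, ∀ M', Ad L' M' → M' ∈ D1 e ∨ M' ∈ D2 e := by
    intro L' hL' M' hM'
    obtain ⟨g, hg, rfl⟩ := D2_trans hL hL'
    obtain ⟨h1, w, h2, h3⟩ := hL'
    by_cases hw : M' = w
    · rw [hw]; exact Or.inl h2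
    · exact Or.inr (D2_nbrs h2 h3 h1 (h.smul g) (D2_smul hg hM) hM' hw)
  have stepx : ∀ x ∈ XX e, ∀ y, Ad x y → y ∈ XX e := by
    intro x hx y hxy
    obtain ⟨h1, h2, h3⟩ := hx
    refine ⟨?_, ?_, ?_⟩
    · rintro rfl; exact h2 hxy.symm
    · intro hy; exact h3 ⟨h1, y, hy, hxy.symm⟩
    · intro hy
      rcases stepc y hy x hxy.symm with h | h
      · exact h2 h
      · exact h3 h
  obtain ⟨x, hx⟩ := XX_nonempty e
  have : D2 x ⊆ XX e := by
    rintro u ⟨-, w, hw, hwu⟩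
    exact stepx w (stepx x hx w hw) u hwu
  have := Set.ncard_le_ncard this
  rw [D2_card, XX_card] at this
  omega

theorem X_nbr {e x y : VV S} (hx : x ∈ XX e) (hxy : Ad x y) : y ∈ D2 e := by
  classical
  have : Fintype (VV S) := Fintype.ofFinite _
  have hc := Finset.sum_card_bipartiteAbove_eq_sum_card_bipartiteBelow (s := (D2 e).toFinset)
    (t := (XX e).toFinset) (fun w u => Ad w u)
  have h1 : ∑ w ∈ (D2 e).toFinset, (Finset.bipartiteAbove (fun w u => Ad w u) (XX e).toFinset w).card
      = (D2 e).ncard * 29 := by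
    rw [Set.ncard_eq_toFinset_card']
    apply Finset.sum_const_nat
    intro L hL
    rw [Set.mem_toFinset] at hL
    obtain ⟨a, w, b, c⟩ := id hL
    rw [← nbr_inter_card c, Set.ncard_eq_toFinset_card']
    congr 1
    ext u
    rw [Finset.mem_bipartiteAbove, Set.mem_toFinset, Set.mem_toFinset]
    constructor
    · rintro ⟨⟨h1, h2, h3⟩, h4⟩
      refine ⟨h4, ?_⟩
      rintro rfl
      exact h2 b
    · rintro ⟨h1, h2⟩
      refine ⟨⟨?_, ?_, ?_⟩, h1⟩
      · rintro rfl
        exact D2_not_D1 hL h1.symm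
      · intro h
        exact h2 (uniq_par h (Ad.symm h1) b c a)
      · intro h; exact D2_no_edge hL h h1
  have hsub : ∀ u, Finset.bipartiteBelow (fun w u => Ad w u) (D2 e).toFinset u ⊆ {w : VV S | Ad u w}.toFinset := by
    intro u w hw
    rw [Finset.mem_bipartiteBelow, Set.mem_toFinset] at hw
    rw [Set.mem_toFinset]
    exact hw.2.symm
  have hle : ∀ u ∈ (XX e).toFinset, (Finset.bipartiteBelow (fun w u => Ad w u) (D2 e).toFinset u).card ≤ 30 := by
    intro u _
    refine (Finset.card_le_card (hsub u)).trans ?_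
    rw [← Set.ncard_eq_toFinset_card', deg_card]
  rw [h1, D2_card] at hc
  have h2 : ∑ u ∈ (XX e).toFinset, 30 = 870 * 29 := by
    rw [Finset.sum_const, ← Set.ncard_eq_toFinset_card', XX_card]; rfl
  have h3 := (Finset.sum_eq_sum_iff_of_le hle).1 (hc.symm.trans h2.symm) x (by rw [Set.mem_toFinset]; exact hx)
  have h4 := Finset.eq_of_subset_of_card_le (hsub x) (by
    rw [h3, ← Set.ncard_eq_toFinset_card', deg_card])
  have h5 : y ∈ {w : VV S | Ad x w}.toFinset := by rw [Set.mem_toFinset]; exact hxy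
  rw [← h4, Finset.mem_bipartiteBelow, Set.mem_toFinset] at h5
  exact h5.1
end
end

section
section
variable {G : Type*} [Group G] [Finite G] {T : Set G} {S : TSetup G T}

/-- lines (with respect to the base line `e`) -/
def Ln (e v : VV S) : Prop := v = e ∨ v ∈ D2 e

theorem not_Ln_iff {e v : VV S} : ¬ Ln e v ↔ v ∈ D1 e ∨ v ∈ XX e := by
  constructor
  · intro h
    by_cases h1 : v ∈ D1 e
    · exact Or.inl h1
    · exact Or.inr ⟨fun h' => h (Or.inl h'), h1, fun h' => h (Or.inr h')⟩
  · rintro (h | h) (h' | h')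
    · exact h.1 h'.symm
    · exact D2_not_D1 h' h
    · exact h.1 h'
    · exact h.2.2 h'

theorem Ad_Ln {e v w : VV S} (h : Ad v w) : Ln e v ↔ ¬ Ln e w := by
  have key : ∀ v w : VV S, Ad v w → Ln e v → ¬ Ln e w := by
    rintro v w h (rfl | h1) (rfl | h2)
    · exact h.1 rfl
    · exact D2_not_D1 h2 h
    · exact D2_not_D1 h1 h.symm
    · exact D2_no_edge h1 h2 h
  refine ⟨key v w h, fun h2 => ?_⟩
  rcases not_Ln_iff.1 h2 with h2 | h2
  · by_cases hv : v = e
    · exact Or.inl hv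
    · exact Or.inr ⟨hv, w, h2, h.symm⟩
  · exact Or.inr (X_nbr h2 h.symm)

open Classical in
noncomputable def col (e v : VV S) : ℤˣ := if Ln e v then 1 else -1

theorem col_Ad {e v w : VV S} (h : Ad v w) : col e w = - col e v := by
  unfold col
  by_cases h1 : Ln e w
  · have : ¬ Ln e v := fun h2 => (Ad_Ln h).1 h2 h1
    rw [if_pos h1, if_neg this, neg_neg]
  · have : Ln e v := (Ad_Ln h).2 h1
    rw [if_neg h1, if_pos this]

theorem exists_nbr (v : VV S) : ∃ w, Ad v w := by
  by_contra h
  have : {w : VV S | Ad v w} = ∅ := Set.eq_empty_iff_forall_notMem.2 (fun x hx => h ⟨x, hx⟩)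
  have h2 := deg_card v
  rw [this] at h2
  simp at h2

theorem col_smul (e v : VV S) (g : G) : col e (g • v) = col e (g • e) * col e v := by
  have step : ∀ v w : VV S, Ad v w → col e (g • v) = col e (g • e) * col e v →
      col e (g • w) = col e (g • e) * col e w := by
    intro v w h h'
    rw [col_Ad (h.smul g), h', col_Ad h, mul_neg]
  have h0 : col e (g • e) = col e (g • e) * col e e := by
    have : col e e = 1 := if_pos (Or.inl rfl)
    rw [this, mul_one]
  have h2 : ∀ v ∈ D2 e, col e (g • v) = col e (g • e) * col e v := by
    rintro v ⟨-, w, h1, h2⟩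
    exact step _ _ h2 (step _ _ h1 h0)
  by_cases hL : Ln e v
  · rcases hL with rfl | h
    · exact h0
    · exact h2 v h
  · rcases not_Ln_iff.1 hL with h | h
    · exact step _ _ h h0
    · obtain ⟨w, hw⟩ := exists_nbr v
      exact step _ _ hw.symm (h2 w (X_nbr h hw))

noncomputable def colHom (e : VV S) : G →* ℤˣ where
  toFun g := col e (g • e)
  map_one' := by
    rw [one_smul]
    exact if_pos (Or.inl rfl)
  map_mul' g h := by
    rw [mul_smul, col_smul]

theorem Ln_smul {H N : Subgroup G} (C : CohSetup H N) (e v : VV S) (g : G) : Ln e (g • v) ↔ Ln e v := by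
  have hk : (colHom e).ker = ⊤ := by
    apply C.perf _ inferInstance
    intro h hh
    have h1 : h ^ 871 = 1 := by
      rw [← C.cardH]
      have := pow_card_eq_one' (x := (⟨h, hh⟩ : H))
      exact congrArg Subtype.val this
    have h2 : (colHom e h) ^ 871 = 1 := by rw [← map_pow, h1, map_one]
    rw [MonoidHom.mem_ker]
    rcases Int.units_eq_one_or (colHom e h) with h3 | h3
    · exact h3
    · rw [h3] at h2
      have h4 : ((-1 : ℤˣ)) ^ 871 = -1 := Odd.neg_one_pow (by decide)
      rw [h4] at h2
      exact absurd h2 (by decide)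
  have hg : col e (g • e) = 1 := by
    have : g ∈ (colHom e).ker := by rw [hk]; trivial
    exact this
  have := col_smul e v g
  rw [hg, one_mul] at this
  unfold col at this
  by_cases h1 : Ln e (g • v) <;> by_cases h2 : Ln e v <;> simp only [h1, h2, if_true, if_false] at this ⊢
  · exact absurd this (by decide)
  · exact absurd this (by decide)

theorem common_nbr {e x F : VV S} (hx : x ∈ XX e) (hF : Ad e F) : ∃ L, Ad F L ∧ Ad L x := by
  have h : ∀ L ∈ {L : VV S | Ad x L}, ∃ w, Ad e w ∧ Ad w L := fun L hL => (X_nbr hx hL).2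
  choose! f hf using h
  have hsub : Set.image f {L : VV S | Ad x L} ⊆ D1 e := by
    rintro _ ⟨L, hL, rfl⟩
    exact (hf L hL).1
  have hinj : Set.InjOn f {L : VV S | Ad x L} := by
    intro L hL L' hL' hh
    have h1 := (hf L hL).2
    have h2 := (hf L' hL').2
    rw [← hh] at h2
    refine uniq_par (e := x) (u := f L) hL h1.symm hL' h2.symm ?_
    intro h3
    exact hx.2.1 (h3 ▸ (hf L hL).1)
  have he := Set.eq_of_subset_of_ncard_le hsub (by
    rw [hinj.ncard_image, deg_card, D1_card])
  have : F ∈ Set.image f {L : VV S | Ad x L} := by rw [he]; exact hF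
  obtain ⟨L, hL, rfl⟩ := this
  exact ⟨L, (hf L hL).2, Ad.symm hL⟩

/-- A coordinate frame -/
structure Frame (S : TSetup G T) where
  e : VV S
  o : VV S
  a : G
  b : G
  ho : o ∈ XX e
  ha : a ∈ e.sg
  hb : b ∈ e.sg
  a1 : a ≠ 1
  hba : b ∉ Subgroup.zpowers a
  lns : ∀ (g : G) (v : VV S), Ln e (g • v) ↔ Ln e v

theorem exists_frame {H N : Subgroup G} (C : CohSetup H N) (S : TSetup G T) : Nonempty (Frame S) := by
  obtain ⟨z, hz⟩ := T_nonempty S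
  obtain ⟨e, -, -, he, -⟩ := two_of S hz
  obtain ⟨o, ho⟩ := XX_nonempty e
  obtain ⟨b, hb, hba⟩ := exists_indep e he (S.ne_one z hz)
  exact ⟨⟨e, o, z, b, ho, he, hb, S.ne_one z hz, hba, fun g v => Ln_smul C e v g⟩⟩

open Classical in
/-- the other vertex through an element -/
noncomputable def oth (e : VV S) (z : G) : VV S :=
  if h : z ≠ 1 ∧ z ∈ e.sg then Classical.choose (exists_other h.1 h.2) else e

theorem oth_spec {e : VV S} {z : G} (h1 : z ≠ 1) (h : z ∈ e.sg) : Ad e (oth e z) ∧ z ∈ (oth e z).sg := by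
  unfold oth
  rw [dif_pos ⟨h1, h⟩]
  exact Classical.choose_spec (exists_other h1 h)

theorem oth_eq {e w : VV S} {z : G} (h1 : z ≠ 1) (h : Ad e w) (hz : z ∈ e.sg) (hw : z ∈ w.sg) : oth e z = w :=
  third h1 hz (oth_spec h1 hz).2 hw (oth_spec h1 hz).1.1 h.1

abbrev K29 := ZMod 29

namespace Frame
variable (f : Frame S)

/-- elements of `e` by coordinates -/
def w (p : K29 × K29) : G := ww f.a f.b p

theorem w_mem (p : K29 × K29) : f.w p ∈ f.e.sg := ww_mem f.ha f.hb p
theorem w_add (p q : K29 × K29) : f.w (p + q) = f.w p * f.w q := ww_add f.ha f.hb p q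
theorem w_zero : f.w 0 = 1 := ww_zero _ _
theorem w_inj : Function.Injective f.w := ww_inj f.ha f.hb f.a1 f.hba
theorem w_surj {x : G} (hx : x ∈ f.e.sg) : ∃ p, f.w p = x := ww_surj f.ha f.hb f.a1 f.hba hx

theorem w_ne_one {p : K29 × K29} (h : p ≠ 0) : f.w p ≠ 1 := by
  rw [← f.w_zero]; exact fun h' => h (f.w_inj h')

theorem w_nsmul (n : ℕ) (p : K29 × K29) : f.w (n • p) = f.w p ^ n := by
  induction n with
  | zero => rw [zero_smul, w_zero, pow_zero]
  | succ n ih => rw [succ_nsmul, w_add, ih, pow_succ]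

theorem w_smul (c : K29) (p : K29 × K29) : f.w (c • p) = f.w p ^ c.val := by
  rw [← w_nsmul]
  congr 1
  ext <;> simp

theorem w_zp {p q : K29 × K29} : f.w p ∈ Subgroup.zpowers (f.w q) ↔ ∃ c : K29, p = c • q := by
  constructor
  · intro h
    obtain ⟨n, hn⟩ := mem_zp_nat h
    rw [← w_nsmul] at hn
    refine ⟨n, ?_⟩
    rw [← f.w_inj hn]
    ext <;> simp
  · rintro ⟨c, rfl⟩
    rw [w_smul]
    exact Subgroup.pow_mem _ (Subgroup.mem_zpowers _) _

/-- projective points -/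
noncomputable def pt (v : Fin 3 → K29) : VV S :=
  if v 2 = 0 then oth f.e (f.w (v 0, v 1)) else f.w (v 0 / v 2, v 1 / v 2) • f.o

theorem pt_X {v : Fin 3 → K29} (h : v 2 ≠ 0) : f.pt v = f.w (v 0 / v 2, v 1 / v 2) • f.o := if_neg h

theorem pt_D {v : Fin 3 → K29} (h : v 2 = 0) : f.pt v = oth f.e (f.w (v 0, v 1)) := if_pos h

theorem pt_X_mem {v : Fin 3 → K29} (h : v 2 ≠ 0) : f.pt v ∈ XX f.e := by
  rw [f.pt_X h]
  exact XX_smul (smul_self (f.w_mem _)) f.ho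

theorem pair_ne {v : Fin 3 → K29} (h0 : v ≠ 0) (h : v 2 = 0) : (v 0, v 1) ≠ 0 := by
  intro h'
  apply h0
  have h1 : v 0 = 0 := congrArg Prod.fst h'
  have h2 : v 1 = 0 := congrArg Prod.snd h'
  ext i
  fin_cases i <;> simp [h, h1, h2]

theorem pt_D_spec {v : Fin 3 → K29} (h0 : v ≠ 0) (h : v 2 = 0) :
    Ad f.e (f.pt v) ∧ f.w (v 0, v 1) ∈ (f.pt v).sg := by
  rw [f.pt_D h]
  exact oth_spec (f.w_ne_one (pair_ne h0 h)) (f.w_mem _)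

theorem pt_Ln {v : Fin 3 → K29} (h0 : v ≠ 0) : ¬ Ln f.e (f.pt v) := by
  rw [not_Ln_iff]
  by_cases h : v 2 = 0
  · exact Or.inl (f.pt_D_spec h0 h).1
  · exact Or.inr (f.pt_X_mem h)

theorem pt_smul {v : Fin 3 → K29} (h0 : v ≠ 0) {c : K29} (hc : c ≠ 0) : f.pt (c • v) = f.pt v := by
  by_cases h : v 2 = 0
  · have h' : (c • v) 2 = 0 := by simp [h]
    rw [f.pt_D h']
    apply oth_eq
    · exact f.w_ne_one (pair_ne (smul_ne_zero hc h0) h')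
    · exact (f.pt_D_spec h0 h).1
    · exact f.w_mem _
    · have : ((c • v) 0, (c • v) 1) = c • (v 0, v 1) := by simp
      rw [this, w_smul]
      exact Subgroup.pow_mem _ (f.pt_D_spec h0 h).2 _
  · have h' : (c • v) 2 ≠ 0 := by simp [h, hc]
    rw [f.pt_X h, f.pt_X h']
    simp only [Pi.smul_apply, smul_eq_mul]
    rw [mul_div_mul_left _ _ hc, mul_div_mul_left _ _ hc]

theorem pt_inj {u v : Fin 3 → K29} (hu : u ≠ 0) (hv : v ≠ 0) (h : f.pt u = f.pt v) : ∃ c : K29, c ≠ 0 ∧ u = c • v := by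
  have key : (∃ c : K29, u = c • v) → ∃ c : K29, c ≠ 0 ∧ u = c • v := by
    rintro ⟨c, hc⟩
    refine ⟨c, ?_, hc⟩
    rintro rfl
    rw [zero_smul] at hc
    exact hu hc
  apply key
  by_cases h1 : u 2 = 0 <;> by_cases h2 : v 2 = 0
  · obtain ⟨a1, a2⟩ := f.pt_D_spec hu h1
    obtain ⟨b1, b2⟩ := f.pt_D_spec hv h2
    rw [h] at a2
    have := Ad_inter b1.1 (f.w_ne_one (pair_ne hv h2)) (f.w_mem _) b2 (f.w_mem _) a2
    obtain ⟨c, hc⟩ := f.w_zp.1 this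
    refine ⟨c, ?_⟩
    have e1 : u 0 = c * v 0 := congrArg Prod.fst hc
    have e2 : u 1 = c * v 1 := congrArg Prod.snd hc
    ext i
    fin_cases i <;> simp [h1, h2, e1, e2]
  · exact absurd (f.pt_D_spec hu h1).1 (h ▸ (f.pt_X_mem h2).2.1)
  · exact absurd (f.pt_D_spec hv h2).1 (h ▸ (f.pt_X_mem h1).2.1)
  · rw [f.pt_X h1, f.pt_X h2] at h
    have h3 : ((f.w (v 0 / v 2, v 1 / v 2))⁻¹ * f.w (u 0 / u 2, u 1 / u 2)) • f.o = f.o := by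
      rw [mul_smul, h, inv_smul_smul]
    have h4 := XX_free f.ho (f.e.sg.mul_mem (f.e.sg.inv_mem (f.w_mem _)) (f.w_mem _)) h3
    have h5 := f.w_inj (inv_mul_eq_one.1 h4)
    have e1 : v 0 / v 2 = u 0 / u 2 := congrArg Prod.fst h5
    have e2 : v 1 / v 2 = u 1 / u 2 := congrArg Prod.snd h5
    refine ⟨u 2 / v 2, ?_⟩
    ext i
    fin_cases i
    · simp only [Fin.zero_eta, Pi.smul_apply, smul_eq_mul]; field_simp at e1 ⊢; linear_combination -e1
    · simp only [Fin.mk_one, Pi.smul_apply, smul_eq_mul]; field_simp at e2 ⊢; linear_combination -e2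
    · simp only [Fin.reduceFinMk, Pi.smul_apply, smul_eq_mul]; field_simp

theorem pt_surj {x : VV S} (h : ¬ Ln f.e x) : ∃ v : Fin 3 → K29, v ≠ 0 ∧ f.pt v = x := by
  rcases not_Ln_iff.1 h with h | h
  · obtain ⟨_, z, z1, ze, zx⟩ := id h
    obtain ⟨p, rfl⟩ := f.w_surj ze
    have h0 : (![p.1, p.2, 0] : Fin 3 → K29) ≠ 0 := by
      intro h0
      apply z1
      have h1 := congrFun h0 0
      have h2 := congrFun h0 1
      simp at h1 h2
      have : p = 0 := Prod.ext h1 h2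
      rw [this, w_zero]
    refine ⟨![p.1, p.2, 0], h0, ?_⟩
    rw [f.pt_D (by simp)]
    exact oth_eq (by simpa using z1) h (by simpa using ze) (by simpa using zx)
  · obtain ⟨g, hg, rfl⟩ := XX_trans f.ho h
    obtain ⟨p, rfl⟩ := f.w_surj hg
    refine ⟨![p.1, p.2, 1], ?_, ?_⟩
    · intro h0
      have h1 := congrFun h0 2
      simp at h1
    · rw [f.pt_X (by simp)]
      simp
end Frame
end
end

section
section
variable {G : Type*} [Group G] [Finite G] {T : Set G} {S : TSetup G T}

theorem prop2 {α β x y : K29} (h : (α, β) ≠ 0) : β * x = α * y ↔ ∃ t : K29, (x, y) = t • (α, β) := by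
  constructor
  · intro h'
    by_cases hα : α = 0
    · have hβ : β ≠ 0 := by rintro rfl; exact h (by rw [hα]; rfl)
      refine ⟨y / β, ?_⟩
      rw [hα, zero_mul] at h'
      have := (mul_eq_zero.1 h').resolve_left hβ
      ext
      · simp [this, hα]
      · simp [hβ]
    · refine ⟨x / α, ?_⟩
      ext
      · simp [hα]
      · simp only [Prod.smul_snd, smul_eq_mul]
        field_simp
        linear_combination -h'
  · rintro ⟨t, ht⟩
    have e1 : x = t * α := congrArg Prod.fst ht
    have e2 : y = t * β := congrArg Prod.snd ht
    rw [e1, e2]; ring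

theorem Ad_trans_mem {e F L x : VV S} (hF : Ad e F) (hFL : Ad F L) (hL : L ≠ e) (hx : x ∈ XX e) (hLx : Ad L x) {u : G} (hu : u ∈ e.sg)
    (h : Ad L (u • x)) : u ∈ F.sg := by
  refine stab_nbr hF hFL hL hu ?_
  have h1 : Ad (u • L) (u • x) := hLx.smul u
  have h2 : Ad F (u • L) := by
    have := hFL.smul u
    rwa [smul_nbr hF hu] at this
  refine (uniq_par hFL h h2 h1 ?_).symm
  intro h3
  exact (XX_smul (smul_self hu) hx).2.1 (h3 ▸ hF)

namespace Frame
variable (f : Frame S)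

theorem line_eq {α β : K29} (hab : (α, β) ≠ 0) (p : K29 × K29) {L : VV S} (hL : L ≠ f.e)
    (hFL : Ad (f.pt ![α, β, 0]) L) (hLx : Ad L (f.w p • f.o)) {v : Fin 3 → K29} (hv : v ≠ 0) :
    Ad L (f.pt v) ↔ β * v 0 - α * v 1 + (α * p.2 - β * p.1) * v 2 = 0 := by
  have h0 : (![α, β, 0] : Fin 3 → K29) ≠ 0 := by
    intro h
    have h1 := congrFun h 0
    have h2 := congrFun h 1
    simp at h1 h2
    exact hab (Prod.ext h1 h2)
  have hF := f.pt_D_spec h0 (by simp)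
  have hFw : f.w (α, β) ∈ (f.pt ![α, β, 0]).sg := by simpa using hF.2
  have hxX : f.w p • f.o ∈ XX f.e := XX_smul (smul_self (f.w_mem _)) f.ho
  by_cases h : v 2 = 0
  · rw [h, mul_zero, add_zero, sub_eq_zero, prop2 hab]
    have hs := f.pt_D_spec hv h
    constructor
    · intro hA
      have he : f.pt v = f.pt ![α, β, 0] := uniq_par hs.1 hA.symm hF.1 hFL hL
      rw [he] at hs
      exact f.w_zp.1 (Ad_inter hF.1.1 (f.w_ne_one hab) (f.w_mem _) hFw (f.w_mem _) hs.2)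
    · rintro ⟨t, ht⟩
      have : v = t • ![α, β, 0] := by
        have e1 : v 0 = t * α := congrArg Prod.fst ht
        have e2 : v 1 = t * β := congrArg Prod.snd ht
        ext i
        fin_cases i <;> simp [h, e1, e2]
      have t0 : t ≠ 0 := by
        rintro rfl
        rw [zero_smul] at this
        exact hv this
      rw [this, f.pt_smul h0 t0]
      exact hFL.symm
  · rw [f.pt_X h]
    set q : K29 × K29 := (v 0 / v 2, v 1 / v 2) with hq
    have e0 : f.w q • f.o = f.w (q - p) • (f.w p • f.o) := by
      rw [← mul_smul, ← w_add, sub_add_cancel]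
    have e1 : (β * v 0 - α * v 1 + (α * p.2 - β * p.1) * v 2 = 0) ↔ β * (q - p).1 = α * (q - p).2 := by
      have : β * v 0 - α * v 1 + (α * p.2 - β * p.1) * v 2 = v 2 * (β * (q - p).1 - α * (q - p).2) := by
        simp only [hq, Prod.fst_sub, Prod.snd_sub]
        field_simp
        ring
      rw [this, mul_eq_zero, sub_eq_zero]
      simp [h]
    rw [e0, e1, prop2 hab]
    constructor
    · intro hA
      have := Ad_trans_mem hF.1 hFL hL hxX hLx (f.w_mem _) hA
      exact f.w_zp.1 (Ad_inter hF.1.1 (f.w_ne_one hab) (f.w_mem _) hFw (f.w_mem _) this)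
    · rintro ⟨t, ht⟩
      have hm : f.w (q - p) ∈ (f.pt ![α, β, 0]).sg := by
        rw [show q - p = t • (α, β) from ht, w_smul]
        exact Subgroup.pow_mem _ hFw _
      have := hLx.smul (f.w (q - p))
      rwa [smul_nbr hFL hm] at this

theorem e_eq {v : Fin 3 → K29} (hv : v ≠ 0) : Ad f.e (f.pt v) ↔ v 2 = 0 := by
  constructor
  · intro h
    by_contra h2
    exact (f.pt_X_mem h2).2.1 h
  · intro h; exact (f.pt_D_spec hv h).1

theorem line_cov {L : VV S} (hL : Ln f.e L) :
    ∃ l : Fin 3 → K29, l ≠ 0 ∧ ∀ v : Fin 3 → K29, v ≠ 0 → (Ad L (f.pt v) ↔ v 0 * l 0 + v 1 * l 1 + v 2 * l 2 = 0) := by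
  rcases hL with rfl | hL
  · refine ⟨![0, 0, 1], ?_, fun v hv => ?_⟩
    · intro h
      have := congrFun h 2
      simp at this
    · rw [f.e_eq hv]; simp
  · obtain ⟨hne, F, hF, hFL⟩ := id hL
    obtain ⟨u, hu, hpu⟩ := f.pt_surj (x := F) (not_Ln_iff.2 (Or.inl hF))
    have hu2 : u 2 = 0 := (f.e_eq hu).1 (hpu ▸ hF)
    have hu' : u = ![u 0, u 1, 0] := by
      ext i
      fin_cases i <;> simp [hu2]
    have hab := pair_ne hu hu2
    have : ∃ x, Ad L x ∧ x ≠ F := by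
      by_contra hh
      push Not at hh
      have h1 : {x : VV S | Ad L x} ⊆ {F} := fun x hx => hh x hx
      have h2 := Set.ncard_le_ncard h1
      rw [deg_card, Set.ncard_singleton] at h2
      omega
    obtain ⟨x, hLx, hxF⟩ := this
    have hx : x ∈ XX f.e := by
      rcases not_Ln_iff.1 ((Ad_Ln (e := f.e) hLx).1 (Or.inr hL)) with h | h
      · exact absurd (uniq_par h hLx.symm hF hFL hne) hxF
      · exact h
    obtain ⟨g, hg, rfl⟩ := XX_trans f.ho hx
    obtain ⟨p, rfl⟩ := f.w_surj hg
    refine ⟨![u 1, -u 0, u 0 * p.2 - u 1 * p.1], ?_, fun v hv => ?_⟩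
    · intro h
      have h1 := congrFun h 0
      have h2 := congrFun h 1
      simp at h1 h2
      exact hab (Prod.ext h2 h1)
    · rw [f.line_eq hab p hne (by rw [← hu', hpu]; exact hFL) hLx hv]
      simp only [Matrix.cons_val_zero, Matrix.cons_val_one, Matrix.cons_val]
      constructor <;> intro h <;> linear_combination h

theorem cov_line {l : Fin 3 → K29} (hl : l ≠ 0) :
    ∃ L : VV S, Ln f.e L ∧ ∀ v : Fin 3 → K29, v ≠ 0 → v 0 * l 0 + v 1 * l 1 + v 2 * l 2 = 0 → Ad L (f.pt v) := by
  by_cases hab : (-l 1, l 0) = 0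
  · have e1 : l 1 = 0 := neg_eq_zero.1 (congrArg Prod.fst hab)
    have e0 : l 0 = 0 := congrArg Prod.snd hab
    refine ⟨f.e, Or.inl rfl, fun v hv h => ?_⟩
    rw [f.e_eq hv]
    rw [e0, e1, mul_zero, mul_zero, zero_add, zero_add, mul_eq_zero] at h
    refine h.resolve_right fun h2 => hl ?_
    ext i
    fin_cases i <;> simp [e0, e1, h2]
  · have : ∃ p : K29 × K29, (-l 1) * p.2 - l 0 * p.1 = l 2 := by
      by_cases h1 : l 1 = 0
      · have h0 : l 0 ≠ 0 := by
          intro h0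
          exact hab (by rw [h0, h1]; simp)
        refine ⟨(-l 2 / l 0, 0), ?_⟩
        simp [h1]
        field_simp
      · refine ⟨(0, -l 2 / l 1), ?_⟩
        simp
        field_simp
    obtain ⟨p, hp⟩ := this
    have h0 : (![-l 1, l 0, 0] : Fin 3 → K29) ≠ 0 := by
      intro h
      have h1 := congrFun h 0
      have h2 := congrFun h 1
      exact hab (Prod.ext h1 h2)
    have hF := f.pt_D_spec h0 (by simp)
    obtain ⟨L, hFL, hLx⟩ := common_nbr (XX_smul (smul_self (f.w_mem p)) f.ho) hF.1
    have hne : L ≠ f.e := by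
      rintro rfl
      exact (XX_smul (smul_self (f.w_mem p)) f.ho).2.1 hLx
    refine ⟨L, Or.inr ⟨hne, _, hF.1, hFL⟩, fun v hv h => ?_⟩
    rw [f.line_eq hab p hne hFL hLx hv, hp]
    linear_combination h

/-- collinearity -/
theorem col_iff {u v w : Fin 3 → K29} (hu : u ≠ 0) (hv : v ≠ 0) (hw : w ≠ 0) :
    (∃ L, Ln f.e L ∧ Ad L (f.pt u) ∧ Ad L (f.pt v) ∧ Ad L (f.pt w)) ↔ (Matrix.of ![u, v, w]).det = 0 := by
  rw [← Matrix.exists_mulVec_eq_zero_iff]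
  constructor
  · rintro ⟨L, hL, h1, h2, h3⟩
    obtain ⟨l, hl, h⟩ := f.line_cov hL
    refine ⟨l, hl, ?_⟩
    ext i
    fin_cases i
    · simpa [Matrix.mulVec, dotProduct, Fin.sum_univ_three] using (h u hu).1 h1
    · simpa [Matrix.mulVec, dotProduct, Fin.sum_univ_three] using (h v hv).1 h2
    · simpa [Matrix.mulVec, dotProduct, Fin.sum_univ_three] using (h w hw).1 h3
  · rintro ⟨l, hl, h⟩
    obtain ⟨L, hL, hh⟩ := f.cov_line hl
    refine ⟨L, hL, hh u hu ?_, hh v hv ?_, hh w hw ?_⟩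
    · simpa [Matrix.mulVec, dotProduct, Fin.sum_univ_three] using congrFun h 0
    · simpa [Matrix.mulVec, dotProduct, Fin.sum_univ_three] using congrFun h 1
    · simpa [Matrix.mulVec, dotProduct, Fin.sum_univ_three] using congrFun h 2

theorem col_smul_iff (g : G) {x y z : VV S} : (∃ L, Ln f.e L ∧ Ad L (g • x) ∧ Ad L (g • y) ∧ Ad L (g • z)) ↔
    ∃ L, Ln f.e L ∧ Ad L x ∧ Ad L y ∧ Ad L z := by
  constructor
  · rintro ⟨L, hL, h1, h2, h3⟩
    refine ⟨g⁻¹ • L, (f.lns _ _).2 hL, ?_, ?_, ?_⟩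
    · rwa [← Ad_smul_iff (g := g), smul_inv_smul]
    · rwa [← Ad_smul_iff (g := g), smul_inv_smul]
    · rwa [← Ad_smul_iff (g := g), smul_inv_smul]
  · rintro ⟨L, hL, h1, h2, h3⟩
    exact ⟨g • L, (f.lns _ _).2 hL, h1.smul g, h2.smul g, h3.smul g⟩

/-- the lift of the action to vectors -/
theorem exists_lift (g : G) : ∃ h : (Fin 3 → K29) → (Fin 3 → K29), (∀ v, v ≠ 0 → h v ≠ 0) ∧
    (∀ v, v ≠ 0 → f.pt (h v) = g • f.pt v) ∧
    ∀ u v w, u ≠ 0 → v ≠ 0 → w ≠ 0 → ((Matrix.of ![h u, h v, h w]).det = 0 ↔ (Matrix.of ![u, v, w]).det = 0) := by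
  have : ∀ v : Fin 3 → K29, v ≠ 0 → ∃ v', v' ≠ 0 ∧ f.pt v' = g • f.pt v := by
    intro v hv
    apply f.pt_surj
    rw [f.lns]
    exact f.pt_Ln hv
  choose! h h1 h2 using this
  refine ⟨h, h1, h2, fun u v w hu hv hw => ?_⟩
  rw [← f.col_iff (h1 u hu) (h1 v hv) (h1 w hw), h2 u hu, h2 v hv, h2 w hw, f.col_smul_iff, f.col_iff hu hv hw]
end Frame
end
end

section
section

theorem D_apply (u v w : Fin 3 → K29) : (Matrix.of ![u, v, w]).det =
    u 0 * v 1 * w 2 - u 0 * v 2 * w 1 - u 1 * v 0 * w 2 + u 1 * v 2 * w 0 + u 2 * v 0 * w 1 - u 2 * v 1 * w 0 := by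
  rw [Matrix.det_fin_three]; simp

theorem D_mul (M : Matrix (Fin 3) (Fin 3) K29) (u v w : Fin 3 → K29) :
    (Matrix.of ![M.mulVec u, M.mulVec v, M.mulVec w]).det = (Matrix.of ![u, v, w]).det * M.det := by
  rw [← Matrix.det_transpose M, ← Matrix.det_mul]
  congr 1
  ext i j
  fin_cases i <;>
    simp [Matrix.mulVec, Matrix.mul_apply, dotProduct, mul_comm]

theorem cross_prop {v x : Fin 3 → K29} (hv : v ≠ 0) (hx : x ≠ 0) (h01 : v 0 * x 1 = v 1 * x 0)
    (h02 : v 0 * x 2 = v 2 * x 0) (h12 : v 1 * x 2 = v 2 * x 1) : ∃ c : K29, c ≠ 0 ∧ x = c • v := by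
  have key : (∃ c : K29, x = c • v) → ∃ c : K29, c ≠ 0 ∧ x = c • v := by
    rintro ⟨c, hc⟩
    refine ⟨c, ?_, hc⟩
    rintro rfl
    rw [zero_smul] at hc
    exact hx hc
  apply key
  have : v 0 ≠ 0 ∨ v 1 ≠ 0 ∨ v 2 ≠ 0 := by
    by_contra hh
    push Not at hh
    apply hv
    ext i
    fin_cases i <;> simp [hh]
  rcases this with h | h | h
  · refine ⟨x 0 / v 0, ?_⟩
    ext i
    fin_cases i <;> simp <;> field_simp <;> first | linear_combination h01 | linear_combination h02
  · refine ⟨x 1 / v 1, ?_⟩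
    ext i
    fin_cases i <;> simp <;> field_simp <;> first | linear_combination -h01 | linear_combination h12
  · refine ⟨x 2 / v 2, ?_⟩
    ext i
    fin_cases i <;> simp <;> field_simp <;> first | linear_combination -h02 | linear_combination -h12

theorem FT0 (h : (Fin 3 → K29) → (Fin 3 → K29)) (h0 : ∀ v, v ≠ 0 → h v ≠ 0)
    (hD : ∀ u v w, u ≠ 0 → v ≠ 0 → w ≠ 0 → ((Matrix.of ![h u, h v, h w]).det = 0 ↔ (Matrix.of ![u, v, w]).det = 0))
    {c1 c2 c3 : K29} (n1 : c1 ≠ 0) (n2 : c2 ≠ 0) (n3 : c3 ≠ 0) (e1 : h ![1, 0, 0] = ![c1, 0, 0]) (e2 : h ![0, 1, 0] = ![0, c2, 0])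
    (e3 : h ![0, 0, 1] = ![0, 0, c3]) (e4 : h ![1, 1, 1] = ![1, 1, 1]) {v : Fin 3 → K29} (hv : v ≠ 0) :
    ∃ c : K29, c ≠ 0 ∧ h v = c • v := by
  have z1 : (![1, 0, 0] : Fin 3 → K29) ≠ 0 := fun h => by simpa using congrFun h 0
  have z2 : (![0, 1, 0] : Fin 3 → K29) ≠ 0 := fun h => by simpa using congrFun h 1
  have z3 : (![0, 0, 1] : Fin 3 → K29) ≠ 0 := fun h => by simpa using congrFun h 2
  have z4 : (![1, 1, 1] : Fin 3 → K29) ≠ 0 := fun h => by simpa using congrFun h 2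
  have A0 : ∀ v, v ≠ 0 → (h v 0 = 0 ↔ v 0 = 0) := by
    intro v hv
    have := hD _ _ v z2 z3 hv
    rw [e2, e3, D_apply, D_apply] at this
    simpa [n2, n3] using this
  have A1 : ∀ v, v ≠ 0 → (h v 1 = 0 ↔ v 1 = 0) := by
    intro v hv
    have := hD _ _ v z1 z3 hv
    rw [e1, e3, D_apply, D_apply] at this
    simpa [n1, n3] using this
  have A2 : ∀ v, v ≠ 0 → (h v 2 = 0 ↔ v 2 = 0) := by
    intro v hv
    have := hD _ _ v z1 z2 hv
    rw [e1, e2, D_apply, D_apply] at this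
    simpa [n1, n2] using this
  have B01 : ∀ v, v ≠ 0 → v 0 = v 1 → h v 0 = h v 1 := by
    intro v hv hh
    have := (hD _ _ v z3 z4 hv).2 (by rw [D_apply]; simp [hh])
    rw [e3, e4, D_apply] at this
    simp at this
    exact mul_left_cancel₀ n3 (by linear_combination -this)
  have B02 : ∀ v, v ≠ 0 → v 0 = v 2 → h v 0 = h v 2 := by
    intro v hv hh
    have := (hD _ _ v z2 z4 hv).2 (by rw [D_apply]; simp [hh])
    rw [e2, e4, D_apply] at this
    simp at this
    exact mul_left_cancel₀ n2 (by linear_combination this)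
  have zst : ∀ s t : K29, (![s, t, 1] : Fin 3 → K29) ≠ 0 := fun s t h => by simpa using congrFun h 2
  have hst : ∀ s t : K29, h ![s, t, 1] 2 ≠ 0 := by
    intro s t
    rw [Ne, A2 _ (zst s t)]; simp
  set a : K29 → K29 := fun s => h ![s, 0, 1] 0 / h ![s, 0, 1] 2 with ha
  have x0 : ∀ s t, h ![s, t, 1] 0 = a s * h ![s, t, 1] 2 := by
    intro s t
    have := (hD _ _ _ z2 (zst s 0) (zst s t)).2 (by rw [D_apply]; simp)
    rw [e2, D_apply] at this
    simp at this
    simp only [ha]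
    have := hst s 0
    field_simp
    apply mul_left_cancel₀ n2
    grind
  have x1 : ∀ s t, h ![s, t, 1] 1 = a t * h ![s, t, 1] 2 := by
    intro s t
    have h1 := (hD _ _ _ z1 (zst t t) (zst s t)).2 (by rw [D_apply]; simp)
    rw [e1, D_apply] at h1
    simp at h1
    have h2 := B01 _ (zst t t) (by simp)
    rw [x0 t t] at h2
    have h3 := hst t t
    apply mul_left_cancel₀ n1
    apply mul_left_cancel₀ h3
    rw [← h2] at h1
    linear_combination -h1
  have z5 : (![1, 1, 0] : Fin 3 → K29) ≠ 0 := fun h => by simpa using congrFun h 0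
  have y2 : h ![1, 1, 0] 2 = 0 := (A2 _ z5).2 (by simp)
  have y0 : h ![1, 1, 0] 0 ≠ 0 := by rw [Ne, A0 _ z5]; simp
  have y1 := B01 _ z5 (by simp)
  have hadd : ∀ s t, a (s + t) = a s + a t := by
    intro s t
    have h1 := (hD _ _ _ (zst s 0) z5 (zst (s + t) t)).2 (by rw [D_apply]; simp)
    have h3 : h ![s, 0, 1] 1 = 0 := (A1 _ (zst s 0)).2 (by simp)
    rw [D_apply, y2, ← y1, x0 s 0, x0 (s + t) t, x1 (s + t) t, h3] at h1
    apply mul_left_cancel₀ y0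
    apply mul_left_cancel₀ (hst s 0)
    apply mul_left_cancel₀ (hst (s + t) t)
    linear_combination -h1
  have hone : a 1 = 1 := by
    have := B02 _ (zst 1 0) (by simp)
    rw [x0 1 0] at this
    exact mul_right_cancel₀ (hst 1 0) (by rw [this, one_mul])
  have hid : ∀ s, a s = s := by
    have ha0 : a 0 = 0 := by
      have := hadd 0 0
      rw [add_zero] at this
      exact left_eq_add.1 this
    have : ∀ n : ℕ, a (n : K29) = n := by
      intro n
      induction n with
      | zero => simpa using ha0
      | succ n ih => rw [Nat.cast_succ, hadd, ih, hone]
    intro s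
    have h1 := this s.val
    rwa [ZMod.natCast_zmod_val] at h1
  have key : ∀ s t, h ![s, t, 1] = h ![s, t, 1] 2 • ![s, t, 1] := by
    intro s t
    ext i
    fin_cases i
    · simpa [hid, mul_comm] using x0 s t
    · simpa [hid, mul_comm] using x1 s t
    · simp
  have par : ∀ u v, u ≠ 0 → v ≠ 0 → (∀ w, (Matrix.of ![u, v, w]).det = 0) →
      h u 0 * h v 1 = h u 1 * h v 0 ∧ h u 0 * h v 2 = h u 2 * h v 0 ∧ h u 1 * h v 2 = h u 2 * h v 1 := by
    intro u v hu hv hw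
    have h1 := (hD u v _ hu hv z1).2 (hw _)
    have h2 := (hD u v _ hu hv z2).2 (hw _)
    have h3 := (hD u v _ hu hv z3).2 (hw _)
    rw [e1, D_apply] at h1
    rw [e2, D_apply] at h2
    rw [e3, D_apply] at h3
    simp at h1 h2 h3
    refine ⟨mul_right_cancel₀ n3 ?_, mul_right_cancel₀ n2 ?_, mul_right_cancel₀ n1 ?_⟩
    · linear_combination h3
    · linear_combination -h2
    · linear_combination h1
  by_cases hv2 : v 2 = 0
  · have h2 := (A2 v hv).2 hv2
    have h1 := (hD _ _ v (zst (v 0) (v 1)) z3 hv).2 (by rw [D_apply]; simp [hv2]; ring)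
    rw [D_apply, e3, h2, x0, x1, hid, hid] at h1
    simp at h1
    have h3 := hst (v 0) (v 1)
    refine cross_prop hv (h0 v hv) ?_ ?_ ?_
    · apply mul_left_cancel₀ n3
      apply mul_left_cancel₀ h3
      linear_combination -h1
    · rw [h2, hv2]; ring
    · rw [h2, hv2]; ring
  · obtain ⟨p1, p2, p3⟩ := par ![v 0 / v 2, v 1 / v 2, 1] v (zst _ _) hv (by
      intro w
      rw [D_apply]
      simp
      field_simp
      ring)
    have h3 := hst (v 0 / v 2) (v 1 / v 2)
    rw [x0, x1, hid, hid] at p1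
    rw [x0, hid] at p2
    rw [x1, hid] at p3
    refine cross_prop hv (h0 v hv) ?_ ?_ ?_
    · field_simp at p1
      linear_combination p1
    · field_simp at p2
      linear_combination p2
    · field_simp at p3
      linear_combination p3

theorem FT1 (h : (Fin 3 → K29) → (Fin 3 → K29)) (h0 : ∀ v, v ≠ 0 → h v ≠ 0)
    (hD : ∀ u v w, u ≠ 0 → v ≠ 0 → w ≠ 0 → ((Matrix.of ![h u, h v, h w]).det = 0 ↔ (Matrix.of ![u, v, w]).det = 0)) :
    ∃ A : Matrix (Fin 3) (Fin 3) K29, A.det ≠ 0 ∧ ∀ v, v ≠ 0 → ∃ c : K29, c ≠ 0 ∧ h v = c • A.mulVec v := by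
  have z1 : (![1, 0, 0] : Fin 3 → K29) ≠ 0 := fun h => by simpa using congrFun h 0
  have z2 : (![0, 1, 0] : Fin 3 → K29) ≠ 0 := fun h => by simpa using congrFun h 1
  have z3 : (![0, 0, 1] : Fin 3 → K29) ≠ 0 := fun h => by simpa using congrFun h 2
  have z4 : (![1, 1, 1] : Fin 3 → K29) ≠ 0 := fun h => by simpa using congrFun h 2
  set B : Matrix (Fin 3) (Fin 3) K29 := (Matrix.of ![h ![1, 0, 0], h ![0, 1, 0], h ![0, 0, 1]]).transpose with hB
  have hBd : B.det ≠ 0 := by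
    rw [hB, Matrix.det_transpose, Ne, hD _ _ _ z1 z2 z3, D_apply]
    simp
  have hBu : IsUnit B.det := isUnit_iff_ne_zero.2 hBd
  have b1 : h ![1, 0, 0] = B.mulVec ![1, 0, 0] := by
    ext i; fin_cases i <;> simp [hB, Matrix.mulVec, dotProduct, Fin.sum_univ_three]
  have b2 : h ![0, 1, 0] = B.mulVec ![0, 1, 0] := by
    ext i; fin_cases i <;> simp [hB, Matrix.mulVec, dotProduct, Fin.sum_univ_three]
  have b3 : h ![0, 0, 1] = B.mulVec ![0, 0, 1] := by
    ext i; fin_cases i <;> simp [hB, Matrix.mulVec, dotProduct, Fin.sum_univ_three]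
  set x := B⁻¹.mulVec (h ![1, 1, 1]) with hx
  have b4 : h ![1, 1, 1] = B.mulVec x := by
    rw [hx, Matrix.mulVec_mulVec, Matrix.mul_nonsing_inv _ hBu, Matrix.one_mulVec]
  have x0 : x 0 ≠ 0 := by
    intro hh
    have := (hD _ _ _ z4 z2 z3).1 (by rw [b4, b2, b3, D_mul, D_apply]; simp [hh])
    rw [D_apply] at this
    simp at this
  have x1 : x 1 ≠ 0 := by
    intro hh
    have := (hD _ _ _ z4 z1 z3).1 (by rw [b4, b1, b3, D_mul, D_apply]; simp [hh])
    rw [D_apply] at this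
    simp at this
  have x2 : x 2 ≠ 0 := by
    intro hh
    have := (hD _ _ _ z4 z1 z2).1 (by rw [b4, b1, b2, D_mul, D_apply]; simp [hh])
    rw [D_apply] at this
    simp at this
  set A := B * Matrix.diagonal x with hA
  have hAd : A.det ≠ 0 := by
    rw [hA, Matrix.det_mul, Matrix.det_diagonal, Fin.prod_univ_three]
    exact mul_ne_zero hBd (mul_ne_zero (mul_ne_zero x0 x1) x2)
  have hAu : IsUnit A.det := isUnit_iff_ne_zero.2 hAd
  have hAinv : ∀ u v, A.mulVec u = v → A⁻¹.mulVec v = u := by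
    rintro u v rfl
    rw [Matrix.mulVec_mulVec, Matrix.nonsing_inv_mul _ hAu, Matrix.one_mulVec]
  have hAinv' : ∀ v, A.mulVec (A⁻¹.mulVec v) = v := by
    intro v
    rw [Matrix.mulVec_mulVec, Matrix.mul_nonsing_inv _ hAu, Matrix.one_mulVec]
  have hAm : ∀ u, A.mulVec u = B.mulVec ![x 0 * u 0, x 1 * u 1, x 2 * u 2] := by
    intro u
    rw [hA, ← Matrix.mulVec_mulVec]
    congr 1
    ext i
    rw [Matrix.mulVec_diagonal]
    fin_cases i <;> simp
  have hx3 : x = ![x 0, x 1, x 2] := by ext i; fin_cases i <;> simp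
  refine ⟨A, hAd, fun v hv => ?_⟩
  have g1 : ∀ v, v ≠ 0 → A⁻¹.mulVec (h v) ≠ 0 := by
    intro v hv hh
    apply h0 v hv
    rw [← hAinv' (h v), hh, Matrix.mulVec_zero]
  have g2 : ∀ u v w, u ≠ 0 → v ≠ 0 → w ≠ 0 → ((Matrix.of ![A⁻¹.mulVec (h u), A⁻¹.mulVec (h v), A⁻¹.mulVec (h w)]).det = 0 ↔
      (Matrix.of ![u, v, w]).det = 0) := by
    intro u v w hu hv hw
    have hAi : A⁻¹.det ≠ 0 := by
      rw [Matrix.det_nonsing_inv, Ring.inverse_eq_inv']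
      exact inv_ne_zero hAd
    rw [D_mul, mul_eq_zero, or_iff_left hAi, hD u v w hu hv hw]
  have g3 : A⁻¹.mulVec (h ![1, 0, 0]) = ![(x 0)⁻¹, 0, 0] := by
    apply hAinv
    rw [hAm, b1]; simp [x0]
  have g4 : A⁻¹.mulVec (h ![0, 1, 0]) = ![0, (x 1)⁻¹, 0] := by
    apply hAinv
    rw [hAm, b2]; simp [x1]
  have g5 : A⁻¹.mulVec (h ![0, 0, 1]) = ![0, 0, (x 2)⁻¹] := by
    apply hAinv
    rw [hAm, b3]; simp [x2]
  have g6 : A⁻¹.mulVec (h ![1, 1, 1]) = ![1, 1, 1] := by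
    apply hAinv
    rw [hAm, b4]
    congr 1
    ext i; fin_cases i <;> simp
  obtain ⟨c, hc, e⟩ := FT0 (fun v => A⁻¹.mulVec (h v)) g1 g2
    (inv_ne_zero x0) (inv_ne_zero x1) (inv_ne_zero x2) g3 g4 g5 g6 hv
  refine ⟨c, hc, ?_⟩
  rw [← Matrix.mulVec_smul, ← e, hAinv']

theorem FT2 (h : (Fin 3 → K29) → (Fin 3 → K29)) (h0 : ∀ v, v ≠ 0 → h v ≠ 0)
    (hD : ∀ u v w, u ≠ 0 → v ≠ 0 → w ≠ 0 → ((Matrix.of ![h u, h v, h w]).det = 0 ↔ (Matrix.of ![u, v, w]).det = 0)) :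
    ∃ A : Matrix.SpecialLinearGroup (Fin 3) K29, ∀ v, v ≠ 0 → ∃ c : K29, c ≠ 0 ∧ h v = c • A.1.mulVec v := by
  obtain ⟨A, hA, h2⟩ := FT1 h h0 hD
  set d := (A.det)⁻¹ ^ 19 with hd
  have d0 : d ≠ 0 := pow_ne_zero _ (inv_ne_zero hA)
  have hc : d ^ 3 * A.det = 1 := by
    have h28 : (A.det)⁻¹ ^ 28 = 1 := ZMod.pow_card_sub_one_eq_one (p := 29) (inv_ne_zero hA)
    have : d ^ 3 = ((A.det)⁻¹ ^ 28) ^ 2 * (A.det)⁻¹ := by rw [hd]; ring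
    rw [this, h28, one_pow, one_mul, inv_mul_cancel₀ hA]
  refine ⟨⟨d • A, ?_⟩, fun v hv => ?_⟩
  · rw [Matrix.det_smul, Fintype.card_fin, hc]
  · obtain ⟨c, c0, e⟩ := h2 v hv
    refine ⟨c * d⁻¹, mul_ne_zero c0 (inv_ne_zero d0), ?_⟩
    rw [e]
    change _ = (c * d⁻¹) • (d • A).mulVec v
    rw [Matrix.smul_mulVec, smul_smul, mul_assoc, inv_mul_cancel₀ d0, mul_one]

theorem cube_one {c : K29} (h : c ^ 3 = 1) : c = 1 := by
  have c0 : c ≠ 0 := by rintro rfl; simp at h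
  have h28 : c ^ 28 = 1 := ZMod.pow_card_sub_one_eq_one (p := 29) c0
  have : c ^ 28 = (c ^ 3) ^ 9 * c := by ring
  rw [this, h, one_pow, one_mul] at h28
  exact h28

/-- a matrix in `SL₃` for which every vector is an eigenvector is the identity -/
theorem SL_scalar (A : Matrix.SpecialLinearGroup (Fin 3) K29)
    (h : ∀ v, v ≠ 0 → ∃ c : K29, A.1.mulVec v = c • v) : A = 1 := by
  have z1 : (![1, 0, 0] : Fin 3 → K29) ≠ 0 := fun h => by simpa using congrFun h 0
  have z2 : (![0, 1, 0] : Fin 3 → K29) ≠ 0 := fun h => by simpa using congrFun h 1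
  have z3 : (![0, 0, 1] : Fin 3 → K29) ≠ 0 := fun h => by simpa using congrFun h 2
  have z4 : (![1, 1, 1] : Fin 3 → K29) ≠ 0 := fun h => by simpa using congrFun h 2
  obtain ⟨c1, h1⟩ := h _ z1
  obtain ⟨c2, h2⟩ := h _ z2
  obtain ⟨c3, h3⟩ := h _ z3
  obtain ⟨c, h4⟩ := h _ z4
  have m : ∀ (v : Fin 3 → K29) i, A.1.mulVec v i = A.1 i 0 * v 0 + A.1 i 1 * v 1 + A.1 i 2 * v 2 := by
    intro v i
    simp [Matrix.mulVec, dotProduct, Fin.sum_univ_three]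
  have q1 : ∀ i, A.1 i 0 = c1 * (![1, 0, 0] : Fin 3 → K29) i := fun i => by
    have := congrFun h1 i
    rw [m] at this
    simpa using this
  have q2 : ∀ i, A.1 i 1 = c2 * (![0, 1, 0] : Fin 3 → K29) i := fun i => by
    have := congrFun h2 i
    rw [m] at this
    simpa using this
  have q3 : ∀ i, A.1 i 2 = c3 * (![0, 0, 1] : Fin 3 → K29) i := fun i => by
    have := congrFun h3 i
    rw [m] at this
    simpa using this
  have q4 : ∀ i, A.1 i 0 + A.1 i 1 + A.1 i 2 = c := fun i => by
    have := congrFun h4 i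
    rw [m] at this
    fin_cases i <;> simpa using this
  have e1 : c1 = c := by have := q4 0; rw [q1, q2, q3] at this; simpa using this
  have e2 : c2 = c := by have := q4 1; rw [q1, q2, q3] at this; simpa using this
  have e3 : c3 = c := by have := q4 2; rw [q1, q2, q3] at this; simpa using this
  have hdet := A.2
  have hc : c ^ 3 = 1 := by
    rw [Matrix.det_fin_three] at hdet
    simp only [q1, q2, q3, e1, e2, e3] at hdet
    simp at hdet
    rw [← hdet]; ring
  have hc1 := cube_one hc
  apply Subtype.ext
  have e : ∀ i j, A.1 i j = (1 : Matrix (Fin 3) (Fin 3) K29) i j := by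
    simp only [Fin.forall_fin_succ, Fin.forall_fin_zero, q1, q2, q3, e1, e2, e3, hc1,
      Matrix.one_apply]
    simp [q1, q2, q3, e1, e2, e3, hc1]
  ext i j
  exact e i j

theorem SL_center : Subgroup.center (Matrix.SpecialLinearGroup (Fin 3) K29) = ⊥ := by
  rw [eq_bot_iff]
  intro A hA
  obtain ⟨r, h1, h2⟩ := Matrix.SpecialLinearGroup.mem_center_iff.1 hA
  rw [Fintype.card_fin] at h1
  rw [cube_one h1, map_one] at h2
  rw [Subgroup.mem_bot]
  exact Subtype.ext h2.symm

theorem SL_card : Nat.card (Matrix.SpecialLinearGroup (Fin 3) K29) = 2 ^ 5 * 3 * 5 * 7 ^ 2 * 13 * 29 ^ 3 * 67 := by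
  have h1 := Matrix.card_GL_field (𝔽 := K29) 3
  rw [Fin.prod_univ_three, ZMod.card] at h1
  have hs : Function.Surjective (Matrix.GeneralLinearGroup.det : GL (Fin 3) K29 →* K29ˣ) := by
    intro u
    refine ⟨Matrix.GeneralLinearGroup.mkOfDetNeZero (Matrix.diagonal ![(u : K29), 1, 1]) ?_, ?_⟩
    · rw [Matrix.det_diagonal, Fin.prod_univ_three]; simp
    · ext
      simp [Matrix.GeneralLinearGroup.mkOfDetNeZero, Fin.prod_univ_three]
  have h2 : Nat.card (Matrix.GeneralLinearGroup.det : GL (Fin 3) K29 →* K29ˣ).ker * Nat.card K29ˣ = Nat.card (GL (Fin 3) K29) := by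
    rw [← Subgroup.card_mul_index (Matrix.GeneralLinearGroup.det : GL (Fin 3) K29 →* K29ˣ).ker, Subgroup.index_ker,
      MonoidHom.range_eq_top.2 hs, Subgroup.card_top]
  have h3 : Nat.card K29ˣ = 28 := by
    rw [Nat.card_eq_fintype_card, ZMod.card_units 29]
  have h4 : Nat.card (Matrix.SpecialLinearGroup (Fin 3) K29) =
      Nat.card (Matrix.GeneralLinearGroup.det : GL (Fin 3) K29 →* K29ˣ).ker := by
    refine Nat.card_congr (Equiv.ofBijective (fun A => ⟨(A : GL (Fin 3) K29), ?_⟩) ⟨?_, ?_⟩)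
    · rw [MonoidHom.mem_ker]; ext; simp
    · intro A B hAB
      have := congrArg (fun x => (x.1 : Matrix (Fin 3) (Fin 3) K29)) hAB
      exact Subtype.ext this
    · rintro ⟨A, hA⟩
      refine ⟨⟨A.1, ?_⟩, ?_⟩
      · rw [MonoidHom.mem_ker] at hA
        exact congrArg Units.val hA
      · apply Subtype.ext
        ext; rfl
  rw [h1, h3, ← h4] at h2
  have e0 : ((29 ^ 3 - 29 ^ ((0 : Fin 3) : ℕ)) * (29 ^ 3 - 29 ^ ((1 : Fin 3) : ℕ)) * (29 ^ 3 - 29 ^ ((2 : Fin 3) : ℕ)) : ℕ)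
      = (2 ^ 5 * 3 * 5 * 7 ^ 2 * 13 * 29 ^ 3 * 67) * 28 := by
    simp
  exact Nat.eq_of_mul_eq_mul_right (by norm_num : 0 < 28) (h2.trans e0)
end
end

section
section
variable {G : Type*} [Group G] [Finite G] {T : Set G} {S : TSetup G T}

theorem SL_ne (A : Matrix.SpecialLinearGroup (Fin 3) K29) {v : Fin 3 → K29} (hv : v ≠ 0) : A.1.mulVec v ≠ 0 := by
  intro h
  apply hv
  have h2 : (A⁻¹ * A).1.mulVec v = 0 := by
    rw [show (A⁻¹ * A).1 = (A⁻¹).1 * A.1 from rfl, ← Matrix.mulVec_mulVec, h, Matrix.mulVec_zero]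
  rw [inv_mul_cancel] at h2
  rw [show (1 : Matrix.SpecialLinearGroup (Fin 3) K29).1 = 1 from rfl, Matrix.one_mulVec] at h2
  exact h2

namespace Frame
variable (f : Frame S)

theorem exists_SL (g : G) : ∃ A : Matrix.SpecialLinearGroup (Fin 3) K29, ∀ v, v ≠ 0 → f.pt (A.1.mulVec v) = g • f.pt v := by
  obtain ⟨h, h0, h1, h2⟩ := f.exists_lift g
  obtain ⟨A, hA⟩ := FT2 h h0 h2
  refine ⟨A, fun v hv => ?_⟩
  obtain ⟨c, c0, e⟩ := hA v hv
  rw [← h1 v hv, e, f.pt_smul (SL_ne A hv) c0]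

theorem uniq_SL {A B : Matrix.SpecialLinearGroup (Fin 3) K29}
    (h : ∀ v, v ≠ 0 → f.pt (A.1.mulVec v) = f.pt (B.1.mulVec v)) : A = B := by
  have : B⁻¹ * A = 1 := by
    apply SL_scalar
    intro v hv
    obtain ⟨c, c0, e⟩ := f.pt_inj (SL_ne A hv) (SL_ne B hv) (h v hv)
    refine ⟨c, ?_⟩
    rw [show (B⁻¹ * A).1 = (B⁻¹).1 * A.1 from rfl, ← Matrix.mulVec_mulVec, e, Matrix.mulVec_smul,
      Matrix.mulVec_mulVec, show (B⁻¹).1 * B.1 = (B⁻¹ * B).1 from rfl, inv_mul_cancel,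
      show (1 : Matrix.SpecialLinearGroup (Fin 3) K29).1 = 1 from rfl, Matrix.one_mulVec]
  exact (inv_mul_eq_one.1 this).symm

theorem exists_hom : ∃ φ : G →* Matrix.SpecialLinearGroup (Fin 3) K29,
    ∀ g v, v ≠ 0 → f.pt ((φ g).1.mulVec v) = g • f.pt v := by
  choose φ hφ using f.exists_SL
  refine ⟨MonoidHom.mk' φ ?_, hφ⟩
  intro g h
  apply f.uniq_SL
  intro v hv
  rw [hφ _ _ hv, show (φ g * φ h).1 = (φ g).1 * (φ h).1 from rfl, ← Matrix.mulVec_mulVec, hφ _ _ (SL_ne _ hv), hφ _ _ hv,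
    mul_smul]

theorem kernel_trivial {H N : Subgroup G} (C : CohSetup H N) (K : Subgroup G) (hK : K.Normal)
    (hfix : ∀ k ∈ K, ∀ v, v ≠ 0 → k • f.pt v = f.pt v) : K = ⊥ := by
  have z1 : (![1, 0, 0] : Fin 3 → K29) ≠ 0 := fun h => by simpa using congrFun h 0
  have z2 : (![0, 1, 0] : Fin 3 → K29) ≠ 0 := fun h => by simpa using congrFun h 1
  have z3 : (![0, 0, 1] : Fin 3 → K29) ≠ 0 := fun h => by simpa using congrFun h 2
  have hKe : ∀ k ∈ K, k ∈ f.e.sg → k = 1 := by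
    intro k hk hke
    exact XX_free (f.pt_X_mem (v := ![0, 0, 1]) (by simp)) hke (hfix k hk _ z3)
  have hpq : f.pt ![1, 0, 0] ≠ f.pt ![0, 1, 0] := by
    intro h
    obtain ⟨c, _, e⟩ := f.pt_inj z1 z2 h
    simpa using congrFun e 0
  have hfe : ∀ k ∈ K, k • f.e = f.e := by
    intro k hk
    by_contra hne
    have h1 := (f.e_eq z1).2 (by simp)
    have h2 := (f.e_eq z2).2 (by simp)
    have h1' := h1.smul k
    have h2' := h2.smul k
    rw [hfix k hk _ z1] at h1'
    rw [hfix k hk _ z2] at h2'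
    exact hpq (uniq_par h1 h1'.symm h2 h2'.symm hne)
  have hcomm : ∀ k ∈ K, ∀ u ∈ f.e.sg, k * u = u * k := by
    intro k hk u hu
    have a1 : k * u * k⁻¹ ∈ f.e.sg := by
      have := conj_mem_smul (g := k) hu
      rwa [hfe k hk] at this
    have a2 : k * u * k⁻¹ * u⁻¹ ∈ f.e.sg := mul_mem a1 (inv_mem hu)
    have a3 : k * u * k⁻¹ * u⁻¹ ∈ K := by
      have := mul_mem hk (hK.conj_mem _ (inv_mem hk) u)
      have e : k * u * k⁻¹ * u⁻¹ = k * (u * k⁻¹ * u⁻¹) := by group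
      rwa [e]
    have := hKe _ a3 a2
    rw [mul_inv_eq_one, mul_inv_eq_iff_eq_mul] at this
    exact this
  have hdvd : Nat.card K ∣ 682892 := by
    rw [← cent_card S (VV_T f.e f.ha f.a1)]
    apply Subgroup.card_dvd_of_le
    intro k hk
    rw [Subgroup.mem_centralizer_singleton_iff]
    exact hcomm k hk _ f.ha
  have hHK : ∀ k ∈ K, k ∈ H → k = 1 := by
    intro k hk hkH
    by_contra h1
    have : f.e.sg ≤ H := fun u hu => C.cent k hkH h1 u (hcomm k hk u hu).symm
    have := Subgroup.card_dvd_of_le this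
    rw [VV_card, C.cardH] at this
    norm_num at this
  have hmod : Nat.card K ≡ 1 [MOD 67] := by
    have : Fact (Nat.Prime 67) := ⟨by norm_num⟩
    obtain ⟨y, hy⟩ := exists_prime_orderOf_dvd_card' (G := H) 67 (by rw [C.cardH]; norm_num)
    have hy' : orderOf (y : G) = 67 := by rw [Subgroup.orderOf_coe, hy]
    have hy1 : (y : G) ≠ 1 := by
      intro h
      rw [h, orderOf_one] at hy'
      norm_num at hy'
    have hp : IsPGroup 67 (Subgroup.zpowers (y : G)) :=
      IsPGroup.of_card (n := 1) (by rw [Nat.card_zpowers, hy', pow_one])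
    let act : MulAction (Subgroup.zpowers (y : G)) K :=
      { smul := fun g k => ⟨g.1 * k.1 * g.1⁻¹, hK.conj_mem _ k.2 _⟩
        one_smul := fun k => Subtype.ext (by change 1 * k.1 * 1⁻¹ = k.1; simp)
        mul_smul := fun g h k => Subtype.ext (by
          change (g.1 * h.1) * k.1 * (g.1 * h.1)⁻¹ = g.1 * (h.1 * k.1 * h.1⁻¹) * g.1⁻¹
          group) }
    have h1 := hp.card_modEq_card_fixedPoints K
    have h2 : MulAction.fixedPoints (Subgroup.zpowers (y : G)) K = {1} := by
      ext k
      rw [Set.mem_singleton_iff, MulAction.mem_fixedPoints]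
      constructor
      · intro h
        have h3 := congrArg Subtype.val (h ⟨y, Subgroup.mem_zpowers _⟩)
        change y.1 * k.1 * y.1⁻¹ = k.1 at h3
        rw [mul_inv_eq_iff_eq_mul] at h3
        exact Subtype.ext (hHK k.1 k.2 (C.cent y y.2 hy1 k.1 h3.symm))
      · rintro rfl g
        apply Subtype.ext
        change g.1 * 1 * g.1⁻¹ = 1
        simp
    rw [h2] at h1
    simpa using h1
  have hcase : Nat.card K = 1 ∨ Nat.card K = 24389 := by
    rw [show 682892 = 28 * 29 ^ 3 by norm_num] at hdvd
    obtain ⟨d1, d2, h1, h2, e⟩ := (Nat.dvd_mul).1 hdvd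
    rw [← e] at hmod ⊢
    obtain ⟨i, hi, rfl⟩ := (Nat.dvd_prime_pow (by norm_num : Nat.Prime 29)).1 h2
    have hd : d1 ≤ 28 := Nat.le_of_dvd (by norm_num) h1
    clear e h2 hdvd
    unfold Nat.ModEq at hmod
    interval_cases i <;> interval_cases d1 <;> revert h1 hmod <;> decide
  rcases hcase with h | h
  · exact Subgroup.eq_bot_of_card_eq K h
  · exfalso
    have hq := Subgroup.card_eq_card_quotient_mul_card_subgroup K
    rw [h, C.cardG] at hq
    have hinj : Function.Injective ((QuotientGroup.mk' K).comp f.e.sg.subtype) := by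
      rw [injective_iff_map_eq_one]
      intro a ha
      have := (QuotientGroup.eq_one_iff (N := K) a.1).1 ha
      exact Subtype.ext (hKe _ this a.2)
    have h2 := Subgroup.card_dvd_of_injective _ hinj
    rw [VV_card] at h2
    obtain ⟨c, hc⟩ := h2
    rw [hc] at hq
    norm_num at hq
    omega

theorem exists_iso (f : Frame S) {H N : Subgroup G} (C : CohSetup H N) : Nonempty (G ≃* Matrix.SpecialLinearGroup (Fin 3) K29) := by
  obtain ⟨φ, hφ⟩ := f.exists_hom
  have hker : φ.ker = ⊥ := by
    apply f.kernel_trivial C _ inferInstance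
    intro k hk v hv
    rw [← hφ k v hv, MonoidHom.mem_ker.1 hk,
      show (1 : Matrix.SpecialLinearGroup (Fin 3) K29).1 = 1 from rfl, Matrix.one_mulVec]
  have hinj := (MonoidHom.ker_eq_bot_iff φ).1 hker
  have hb : Function.Bijective φ := by
    rw [Nat.bijective_iff_injective_and_card]
    exact ⟨hinj, by rw [SL_card, C.cardG]⟩
  exact ⟨MulEquiv.ofBijective φ hb⟩

end Frame

end

open scoped MatrixGroups in
theorem main_aux {G : Type*} [Group G] [Finite G]
    (hcard : Nat.card G = 2 ^ 5 * 3 * 5 * 7 ^ 2 * 13 * 29 ^ 3 * 67)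
    (hdeg13 : primeGraphDeg G 13 = 1)
    (hdeg67 : primeGraphDeg G 67 = 1) :
    Nonempty (G ≃* PSL(3, ZMod 29)) := by
  obtain ⟨H, N, C⟩ := exists_setup hcard (uniqNbr_of_deg (by norm_num) hdeg67) (uniqNbr_of_deg (by norm_num) hdeg13)
  obtain ⟨T, S⟩ := exists_TSetup C
  obtain ⟨f⟩ := exists_frame C S
  obtain ⟨φ⟩ := f.exists_iso C
  exact ⟨φ.trans (QuotientGroup.quotientBot.symm.trans (QuotientGroup.quotientMulEquivOfEq SL_center.symm))⟩
end

theorem L3_29_OD_characterizable (G : Type*) [Group G] [Finite G]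
    (hcard : Nat.card G = 2 ^ 5 * 3 * 5 * 7 ^ 2 * 13 * 29 ^ 3 * 67)
    (hdeg2 : primeGraphDeg G 2 = 4)
    (hdeg3 : primeGraphDeg G 3 = 3)
    (hdeg5 : primeGraphDeg G 5 = 3)
    (hdeg7 : primeGraphDeg G 7 = 4)
    (hdeg13 : primeGraphDeg G 13 = 1)
    (hdeg29 : primeGraphDeg G 29 = 2)
    (hdeg67 : primeGraphDeg G 67 = 1) :
    Nonempty (G ≃* PSL(3, ZMod 29)) := by
  exact main_aux hcard hdeg13 hdeg67
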